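/- For every ε > 0 there exists an online algorithm for the random graph process such that, with high probability, within the first ⌈(0.5 + ε)·n·log n⌉ steps the algorithm has selected at most (1 + ε)·n edges and the graph spanned by the selected edges is Hamiltonian. (This is the case K = 1 of the K-choice process and refutes the conjecture of Frieze, Krivelevich and Michaeli that for some ε > 0 no such algorithm exists.) -/

import Mathlib

/-!
The `K`-choice process on vertex set `Fin n`: a uniformly random ordering of the
(non-diagonal) edges of the complete graph on `Fin n` is revealed in consecutive
blocks ("rounds") of `K` edges; in each round an online algorithm (a function of the
edges presented so far) selects at most one of the `K` presented edges and adds it,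
immediately and irrevocably, to its graph.  `selected n K A σ t` is the set of edges
selected by the algorithm `A` after `t` rounds, when the random order is `σ`.
-/

namespace KChoice

/-- The edges of the complete graph on `Fin n`. -/
abbrev EdgeType (n : ℕ) := {e : Sym2 (Fin n) // ¬ e.IsDiag}

/-- The sample space: uniformly random orderings of the edges of `K_n`. -/
abbrev Omega (n : ℕ) := Fin (Fintype.card (EdgeType n)) ≃ EdgeType n

/-- The full ordered list of revealed edges. -/
def revealList {n : ℕ} (σ : Omega n) : List (Sym2 (Fin n)) :=
  List.ofFn fun i => (σ i).1

/-- An online algorithm: given the (ordered) list of all edges presented so far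
(including the current round's block), it outputs at most one edge. -/
def Alg (n : ℕ) := List (Sym2 (Fin n)) → Option (Sym2 (Fin n))

/-- The edges presented during the first `t` rounds, in order. -/
def presented (n K : ℕ) (σ : Omega n) (t : ℕ) : List (Sym2 (Fin n)) :=
  (revealList σ).take (K * t)

/-- The block of (at most `K`) edges presented at round `t`. -/
def block (n K : ℕ) (σ : Omega n) (t : ℕ) : List (Sym2 (Fin n)) :=
  ((revealList σ).take (K * t)).drop (K * (t - 1))

/-- The set of edges selected by the algorithm `A` within the first `t` rounds.
A choice at a given round only counts if it is one of the edges presented at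
that round (so at most one edge is selected per round). -/
def selected (n K : ℕ) (A : Alg n) (σ : Omega n) : ℕ → Finset (Sym2 (Fin n))
  | 0 => ∅
  | t + 1 =>
      selected n K A σ t ∪
        (match A (presented n K σ (t + 1)) with
          | some e => if e ∈ block n K σ (t + 1) then {e} else ∅
          | none => ∅)

/-- The algorithm's graph after `t` rounds. -/
def Bgraph (n K : ℕ) (A : Alg n) (σ : Omega n) (t : ℕ) : SimpleGraph (Fin n) :=
  SimpleGraph.fromEdgeSet (↑(selected n K A σ t) : Set (Sym2 (Fin n)))

/-- The probability, under a uniformly random ordering of the edges, of an event. -/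
noncomputable def pr (n : ℕ) (Good : Omega n → Prop) : ℝ :=
  (Nat.card {σ : Omega n // Good σ} : ℝ) / (Nat.card (Omega n) : ℝ)

end KChoice

namespace KChoice
open Finset

/-- The number of edges of the complete graph on `Fin n`. -/
abbrev numEdges (n : ℕ) : ℕ := Fintype.card (EdgeType n)

/-- The first `t` revealed edges. -/
def hist {n : ℕ} (σ : Omega n) (t : ℕ) : List (Sym2 (Fin n)) := (revealList σ).take t

lemma length_revealList {n : ℕ} (σ : Omega n) : (revealList σ).length = numEdges n := by
  simp [revealList]

lemma length_hist {n : ℕ} (σ : Omega n) {t : ℕ} (ht : t ≤ numEdges n) :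
    (hist σ t).length = t := by
  rw [hist, List.length_take, length_revealList, min_eq_left ht]

lemma hist_succ {n : ℕ} (σ : Omega n) (t : Fin (numEdges n)) :
    hist σ (t + 1) = hist σ t ++ [(σ t).1] := by
  have ht : (t : ℕ) < (revealList σ).length := by rw [length_revealList]; exact t.2
  unfold hist
  rw [List.take_succ_eq_append_getElem ht]
  simp [revealList]

lemma take_hist {n : ℕ} (σ : Omega n) {s t : ℕ} (h : s ≤ t) :
    (hist σ t).take s = hist σ s := by
  simp [hist, List.take_take, h]

lemma mem_hist {n : ℕ} (σ : Omega n) (t : ℕ) (e : Sym2 (Fin n)) :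
    e ∈ hist σ t ↔ ∃ i : Fin (numEdges n), (i : ℕ) < t ∧ (σ i).1 = e := by
  simp only [hist, List.mem_take_iff_getElem, revealList, List.length_ofFn, List.getElem_ofFn]
  constructor
  · rintro ⟨i, hi, rfl⟩
    exact ⟨⟨i, lt_of_lt_of_le hi (min_le_right _ _)⟩, lt_of_lt_of_le hi (min_le_left _ _), rfl⟩
  · rintro ⟨i, hi, rfl⟩
    exact ⟨i, lt_min hi i.2, rfl⟩

lemma hist_swap {n : ℕ} (σ : Omega n) {t i : Fin (numEdges n)} (h : t ≤ i) :
    hist ((Equiv.swap t i).trans σ) t = hist σ t := by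
  apply List.ext_getElem
  · rw [length_hist _ t.2.le, length_hist _ t.2.le]
  · intro k h1 h2
    rw [length_hist _ t.2.le] at h1
    simp only [hist, revealList, List.getElem_take, List.getElem_ofFn, Equiv.trans_apply]
    congr 2
    apply Equiv.swap_apply_of_ne_of_ne
    · intro hh; rw [Fin.ext_iff] at hh; simp at hh; omega
    · intro hh; rw [Fin.ext_iff] at hh; rw [Fin.le_def] at h; simp at hh; omega

instance nonempty_omega (n : ℕ) : Nonempty (Omega n) :=
  ⟨(Fintype.equivFin (EdgeType n)).symm⟩

/-- Expectation over a uniformly random ordering. -/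
noncomputable def mean (n : ℕ) (f : Omega n → ℝ) : ℝ :=
  (∑ σ, f σ) / (Fintype.card (Omega n) : ℝ)

lemma card_omega_pos (n : ℕ) : (0 : ℝ) < (Fintype.card (Omega n) : ℝ) := by
  exact_mod_cast Fintype.card_pos

lemma mean_mono {n : ℕ} {f g : Omega n → ℝ} (h : ∀ σ, f σ ≤ g σ) : mean n f ≤ mean n g :=
  div_le_div_of_nonneg_right (Finset.sum_le_sum fun σ _ => h σ) (card_omega_pos n).le

lemma mean_const_mul {n : ℕ} (c : ℝ) (f : Omega n → ℝ) :
    mean n (fun σ => c * f σ) = c * mean n f := by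
  rw [mean, mean, ← Finset.mul_sum, mul_div_assoc]

lemma mean_const (n : ℕ) (c : ℝ) : mean n (fun _ => c) = c := by
  have := (card_omega_pos n).ne'
  simp only [mean, Finset.sum_const, Finset.card_univ, nsmul_eq_mul]
  field_simp

open Classical in
lemma pr_eq_mean (n : ℕ) (P : Omega n → Prop) :
    pr n P = mean n (fun σ => if P σ then 1 else 0) := by
  rw [pr, mean, Nat.card_eq_fintype_card, Nat.card_eq_fintype_card, Fintype.card_subtype]
  simp

lemma pr_mono {n : ℕ} {P Q : Omega n → Prop} (h : ∀ σ, P σ → Q σ) : pr n P ≤ pr n Q := by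
  classical
  rw [pr_eq_mean, pr_eq_mean]
  apply mean_mono
  intro σ
  by_cases hP : P σ
  · simp [hP, h σ hP]
  · simp only [hP, if_false]; split_ifs <;> norm_num

lemma pr_le_one (n : ℕ) (P : Omega n → Prop) : pr n P ≤ 1 := by
  classical
  rw [pr_eq_mean]
  refine le_trans (mean_mono (g := fun _ => 1) fun σ => ?_) (mean_const n 1).le
  split_ifs <;> norm_num

lemma pr_or_le {n : ℕ} (P Q : Omega n → Prop) :
    pr n (fun σ => P σ ∨ Q σ) ≤ pr n P + pr n Q := by
  classical
  rw [pr_eq_mean, pr_eq_mean, pr_eq_mean, mean, mean, mean, ← add_div, ← Finset.sum_add_distrib]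
  apply div_le_div_of_nonneg_right _ (card_omega_pos n).le
  apply Finset.sum_le_sum
  intro σ _
  by_cases hP : P σ <;> by_cases hQ : Q σ <;> simp [hP, hQ]

lemma pr_not {n : ℕ} (P : Omega n → Prop) : pr n (fun σ => ¬ P σ) = 1 - pr n P := by
  classical
  rw [pr_eq_mean, pr_eq_mean, eq_sub_iff_add_eq, ← mean_const n 1, mean, mean, mean, ← add_div,
    ← Finset.sum_add_distrib]
  congr 1
  apply Finset.sum_congr rfl
  intro σ _
  by_cases hP : P σ <;> simp [hP]

lemma pr_exists_le {n : ℕ} {ι : Type*} (s : Finset ι) (P : ι → Omega n → Prop) :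
    pr n (fun σ => ∃ i ∈ s, P i σ) ≤ ∑ i ∈ s, pr n (P i) := by
  classical
  induction s using Finset.induction_on with
  | empty =>
    rw [pr_eq_mean]; simp [mean]
  | insert a s ha ih =>
    rw [Finset.sum_insert ha]
    calc _ ≤ pr n (fun σ => P a σ ∨ ∃ i ∈ s, P i σ) := by
            apply pr_mono; simp
      _ ≤ _ := pr_or_le _ _
      _ ≤ _ := by gcongr

/-- Exchanging the `t`-th edge with a uniformly random later one preserves the expectation. -/
lemma mean_swap {n : ℕ} (t : Fin (numEdges n)) (f : Omega n → ℝ) :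
    mean n (fun σ => ∑ i ∈ Finset.univ.filter (fun i => t ≤ i), f ((Equiv.swap t i).trans σ)) =
      ((numEdges n : ℝ) - (t : ℕ)) * mean n f := by
  unfold mean
  rw [Finset.sum_comm]
  have key : ∀ i : Fin (numEdges n),
      ∑ σ : Omega n, f ((Equiv.swap t i).trans σ) = ∑ σ : Omega n, f σ := by
    intro i
    apply Fintype.sum_bijective (fun σ : Omega n => ((Equiv.swap t i).trans σ : Omega n))
    · apply Function.Involutive.bijective
      intro σ
      ext x
      simp
    · intro σ; rfl
  rw [Finset.sum_congr rfl (fun i _ => key i), Finset.sum_const, nsmul_eq_mul, mul_div_assoc]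
  congr 1
  have : (Finset.univ.filter (fun i => t ≤ i)) = Finset.Ici t := by ext; simp
  rw [this, Fin.card_Ici, Nat.cast_sub t.2.le]

open Classical in
/-- The number of unrevealed edges that satisfy `B`. -/
noncomputable def avail {n : ℕ} (B : Sym2 (Fin n) → Prop) (σ : Omega n) (t : ℕ) : ℕ :=
  (Finset.univ.filter (fun i : Fin (numEdges n) => t ≤ (i : ℕ) ∧ B (σ i).1)).card

/-- If the conditional expectation of `Z` grows by a factor at most `c` in each step, then the
expectation grows by a factor at most `c` in each step. -/
lemma mean_hist_le {n : ℕ} (Z : List (Sym2 (Fin n)) → ℝ) (c : ℝ) (hc : 0 ≤ c) {t₀ t₁ : ℕ}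
    (h01 : t₀ ≤ t₁) (h1 : t₁ ≤ numEdges n)
    (hZ : ∀ (σ : Omega n) (t : Fin (numEdges n)), t₀ ≤ (t : ℕ) → (t : ℕ) < t₁ →
      ∑ i ∈ Finset.univ.filter (fun i => t ≤ i), Z (hist σ t ++ [(σ i).1]) ≤
        ((numEdges n : ℝ) - (t : ℕ)) * (c * Z (hist σ t))) :
    mean n (fun σ => Z (hist σ t₁)) ≤ c ^ (t₁ - t₀) * mean n (fun σ => Z (hist σ t₀)) := by
  induction t₁, h01 using Nat.le_induction with
  | base => simp
  | succ t₁ h ih =>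
    have ih' := ih (by omega) (fun σ t ht1 ht2 => hZ σ t ht1 (by omega))
    let t : Fin (numEdges n) := ⟨t₁, by omega⟩
    have hpos : (0 : ℝ) < (numEdges n : ℝ) - (t : ℕ) := by
      have : ((t : ℕ) : ℝ) < numEdges n := by exact_mod_cast t.2
      linarith
    have h2 := mean_swap t (fun σ => Z (hist σ (t₁ + 1)))
    have h3 : mean n (fun σ => ∑ i ∈ Finset.univ.filter (fun i => t ≤ i),
        Z (hist ((Equiv.swap t i).trans σ) (t₁ + 1))) ≤
        ((numEdges n : ℝ) - (t : ℕ)) * (c * mean n (fun σ => Z (hist σ t₁))) := by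
      rw [← mean_const_mul, ← mean_const_mul]
      apply mean_mono
      intro σ
      refine le_trans (le_of_eq ?_) (hZ σ t h (by simp [t]))
      apply Finset.sum_congr rfl
      intro i hi
      have hi' : t ≤ i := by simpa using hi
      have := hist_succ ((Equiv.swap t i).trans σ : Omega n) t
      simp only [t] at this ⊢
      rw [this]
      have h4 := hist_swap σ hi'
      simp only [t] at h4
      rw [h4]
      simp
    rw [h2] at h3
    have h5 := le_of_mul_le_mul_left h3 hpos
    calc _ ≤ c * mean n (fun σ => Z (hist σ t₁)) := h5
      _ ≤ c * (c ^ (t₁ - t₀) * mean n (fun σ => Z (hist σ t₀))) := by gcongr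
      _ = _ := by rw [Nat.succ_sub h, pow_succ]; ring

open Classical in
/-- Exponential moment bound for a counter of a random graph process. -/
lemma exp_moment_le {n : ℕ} (θ p : ℝ) (c : List (Sym2 (Fin n)) → ℕ)
    (Good : List (Sym2 (Fin n)) → Prop) (B : List (Sym2 (Fin n)) → Sym2 (Fin n) → Prop)
    {t₀ t₁ : ℕ} (h01 : t₀ ≤ t₁) (h1 : t₁ ≤ numEdges n)
    (hc : ∀ (σ : Omega n) (t i : Fin (numEdges n)), t₀ ≤ (t : ℕ) → (t : ℕ) < t₁ → t ≤ i →
      Good (hist σ t) →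
      θ * c (hist σ t ++ [(σ i).1]) ≤
        θ * c (hist σ t) + if B (hist σ t) (σ i).1 then θ else 0)
    (hav : ∀ (σ : Omega n) (t : Fin (numEdges n)), t₀ ≤ (t : ℕ) → (t : ℕ) < t₁ → Good (hist σ t) →
      (Real.exp θ - 1) * (avail (B (hist σ t)) σ t) ≤
        (Real.exp θ - 1) * (p * ((numEdges n : ℝ) - (t : ℕ))))
    (h0 : ∀ σ : Omega n, θ * c (hist σ t₀) ≤ 0) :
    mean n (fun σ => if ∀ t, t₀ ≤ t → t < t₁ → Good (hist σ t) then
        Real.exp (θ * c (hist σ t₁)) else 0) ≤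
      Real.exp ((Real.exp θ - 1) * p * ((t₁ : ℝ) - t₀)) := by
  let Z : List (Sym2 (Fin n)) → ℝ := fun h =>
    if ∀ t, t₀ ≤ t → t < h.length → Good (h.take t) then Real.exp (θ * c h) else 0
  have hZnn : ∀ h, 0 ≤ Z h := by
    intro h; simp only [Z]; split_ifs; exact (Real.exp_pos _).le; exact le_rfl
  have key := mean_hist_le Z (Real.exp ((Real.exp θ - 1) * p)) (Real.exp_pos _).le h01 h1 (by
    intro σ t ht0 ht1
    have hlen : (hist σ t).length = t := length_hist σ t.2.le
    by_cases hG : (∀ s, t₀ ≤ s → s < (t : ℕ) → Good (hist σ s)) ∧ Good (hist σ t)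
    · obtain ⟨hG1, hG2⟩ := hG
      have hZt : Z (hist σ t) = Real.exp (θ * c (hist σ t)) := by
        simp only [Z]
        rw [if_pos]
        intro s hs1 hs2
        rw [take_hist σ (by omega)]
        exact hG1 s hs1 (by omega)
      have hle : ∀ i ∈ Finset.univ.filter (fun i => t ≤ i), Z (hist σ t ++ [(σ i).1]) ≤
          Z (hist σ t) * (1 + (Real.exp θ - 1) * (if B (hist σ t) (σ i).1 then 1 else 0)) := by
        intro i hi
        have hi' : t ≤ i := by simpa using hi
        have : Z (hist σ t ++ [(σ i).1]) ≤ Real.exp (θ * c (hist σ t ++ [(σ i).1])) := by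
          simp only [Z]; split_ifs
          · exact le_rfl
          · exact (Real.exp_pos _).le
        refine this.trans ?_
        have h3 := hc σ t i ht0 ht1 hi' hG2
        rw [hZt]
        refine (Real.exp_le_exp.2 h3).trans (le_of_eq ?_)
        rw [Real.exp_add]
        split_ifs <;> simp
      refine (Finset.sum_le_sum hle).trans ?_
      rw [← Finset.mul_sum, Finset.sum_add_distrib, ← Finset.mul_sum]
      have hcard : ∑ i ∈ Finset.univ.filter (fun i => t ≤ i), (1 : ℝ) =
          (numEdges n : ℝ) - (t : ℕ) := by
        have : (Finset.univ.filter (fun i => t ≤ i)) = Finset.Ici t := by ext; simp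
        rw [this, Finset.sum_const, nsmul_eq_mul, mul_one, Fin.card_Ici, Nat.cast_sub t.2.le]
      have hav' : ∑ i ∈ Finset.univ.filter (fun i => t ≤ i),
          (if B (hist σ t) (σ i).1 then (1 : ℝ) else 0) = avail (B (hist σ t)) σ t := by
        rw [Finset.sum_boole, Finset.filter_filter]
        rfl
      rw [hcard, hav']
      have hN : (0 : ℝ) ≤ (numEdges n : ℝ) - (t : ℕ) := by
        have : ((t : ℕ) : ℝ) < numEdges n := by exact_mod_cast t.2
        linarith
      have h4 := hav σ t ht0 ht1 hG2
      have h5 := Real.add_one_le_exp ((Real.exp θ - 1) * p)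
      have h6 := hZnn (hist σ t)
      calc _ ≤ Z (hist σ t) * (((numEdges n : ℝ) - (t : ℕ)) *
              ((Real.exp θ - 1) * p + 1)) := by
            apply mul_le_mul_of_nonneg_left _ h6
            nlinarith
        _ ≤ Z (hist σ t) * (((numEdges n : ℝ) - (t : ℕ)) * Real.exp ((Real.exp θ - 1) * p)) := by
            gcongr
        _ = _ := by ring
    · have hz : ∀ i ∈ Finset.univ.filter (fun i => t ≤ i), Z (hist σ t ++ [(σ i).1]) = 0 := by
        intro i hi
        simp only [Z]
        rw [if_neg]
        intro hh
        apply hG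
        have h7 : ∀ s, t₀ ≤ s → s ≤ (t : ℕ) → Good (hist σ s) := by
          intro s hs1 hs2
          have := hh s hs1 (by simp [hlen]; omega)
          rw [List.take_append_of_le_length (by omega), take_hist σ hs2] at this
          exact this
        exact ⟨fun s a b => h7 s a b.le, h7 t ht0 le_rfl⟩
      rw [Finset.sum_congr rfl hz]
      have hN : (0 : ℝ) ≤ (numEdges n : ℝ) - (t : ℕ) := by
        have : ((t : ℕ) : ℝ) < numEdges n := by exact_mod_cast t.2
        linarith
      have := hZnn (hist σ t)
      simp only [Finset.sum_const_zero]
      positivity)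
  have e1 : ∀ σ : Omega n, Z (hist σ t₁) = if ∀ t, t₀ ≤ t → t < t₁ → Good (hist σ t) then
        Real.exp (θ * c (hist σ t₁)) else 0 := by
    intro σ
    simp only [Z, length_hist σ h1]
    congr 1
    apply propext
    constructor
    · intro h t a b
      have := h t a b
      rwa [take_hist σ b.le] at this
    · intro h t a b
      rw [take_hist σ b.le]; exact h t a b
  have e2 : mean n (fun σ => Z (hist σ t₀)) ≤ 1 := by
    rw [← mean_const n 1]
    apply mean_mono
    intro σ
    simp only [Z]
    split_ifs
    · rw [Real.exp_le_one_iff]; exact h0 σ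
    · norm_num
  rw [← funext e1]
  refine key.trans ?_
  calc _ ≤ Real.exp ((Real.exp θ - 1) * p) ^ (t₁ - t₀) * 1 := by gcongr
    _ = _ := by
      rw [mul_one, ← Real.exp_nat_mul, Nat.cast_sub h01]
      ring_nf

/-- Lower tail bound for a counter that increases whenever an edge of `B` is revealed. -/
lemma pr_lower_tail {n : ℕ} (b p : ℝ) (hb : 0 ≤ b) (M : ℝ) (c : List (Sym2 (Fin n)) → ℕ)
    (Good : List (Sym2 (Fin n)) → Prop) (B : List (Sym2 (Fin n)) → Sym2 (Fin n) → Prop)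
    (hp : 0 ≤ p)
    {t₀ t₁ : ℕ} (h01 : t₀ ≤ t₁) (h1 : t₁ ≤ numEdges n)
    (hmono : ∀ (σ : Omega n) (t i : Fin (numEdges n)), t₀ ≤ (t : ℕ) → (t : ℕ) < t₁ → t ≤ i →
      Good (hist σ t) → c (hist σ t) ≤ c (hist σ t ++ [(σ i).1]))
    (hc : ∀ (σ : Omega n) (t i : Fin (numEdges n)), t₀ ≤ (t : ℕ) → (t : ℕ) < t₁ → t ≤ i →
      Good (hist σ t) → B (hist σ t) (σ i).1 → c (hist σ t) + 1 ≤ c (hist σ t ++ [(σ i).1]))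
    (hav : ∀ (σ : Omega n) (t : Fin (numEdges n)), t₀ ≤ (t : ℕ) → (t : ℕ) < t₁ → Good (hist σ t) →
      p * (numEdges n : ℝ) ≤ avail (B (hist σ t)) σ t) :
    pr n (fun σ => (∀ t, t₀ ≤ t → t < t₁ → Good (hist σ t)) ∧ (c (hist σ t₁) : ℝ) ≤ M) ≤
      Real.exp (b * M - (1 - Real.exp (-b)) * p * ((t₁ : ℝ) - t₀)) := by
  classical
  have key := exp_moment_le (-b) p c Good B h01 h1 (by
    intro σ t i a1 a2 a3 a4
    split_ifs with hB
    · have : (c (hist σ t) + 1 : ℝ) ≤ c (hist σ t ++ [(σ i).1]) := by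
        exact_mod_cast hc σ t i a1 a2 a3 a4 hB
      nlinarith
    · have : (c (hist σ t) : ℝ) ≤ c (hist σ t ++ [(σ i).1]) := by
        exact_mod_cast hmono σ t i a1 a2 a3 a4
      nlinarith) (by
    intro σ t a1 a2 a3
    have h3 : Real.exp (-b) ≤ 1 := by rw [Real.exp_le_one_iff]; linarith
    have h4 := hav σ t a1 a2 a3
    have h5 : (0 : ℝ) ≤ ((t : ℕ) : ℝ) := by positivity
    apply mul_le_mul_of_nonpos_left _ (by linarith)
    nlinarith) (by
    intro σ
    have : (0 : ℝ) ≤ c (hist σ t₀) := by positivity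
    nlinarith)
  rw [pr_eq_mean]
  calc _ ≤ mean n (fun σ => Real.exp (b * M) *
        (if ∀ t, t₀ ≤ t → t < t₁ → Good (hist σ t) then
        Real.exp (-b * c (hist σ t₁)) else 0)) := by
        apply mean_mono
        intro σ
        split_ifs with h2 h3 h4
        · rw [← Real.exp_add, Real.one_le_exp_iff]
          nlinarith [h2.2]
        · exact absurd h2.1 h3
        · positivity
        · simp
    _ = Real.exp (b * M) * mean n (fun σ =>
        (if ∀ t, t₀ ≤ t → t < t₁ → Good (hist σ t) then
        Real.exp (-b * c (hist σ t₁)) else 0)) := mean_const_mul _ _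
    _ ≤ Real.exp (b * M) * Real.exp ((Real.exp (-b) - 1) * p * ((t₁ : ℝ) - t₀)) := by gcongr
    _ = _ := by rw [← Real.exp_add]; congr 1; ring

/-- Upper tail bound for a counter that increases by at most one, and only when an edge of `B` is
revealed. -/
lemma pr_upper_tail {n : ℕ} (b p : ℝ) (hb : 0 ≤ b) (M : ℝ) (c : List (Sym2 (Fin n)) → ℕ)
    (B : Sym2 (Fin n) → Prop) {t₁ : ℕ} (h1 : t₁ ≤ numEdges n) (hc0 : c [] = 0)
    (hc : ∀ h e, c (h ++ [e]) ≤ c h + 1) (hc' : ∀ h e, ¬ B e → c (h ++ [e]) ≤ c h)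
    (hav : ∀ (σ : Omega n) (t : Fin (numEdges n)), (t : ℕ) < t₁ →
      (avail B σ t : ℝ) ≤ p * ((numEdges n : ℝ) - (t : ℕ))) :
    pr n (fun σ => M ≤ (c (hist σ t₁) : ℝ)) ≤
      Real.exp (- b * M + (Real.exp b - 1) * p * t₁) := by
  classical
  have key := exp_moment_le b p c (fun _ => True) (fun _ => B) (Nat.zero_le t₁) h1 (by
    intro σ t i a1 a2 a3 a4
    split_ifs with hB
    · have : (c (hist σ t ++ [(σ i).1]) : ℝ) ≤ c (hist σ t) + 1 := by exact_mod_cast hc _ _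
      nlinarith
    · have : (c (hist σ t ++ [(σ i).1]) : ℝ) ≤ c (hist σ t) := by exact_mod_cast hc' _ _ hB
      nlinarith) (by
    intro σ t a1 a2 a3
    have h3 : 1 ≤ Real.exp b := by rwa [Real.one_le_exp_iff]
    have h4 := hav σ t a2
    apply mul_le_mul_of_nonneg_left h4 (by linarith)) (by
    intro σ
    simp [hist, hc0])
  simp only [implies_true, if_true] at key
  rw [pr_eq_mean]
  calc _ ≤ mean n (fun σ => Real.exp (-b * M) *
        (Real.exp (b * c (hist σ t₁)))) := by
        apply mean_mono
        intro σ
        split_ifs with h2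
        · rw [← Real.exp_add, Real.one_le_exp_iff]
          nlinarith
        · positivity
    _ = Real.exp (-b * M) * mean n (fun σ =>
        (Real.exp (b * c (hist σ t₁)))) :=
          mean_const_mul _ _
    _ ≤ Real.exp (-b * M) * Real.exp ((Real.exp b - 1) * p * ((t₁ : ℝ) - (0 : ℕ))) := by gcongr
    _ = _ := by rw [← Real.exp_add]; congr 1; push_cast; ring

/-- The edges of a set that have not been revealed yet are available. -/
lemma card_sub_le_avail {n : ℕ} (B : Sym2 (Fin n) → Prop) (F : Finset (Sym2 (Fin n)))
    (σ : Omega n) (t : ℕ) (hF : ∀ e ∈ F, ¬ e.IsDiag ∧ (e ∉ hist σ t → B e)) (k : ℕ)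
    (hk : (F.filter (fun e => e ∈ hist σ t)).card ≤ k) : F.card ≤ avail B σ t + k := by
  classical
  have h1 := Finset.card_filter_add_card_filter_not (s := F) (fun e => e ∈ hist σ t)
  have h2 : (F.filter (fun e => ¬ e ∈ hist σ t)).card ≤ avail B σ t := by
    unfold avail
    rw [← Finset.card_image_of_injective (f := fun i => (σ i).1)
      (Finset.univ.filter (fun i : Fin (numEdges n) => t ≤ (i : ℕ) ∧ B (σ i).1))
      (Subtype.val_injective.comp σ.injective)]
    apply Finset.card_le_card
    intro e he
    simp only [Finset.mem_filter] at he
    obtain ⟨h3, h4⟩ := hF e he.1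
    simp only [Finset.mem_image, Finset.mem_filter, Finset.mem_univ, true_and]
    refine ⟨σ.symm ⟨e, h3⟩, ⟨?_, ?_⟩, by simp⟩
    · by_contra hlt
      exact he.2 ((mem_hist σ t e).2 ⟨_, not_le.1 hlt, by simp⟩)
    · simpa using h4 he.2
  omega

lemma avail_le_card {n : ℕ} (B : Sym2 (Fin n) → Prop) (F : Finset (Sym2 (Fin n)))
    (hF : ∀ e, B e → e ∈ F) (σ : Omega n) (t : ℕ) : avail B σ t ≤ F.card := by
  classical
  unfold avail
  rw [← Finset.card_image_of_injective (f := fun i => (σ i).1)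
      (Finset.univ.filter (fun i : Fin (numEdges n) => t ≤ (i : ℕ) ∧ B (σ i).1))
      (Subtype.val_injective.comp σ.injective)]
  apply Finset.card_le_card
  intro e he
  simp only [Finset.mem_image, Finset.mem_filter, Finset.mem_univ, true_and] at he
  obtain ⟨i, ⟨_, h⟩, rfl⟩ := he
  exact hF _ h

end KChoice

namespace KChoice
open Finset

section ListPaths
variable {V : Type*}

/-- `y` immediately follows `x` in the list `l`. -/
def Nxt (l : List V) (x y : V) : Prop := [x, y] <:+: l

/-- `x` and `y` are neighbours in the list `l`. -/
def Consec (l : List V) (x y : V) : Prop := Nxt l x y ∨ Nxt l y x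

lemma Consec.symm {l : List V} {x y : V} (h : Consec l x y) : Consec l y x := Or.symm h

lemma not_nxt_nil (x y : V) : ¬ Nxt [] x y := by simp [Nxt]

lemma nxt_cons {w : V} {l : List V} {x y : V} :
    Nxt (w :: l) x y ↔ (x = w ∧ l.head? = some y) ∨ Nxt l x y := by
  unfold Nxt
  rw [List.infix_cons_iff]
  apply or_congr_left
  cases l with
  | nil => simp
  | cons a l => simp [eq_comm]

lemma nxt_append_cons {l₁ l₂ : List V} {w x y : V} :
    Nxt (l₁ ++ w :: l₂) x y ↔ Nxt (l₁ ++ [w]) x y ∨ Nxt (w :: l₂) x y := by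
  induction l₁ with
  | nil => simp [nxt_cons, not_nxt_nil]
  | cons a l ih =>
    rw [List.cons_append, List.cons_append, nxt_cons, nxt_cons, ih]
    cases l <;> simp [or_assoc]

lemma nxt_append_left {l₁ l₂ : List V} {x y : V} (h : Nxt l₁ x y) : Nxt (l₁ ++ l₂) x y :=
  h.trans (List.prefix_append _ _).isInfix

lemma nxt_append_right {l₁ l₂ : List V} {x y : V} (h : Nxt l₂ x y) : Nxt (l₁ ++ l₂) x y :=
  h.trans (List.suffix_append _ _).isInfix

lemma nxt_reverse {l : List V} {x y : V} : Nxt l.reverse x y ↔ Nxt l y x := by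
  unfold Nxt
  rw [← List.reverse_infix]
  simp

lemma consec_reverse {l : List V} {x y : V} : Consec l.reverse x y ↔ Consec l x y := by
  simp [Consec, nxt_reverse, or_comm]

lemma Consec.append_left {l₁ l₂ : List V} {x y : V} (h : Consec l₁ x y) :
    Consec (l₁ ++ l₂) x y := h.imp nxt_append_left nxt_append_left

lemma Consec.append_right {l₁ l₂ : List V} {x y : V} (h : Consec l₂ x y) :
    Consec (l₁ ++ l₂) x y := h.imp nxt_append_right nxt_append_right

lemma Nxt.mem_left {l : List V} {x y : V} (h : Nxt l x y) : x ∈ l := h.subset (by simp)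

lemma Nxt.mem_right {l : List V} {x y : V} (h : Nxt l x y) : y ∈ l := h.subset (by simp)

lemma Consec.mem_right {l : List V} {x y : V} (h : Consec l x y) : y ∈ l :=
  h.elim Nxt.mem_right Nxt.mem_left

lemma nxt_middle (l₁ l₂ : List V) (x y : V) : Nxt (l₁ ++ x :: y :: l₂) x y :=
  ⟨l₁, l₂, by simp⟩

lemma Nxt.right_unique {l : List V} (hl : l.Nodup) {x y z : V} (h : Nxt l x y) (h' : Nxt l x z) :
    y = z := by
  induction l with
  | nil => exact absurd h (not_nxt_nil _ _)
  | cons a l ih =>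
    rw [List.nodup_cons] at hl
    rw [nxt_cons] at h h'
    rcases h with ⟨rfl, h⟩ | h <;> rcases h' with ⟨h1, h'⟩ | h'
    · rw [h] at h'; exact Option.some.inj h'
    · exact absurd h'.mem_left hl.1
    · subst h1; exact absurd h.mem_left hl.1
    · exact ih hl.2 h h'

lemma Nxt.left_unique {l : List V} (hl : l.Nodup) {x y z : V} (h : Nxt l y x) (h' : Nxt l z x) :
    y = z := by
  rw [← nxt_reverse] at h h'
  exact Nxt.right_unique (List.nodup_reverse.2 hl) h h'

lemma not_nxt_getLast {l : List V} (hl : l.Nodup) {b y : V} (hb : l.getLast? = some b) :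
    ¬ Nxt l b y := by
  induction l with
  | nil => exact not_nxt_nil _ _
  | cons a l ih =>
    rw [List.nodup_cons] at hl
    rw [nxt_cons]
    rintro (⟨rfl, h⟩ | h)
    · cases l with
      | nil => simp at h
      | cons c l =>
        rw [List.getLast?_cons_cons] at hb
        exact hl.1 (List.mem_of_getLast? hb)
    · cases l with
      | nil => exact not_nxt_nil _ _ h
      | cons c l =>
        rw [List.getLast?_cons_cons] at hb
        exact ih hl.2 hb h

/-- The degree of a vertex of a graph. -/
noncomputable def deg (F : SimpleGraph V) (v : V) : ℕ := (F.neighborSet v).ncard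

lemma deg_mono [Finite V] {F G : SimpleGraph V} (h : F ≤ G) (v : V) : deg F v ≤ deg G v :=
  Set.ncard_le_ncard (fun _ hw => h hw) (Set.toFinite _)

lemma eq_of_deg_le_one [Finite V] {F : SimpleGraph V} {v a b : V} (h : deg F v ≤ 1)
    (ha : F.Adj v a) (hb : F.Adj v b) : a = b :=
  (Set.ncard_le_one (Set.toFinite _)).1 h a ha b hb

lemma eq_or_eq_of_deg_le_two [Finite V] {F : SimpleGraph V} {v a b c : V} (h : deg F v ≤ 2)
    (ha : F.Adj v a) (hb : F.Adj v b) (hab : a ≠ b) (hc : F.Adj v c) : c = a ∨ c = b := by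
  by_contra hcon
  push Not at hcon
  have h1 : ({a, b, c} : Set V) ⊆ F.neighborSet v := by
    rintro x (rfl | rfl | rfl) <;> assumption
  have h2 := Set.ncard_le_ncard h1 (Set.toFinite _)
  rw [Set.ncard_eq_three.2 ⟨a, b, c, hab, hcon.1.symm, hcon.2.symm, rfl⟩] at h2
  unfold deg at h
  omega

/-- A list is a path of `F` that contains, with each of its vertices, all edges of `F` at that
vertex. -/
def ClosedIn (F : SimpleGraph V) (l : List V) : Prop :=
  ∀ v ∈ l, ∀ w, F.Adj v w → Consec l v w

lemma ClosedIn.mem_of_reachable {F : SimpleGraph V} {l : List V} (h : ClosedIn F l) {v w : V}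
    (hv : v ∈ l) (hvw : F.Reachable v w) : w ∈ l := by
  obtain ⟨p⟩ := hvw
  induction p with
  | nil => exact hv
  | cons hadj p ih => exact ih (h _ hv _ hadj).mem_right

lemma reachable_of_isChain {F : SimpleGraph V} {l : List V} {y : V} (h : (y :: l).IsChain F.Adj)
    {v : V} (hv : v ∈ y :: l) : F.Reachable y v := by
  induction l generalizing y with
  | nil => simp at hv; subst hv; exact SimpleGraph.Reachable.refl _
  | cons a l ih =>
    rw [List.isChain_cons_cons] at h
    rw [List.mem_cons] at hv
    rcases hv with rfl | hv
    · exact SimpleGraph.Reachable.refl _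
    · exact h.1.reachable.trans (ih h.2 hv)

/-- In a graph with maximum degree at most two, a vertex of degree at most one starts a path that
exhausts its component. -/
lemma exists_closed_path [Finite V] {F : SimpleGraph V} (hF : ∀ v, deg F v ≤ 2) {y : V}
    (hy : deg F y ≤ 1) :
    ∃ q : List V, (y :: q).Nodup ∧ (y :: q).IsChain F.Adj ∧ ClosedIn F (y :: q) := by
  classical
  have := Fintype.ofFinite V
  let P : ℕ → Prop := fun k => ∃ q : List V, (y :: q).Nodup ∧ (y :: q).IsChain F.Adj ∧ q.length = k
  have h0 : P 0 := ⟨[], by simp, by simp, rfl⟩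
  have hb : ∀ k, P k → k ≤ Fintype.card V := by
    rintro k ⟨q, h1, -, rfl⟩
    have := h1.length_le_card
    simp at this; omega
  have hPk := Nat.findGreatest_spec (P := P) (Nat.zero_le (Fintype.card V)) h0
  obtain ⟨q, hnd, hch, hlen⟩ := hPk
  have hmax : ∀ w, w ∉ y :: q → ∀ b, (y :: q).getLast? = some b → ¬ F.Adj b w := by
    intro w hw b hb' hadj
    have hP : P (q.length + 1) := by
      refine ⟨q ++ [w], ?_, ?_, by simp⟩
      · rw [← List.cons_append, List.nodup_append]
        refine ⟨hnd, by simp, ?_⟩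
        intro a ha c hc
        simp at hc; subst hc
        exact fun h => hw (h ▸ ha)
      · rw [← List.cons_append, List.isChain_append]
        refine ⟨hch, by simp, ?_⟩
        intro x hx z hz
        rw [hb'] at hx
        simp at hx hz; subst hx; subst hz; exact hadj
    have := Nat.le_findGreatest (hb _ hP) hP
    omega
  refine ⟨q, hnd, hch, ?_⟩
  have inner : ∀ l₁ v c l₂, y :: q = l₁ ++ v :: c :: l₂ → ∀ w, F.Adj v w →
      Consec (y :: q) v w := by
    intro l₁ v c l₂ heq w hw
    rw [heq] at hnd hch ⊢
    have hvc : F.Adj v c := by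
      have := List.isChain_append.1 hch
      exact (List.isChain_cons_cons.1 this.2.1).1
    rcases List.eq_nil_or_concat l₁ with rfl | ⟨l₀, p, rfl⟩
    · simp at heq
      obtain ⟨rfl, -⟩ := heq
      have := eq_of_deg_le_one hy hvc hw
      subst this
      exact Or.inl (nxt_middle [] _ _ _)
    · rw [List.concat_eq_append] at hch hnd ⊢
      have hpv : F.Adj v p := by
        have := List.isChain_append.1 hch
        exact (this.2.2 p (by simp) v (by simp)).symm
      have hpc : p ≠ c := by
        rintro rfl
        rw [List.nodup_append] at hnd
        exact hnd.2.2 p (by simp) p (by simp) rfl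
      rcases eq_or_eq_of_deg_le_two (hF v) hpv hvc hpc hw with rfl | rfl
      · right
        rw [List.append_assoc]
        exact nxt_middle _ _ _ _
      · exact Or.inl (nxt_middle _ _ _ _)
  intro v hv w hw
  obtain ⟨l₁, l₂, heq⟩ := List.append_of_mem hv
  cases l₂ with
  | cons c l₂ => exact inner l₁ v c l₂ heq w hw
  | nil =>
    have hlast : (y :: q).getLast? = some v := by rw [heq]; simp
    have hwq : w ∈ y :: q := by
      by_contra hwq
      exact hmax w hwq v hlast hw
    obtain ⟨l₃, l₄, heq'⟩ := List.append_of_mem hwq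
    cases l₄ with
    | cons c l₄ => exact (inner l₃ w c l₄ heq' v hw.symm).symm
    | nil =>
      rw [heq'] at hlast
      simp at hlast
      exact absurd hlast.symm hw.ne

end ListPaths
end KChoice

namespace KChoice
open Finset

section Rotations
variable {V : Type*}

/-- A path of `G` that is a union of components of `F`. -/
structure GoodPath (G F : SimpleGraph V) (l : List V) : Prop where
  nodup : l.Nodup
  ne_nil : l ≠ []
  chain : l.IsChain G.Adj
  closed : ClosedIn F l

/-- A sparse linear forest `F` in `G`, with an expanding set `S` of isolated vertices of `F` such
that the endpoints of `F` outside `S` have many private neighbours in `S`. -/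
structure Ready [Fintype V] (G F : SimpleGraph V) (S : Finset V) (m : ℕ) : Prop where
  le : F ≤ G
  iso : ∀ v ∈ S, ∀ w, ¬ F.Adj v w
  deg_le : ∀ v, deg F v ≤ 2
  private_nbrs : ∃ P : V → Finset V, (∀ v, v ∉ S → deg F v ≤ 1 →
      P v ⊆ S ∧ 10 ≤ (P v).card ∧ ∀ y ∈ P v, G.Adj v y) ∧
      ∀ v w, v ∉ S → deg F v ≤ 1 → w ∉ S → deg F w ≤ 1 → v ≠ w → Disjoint (P v) (P w)
  reach : ∀ v, v ∉ S → ∃ w, w ∉ S ∧ deg F w ≤ 1 ∧ F.Reachable v w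
  pos : 1 ≤ m
  nonempty : S.Nonempty
  expand : ∀ R ⊆ S, R.Nonempty → R.card ≤ m → ∃ Y ⊆ S, Disjoint Y R ∧ 10 * R.card ≤ Y.card ∧
      ∀ y ∈ Y, ∃ r ∈ R, G.Adj r y
  connected : ∀ A ⊆ S, A.Nonempty → A ≠ S → ∃ a ∈ A, ∃ b ∈ S, b ∉ A ∧ G.Adj a b

lemma Ready.mono [Fintype V] {G G' F : SimpleGraph V} {S : Finset V} {m : ℕ}
    (h : Ready G F S m) (hG : G ≤ G') : Ready G' F S m where
  le := h.le.trans hG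
  iso := h.iso
  deg_le := h.deg_le
  private_nbrs := by
    obtain ⟨P, h1, h2⟩ := h.private_nbrs
    exact ⟨P, fun v hv hd => ⟨(h1 v hv hd).1, (h1 v hv hd).2.1,
      fun y hy => hG ((h1 v hv hd).2.2 y hy)⟩, h2⟩
  reach := h.reach
  pos := h.pos
  nonempty := h.nonempty
  expand := fun R hR hne hc => by
    obtain ⟨Y, h1, h2, h3, h4⟩ := h.expand R hR hne hc
    exact ⟨Y, h1, h2, h3, fun y hy => by obtain ⟨r, hr, ha⟩ := h4 y hy; exact ⟨r, hr, hG ha⟩⟩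
  connected := fun A hA hne hne' => by
    obtain ⟨a, ha, b, hb, hbA, hadj⟩ := h.connected A hA hne hne'
    exact ⟨a, ha, b, hb, hbA, hG hadj⟩

lemma GoodPath.mono {G G' F : SimpleGraph V} {l : List V} (h : GoodPath G F l) (hG : G ≤ G') :
    GoodPath G' F l := ⟨h.nodup, h.ne_nil, h.chain.imp fun _ _ hab => hG hab, h.closed⟩

lemma GoodPath.reverse {G F : SimpleGraph V} {l : List V} (h : GoodPath G F l) :
    GoodPath G F l.reverse where
  nodup := List.nodup_reverse.2 h.nodup
  ne_nil := by simpa using h.ne_nil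
  chain := by
    rw [List.isChain_reverse]
    exact h.chain.imp fun _ _ hab => hab.symm
  closed := fun v hv w hw => consec_reverse.2 (h.closed v (List.mem_reverse.1 hv) w hw)

open Classical in
/-- The number of vertices of a list that have degree at most one in `F`. -/
noncomputable def coreCount (F : SimpleGraph V) (l : List V) : ℕ :=
  l.countP (fun v => decide (deg F v ≤ 1))

lemma coreCount_perm {F : SimpleGraph V} {l l' : List V} (h : l.Perm l') :
    coreCount F l = coreCount F l' := h.countP_eq _

/-- One Pósa rotation at a vertex of `S`. -/
def Rot (G : SimpleGraph V) (S : Finset V) (l l' : List V) : Prop :=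
  ∃ l₁ z l₂ b, l = l₁ ++ z :: l₂ ∧ l₂.getLast? = some b ∧ G.Adj b z ∧ z ∈ S ∧
    l' = l₁ ++ z :: l₂.reverse

lemma Rot.perm {G : SimpleGraph V} {S : Finset V} {l l' : List V} (h : Rot G S l l') :
    l'.Perm l := by
  obtain ⟨l₁, z, l₂, b, rfl, -, -, -, rfl⟩ := h
  exact ((List.reverse_perm l₂).cons z).append_left l₁

lemma Rot.head {G : SimpleGraph V} {S : Finset V} {l l' : List V} (h : Rot G S l l') :
    l'.head? = l.head? := by
  obtain ⟨l₁, z, l₂, b, rfl, -, -, -, rfl⟩ := h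
  cases l₁ <;> simp

lemma Rot.goodPath {G F : SimpleGraph V} {S : Finset V} (hS : ∀ v ∈ S, ∀ w, ¬ F.Adj v w)
    {l l' : List V} (h : Rot G S l l') (hl : GoodPath G F l) : GoodPath G F l' := by
  have hp := h.perm
  obtain ⟨l₁, z, l₂, b, rfl, hb, hadj, hz, rfl⟩ := h
  refine ⟨hp.nodup_iff.2 hl.nodup, by simp, ?_, ?_⟩
  · have h1 := List.isChain_append.1 hl.chain
    rw [List.isChain_append]
    refine ⟨h1.1, ?_, by simpa using h1.2.2⟩
    rw [List.isChain_cons]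
    refine ⟨?_, ?_⟩
    · intro y hy
      rw [List.head?_reverse, hb] at hy
      simp at hy
      subst hy
      exact hadj.symm
    · rw [List.isChain_reverse]
      have := (List.isChain_cons.1 h1.2.1).2
      exact this.imp fun _ _ hab => hab.symm
  · have key : ∀ v w, F.Adj v w → Nxt (l₁ ++ z :: l₂) v w →
        Consec (l₁ ++ z :: l₂.reverse) v w := by
      intro v w hvw hn
      rw [nxt_append_cons] at hn
      rcases hn with hn | hn
      · exact Or.inl (nxt_append_cons.2 (Or.inl hn))
      · rw [nxt_cons] at hn
        rcases hn with ⟨rfl, -⟩ | hn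
        · exact absurd hvw (hS _ hz _)
        · right
          rw [nxt_append_cons, nxt_cons, nxt_reverse]
          exact Or.inr (Or.inr hn)
    intro v hv w hw
    rcases hl.closed v (hp.subset hv) w hw with h | h
    · exact key v w hw h
    · exact (key w v hw.symm h).symm

lemma Rot.consec_iff {G : SimpleGraph V} {S : Finset V} {l l' : List V} (hnd : l.Nodup)
    (h : Rot G S l l') {x : V} (hx : ∀ b, l.getLast? = some b → x ≠ b)
    (hx' : ∀ b, l'.getLast? = some b → x ≠ b ∧ ¬ Consec l x b) (y : V) :
    Consec l' x y ↔ Consec l x y := by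
  obtain ⟨l₁, z, l₂, b, rfl, hb, hadj, hz, rfl⟩ := h
  have hb' : x ≠ b := by
    apply hx b
    cases l₂ with
    | nil => simp at hb
    | cons a l => rw [List.getLast?_append, List.getLast?_cons_cons, hb]; rfl
  cases l₂ with
  | nil => simp
  | cons c l =>
    obtain ⟨h1, h2⟩ := hx' c (by
      rw [List.getLast?_append, List.reverse_cons, ← List.cons_append, List.getLast?_append]
      simp)
    have hxz : x ≠ z := by
      rintro rfl
      exact h2 (Or.inl (nxt_middle _ _ _ _))
    have e1 : (c :: l).reverse.head? = some b := by rw [List.head?_reverse, hb]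
    have e2 : (c :: l).head? = some c := rfl
    have k1 : ∀ u w, Nxt (l₁ ++ z :: (c :: l).reverse) u w ↔
        Nxt (l₁ ++ [z]) u w ∨ (u = z ∧ some b = some w) ∨ Nxt (c :: l) w u := by
      intro u w
      rw [nxt_append_cons, nxt_cons (w := z) (l := (c :: l).reverse), e1, nxt_reverse]
    have k2 : ∀ u w, Nxt (l₁ ++ z :: c :: l) u w ↔
        Nxt (l₁ ++ [z]) u w ∨ (u = z ∧ some c = some w) ∨ Nxt (c :: l) u w := by
      intro u w
      rw [nxt_append_cons, nxt_cons (w := z) (l := c :: l), e2]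
    unfold Consec
    rw [k1, k1, k2, k2]
    simp only [Option.some.injEq, hxz, hb'.symm, h1.symm, false_and, and_false, false_or]
    tauto

lemma reflTransGen_rot_perm {G : SimpleGraph V} {S : Finset V} {l l' : List V}
    (h : Relation.ReflTransGen (Rot G S) l l') : l'.Perm l := by
  induction h with
  | refl => exact List.Perm.refl _
  | tail _ h ih => exact h.perm.trans ih

lemma reflTransGen_rot_head {G : SimpleGraph V} {S : Finset V} {l l' : List V}
    (h : Relation.ReflTransGen (Rot G S) l l') : l'.head? = l.head? := by
  induction h with
  | refl => rfl
  | tail _ h ih => exact h.head.trans ih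

lemma reflTransGen_rot_goodPath {G F : SimpleGraph V} {S : Finset V}
    (hS : ∀ v ∈ S, ∀ w, ¬ F.Adj v w) {l l' : List V}
    (h : Relation.ReflTransGen (Rot G S) l l') (hl : GoodPath G F l) : GoodPath G F l' := by
  induction h with
  | refl => exact hl
  | tail _ h ih => exact h.goodPath hS ih

open Classical in
/-- The endpoints of the paths obtained from `l` by rotations. -/
noncomputable def rotEnds [Fintype V] (G : SimpleGraph V) (S : Finset V) (l : List V) : Finset V :=
  Finset.univ.filter fun b =>
    ∃ l', Relation.ReflTransGen (Rot G S) l l' ∧ l'.getLast? = some b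

lemma mem_rotEnds [Fintype V] {G : SimpleGraph V} {S : Finset V} {l : List V} {b : V} :
    b ∈ rotEnds G S l ↔
      ∃ l', Relation.ReflTransGen (Rot G S) l l' ∧ l'.getLast? = some b := by
  simp [rotEnds]

lemma consec_iff_of_rots [Fintype V] {G : SimpleGraph V} {S : Finset V} {l l' : List V}
    (hnd : l.Nodup) (h : Relation.ReflTransGen (Rot G S) l l') {x : V}
    (hx : x ∉ rotEnds G S l) (hx' : ∀ c ∈ rotEnds G S l, ¬ Consec l x c) (y : V) :
    Consec l' x y ↔ Consec l x y := by
  induction h generalizing y with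
  | refl => rfl
  | tail h1 h2 ih =>
    rw [← ih]
    have hmem := fun b => fun hb => mem_rotEnds (G := G) (S := S) (l := l) (b := b) |>.2 hb
    apply h2.consec_iff ((reflTransGen_rot_perm h1).nodup_iff.2 hnd)
    · rintro b hb rfl
      exact hx (hmem _ ⟨_, h1, hb⟩)
    · intro b hb
      have hbm := hmem b ⟨_, h1.tail h2, hb⟩
      refine ⟨?_, ?_⟩
      · rintro rfl; exact hx hbm
      · rw [ih]; exact hx' b hbm

/-- The `F`-degree of the last vertex of a good path is at most one. -/
lemma GoodPath.deg_last_le [Finite V] {G F : SimpleGraph V} {l : List V} (h : GoodPath G F l)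
    {b : V} (hb : l.getLast? = some b) : deg F b ≤ 1 := by
  unfold deg
  rw [Set.ncard_le_one (Set.toFinite _)]
  intro x hx y hy
  have hbl := List.mem_of_getLast? hb
  have h1 := (h.closed b hbl x hx).resolve_left (not_nxt_getLast h.nodup hb)
  have h2 := (h.closed b hbl y hy).resolve_left (not_nxt_getLast h.nodup hb)
  exact h1.left_unique h.nodup h2

/-- No good path contains more core vertices. -/
def MaxPath (G F : SimpleGraph V) (l : List V) : Prop :=
  GoodPath G F l ∧ ∀ l', GoodPath G F l' → coreCount F l' ≤ coreCount F l

lemma deg_eq_zero_of_isolated {F : SimpleGraph V} {v : V} (h : ∀ w, ¬ F.Adj v w) :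
    deg F v = 0 := by
  unfold deg
  have : F.neighborSet v = ∅ := by
    ext w; simp [h w]
  rw [this]; simp

lemma coreCount_append (F : SimpleGraph V) (l l' : List V) :
    coreCount F (l ++ l') = coreCount F l + coreCount F l' := by
  simp [coreCount, List.countP_append]

lemma coreCount_pos {F : SimpleGraph V} {l : List V} {v : V} (hv : v ∈ l) (hd : deg F v ≤ 1) :
    0 < coreCount F l := by
  unfold coreCount
  rw [List.countP_pos_iff]
  exact ⟨v, hv, by simpa using hd⟩

/-- A maximal good path contains all neighbours in `S` of its last vertex. -/
lemma MaxPath.mem_of_adj_last {G F : SimpleGraph V} {S : Finset V}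
    (hS : ∀ v ∈ S, ∀ w, ¬ F.Adj v w) {l : List V} (h : MaxPath G F l) {b z : V}
    (hb : l.getLast? = some b) (hz : z ∈ S) (hadj : G.Adj b z) : z ∈ l := by
  by_contra hzl
  have hg : GoodPath G F (l ++ [z]) := by
    refine ⟨?_, by simp, ?_, ?_⟩
    · rw [List.nodup_append]
      refine ⟨h.1.nodup, by simp, ?_⟩
      intro a ha c hc
      simp at hc; subst hc
      exact fun e => hzl (e ▸ ha)
    · rw [List.isChain_append]
      refine ⟨h.1.chain, by simp, ?_⟩
      intro x hx y hy
      rw [hb] at hx; simp at hx hy; subst hx; subst hy; exact hadj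
    · intro v hv w hw
      rw [List.mem_append] at hv
      rcases hv with hv | hv
      · exact (h.1.closed v hv w hw).append_left
      · simp at hv; subst hv; exact absurd hw (hS _ hz _)
  have h1 := h.2 _ hg
  rw [coreCount_append] at h1
  have h2 := coreCount_pos (F := F) (l := [z]) (v := z) (by simp)
    (by rw [deg_eq_zero_of_isolated (hS z hz)]; omega)
  omega

/-- Pósa's lemma: rotations of a maximal good path produce many endpoints. -/
lemma card_rotEnds [Fintype V] {G F : SimpleGraph V} {S : Finset V} {m : ℕ}
    (hR : Ready G F S m) {l : List V} (hl : MaxPath G F l) : m < (rotEnds G S l).card := by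
  classical
  by_contra hcard
  push Not at hcard
  set R := rotEnds G S l with hRdef
  have hmax : ∀ l', Relation.ReflTransGen (Rot G S) l l' → MaxPath G F l' := by
    intro l' h
    refine ⟨reflTransGen_rot_goodPath hR.iso h hl.1, fun l'' h'' => ?_⟩
    rw [coreCount_perm (reflTransGen_rot_perm h)]
    exact hl.2 _ h''
  have hRne : 0 < R.card := by
    rw [Finset.card_pos]
    refine ⟨l.getLast hl.1.ne_nil, mem_rotEnds.2 ⟨l, Relation.ReflTransGen.refl, ?_⟩⟩
    exact List.getLast?_eq_getLast_of_ne_nil hl.1.ne_nil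
  have hRdeg : ∀ b ∈ R, deg F b ≤ 1 := by
    intro b hb
    obtain ⟨l', h1, h2⟩ := mem_rotEnds.1 hb
    exact (hmax l' h1).1.deg_last_le h2
  let N := S.filter fun z => z ∉ R ∧ ∃ b ∈ R, G.Adj b z
  have hN1 : N.card ≤ 2 * R.card := by
    let f : V → Finset V := fun c =>
      (Finset.univ.filter fun z => Nxt l z c) ∪ (Finset.univ.filter fun z => Nxt l c z)
    have hsub : N ⊆ R.biUnion f := by
      intro z hz
      simp only [N, Finset.mem_filter] at hz
      obtain ⟨hzS, hzR, b, hb, hadj⟩ := hz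
      by_contra hcon
      have hno : ∀ c ∈ R, ¬ Consec l z c := by
        intro c hc hcs
        apply hcon
        rw [Finset.mem_biUnion]
        refine ⟨c, hc, ?_⟩
        simp only [f, Finset.mem_union, Finset.mem_filter, Finset.mem_univ, true_and]
        exact hcs
      obtain ⟨l', h1, h2⟩ := mem_rotEnds.1 hb
      have hz' : z ∈ l' := (hmax l' h1).mem_of_adj_last hR.iso h2 hzS hadj
      obtain ⟨l₁, l₂, rfl⟩ := List.append_of_mem hz'
      cases l₂ with
      | nil => simp at h2; exact hadj.ne h2.symm
      | cons c l₂ =>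
        have hc : c ∈ R := by
          refine mem_rotEnds.2 ⟨l₁ ++ z :: (c :: l₂).reverse, h1.tail
            ⟨l₁, z, c :: l₂, b, rfl, ?_, hadj, hzS, rfl⟩, by
              rw [List.reverse_cons, ← List.cons_append, ← List.append_assoc]
              exact List.getLast?_concat⟩
          rw [List.getLast?_append, List.getLast?_cons_cons] at h2
          cases hh : (c :: l₂).getLast? with
          | none => simp at hh
          | some d => rw [hh] at h2; simpa using h2
        apply hno c hc
        rw [← consec_iff_of_rots hl.1.nodup h1 hzR hno]
        exact Or.inl (nxt_middle _ _ _ _)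
    have hf : ∀ c ∈ R, (f c).card ≤ 2 := by
      intro c _
      refine (Finset.card_union_le _ _).trans ?_
      have a1 : (Finset.univ.filter fun z => Nxt l z c).card ≤ 1 := by
        rw [Finset.card_le_one]
        intro a ha b hb
        simp at ha hb
        exact ha.left_unique hl.1.nodup hb
      have a2 : (Finset.univ.filter fun z => Nxt l c z).card ≤ 1 := by
        rw [Finset.card_le_one]
        intro a ha b hb
        simp at ha hb
        exact ha.right_unique hl.1.nodup hb
      omega
    calc N.card ≤ (R.biUnion f).card := Finset.card_le_card hsub
      _ ≤ R.card * 2 := Finset.card_biUnion_le_card_mul _ _ _ hf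
      _ = _ := by ring
  have hsplit := Finset.card_filter_add_card_filter_not (s := R) (fun v => v ∈ S)
  set RS := R.filter (fun v => v ∈ S)
  set RW := R.filter (fun v => ¬ v ∈ S)
  have hN2 : 10 * RS.card ≤ N.card + RW.card * 0 := by
    rcases RS.eq_empty_or_nonempty with h0 | h0
    · rw [h0]; simp
    · obtain ⟨Y, h1, h2, h3, h4⟩ := hR.expand RS (fun v hv => (Finset.mem_filter.1 hv).2) h0
        ((Finset.card_filter_le _ _).trans hcard)
      refine h3.trans ?_
      simp only [mul_zero, add_zero]
      apply Finset.card_le_card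
      intro y hy
      obtain ⟨r, hr, hadj⟩ := h4 y hy
      simp only [N, Finset.mem_filter]
      refine ⟨h1 hy, fun hyR => ?_, r, (Finset.mem_filter.1 hr).1, hadj⟩
      exact Finset.disjoint_left.1 h2 hy (Finset.mem_filter.2 ⟨hyR, h1 hy⟩)
  have hN3 : 10 * RW.card ≤ N.card + RS.card := by
    obtain ⟨P, h1, h2⟩ := hR.private_nbrs
    have hw : ∀ v ∈ RW, v ∉ S ∧ deg F v ≤ 1 := fun v hv =>
      ⟨(Finset.mem_filter.1 hv).2, hRdeg v (Finset.mem_filter.1 hv).1⟩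
    have e1 : 10 * RW.card ≤ (RW.biUnion P).card := by
      rw [Finset.card_biUnion]
      · rw [mul_comm, ← smul_eq_mul]
        exact Finset.card_nsmul_le_sum _ _ _ fun v hv => (h1 v (hw v hv).1 (hw v hv).2).2.1
      · intro v hv w hw' hne
        exact h2 v w (hw v hv).1 (hw v hv).2 (hw w hw').1 (hw w hw').2 hne
    refine e1.trans ?_
    refine (Finset.card_le_card (t := N ∪ RS) ?_).trans (Finset.card_union_le _ _)
    intro y hy
    obtain ⟨v, hv, hyv⟩ := Finset.mem_biUnion.1 hy
    have h3 := h1 v (hw v hv).1 (hw v hv).2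
    rw [Finset.mem_union]
    by_cases hyR : y ∈ R
    · exact Or.inr (Finset.mem_filter.2 ⟨hyR, h3.1 hyv⟩)
    · exact Or.inl (Finset.mem_filter.2 ⟨h3.1 hyv, hyR, v, (Finset.mem_filter.1 hv).1,
        h3.2.2 y hyv⟩)
  omega

end Rotations
end KChoice

namespace KChoice
open Finset

section Boosters
variable {V : Type*}

/-- A spanning path whose endpoints are adjacent closes up to a Hamiltonian cycle. -/
lemma isHamiltonian_of_list [Fintype V] [DecidableEq V] {G : SimpleGraph V} {l : List V}
    (hnd : l.Nodup)
    (hall : ∀ v, v ∈ l) (hch : l.IsChain G.Adj) (hcard : 3 ≤ Fintype.card V) {a b : V}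
    (ha : l.head? = some a) (hb : l.getLast? = some b) (hadj : G.Adj b a) : G.IsHamiltonian := by
  have hlen : l.length = Fintype.card V := by
    rw [← List.toFinset_card_of_nodup hnd]
    have : l.toFinset = Finset.univ := by ext v; simp [hall v]
    rw [this, Finset.card_univ]
  match l, hnd, hch, ha, hb, hlen with
  | [], _, _, _, _, h => simp at h; omega
  | [_], _, _, _, _, h => simp at h; omega
  | [_, _], _, _, _, _, h => simp at h; omega
  | x :: c :: d :: l, hnd, hch, ha, hb, hlen =>
    simp only [List.head?_cons, Option.some.injEq] at ha
    subst ha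
    have hb' : (c :: d :: l).getLast (by simp) = b := by
      rw [List.getLast?_cons_cons, List.getLast?_eq_getLast_of_ne_nil (by simp)] at hb
      exact Option.some.inj hb
    have hb'' : (d :: l).getLast (by simp) = b := by
      rw [← hb', List.getLast_cons (a := c) (List.cons_ne_nil d l)]
    let q : G.Walk c ((c :: d :: l).getLast (by simp)) :=
      SimpleGraph.Walk.ofSupport (c :: d :: l) (by simp) hch.of_cons
    have hq : q.support = c :: d :: l := SimpleGraph.Walk.support_ofSupport _ _
    let q' : G.Walk c b := q.copy rfl hb'
    have hq' : q'.support = c :: d :: l := by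
      simp only [q', SimpleGraph.Walk.support_copy, hq]
    have hxc : G.Adj x c := hch.rel
    have hbl : b ∈ d :: l := by rw [← hb'']; exact List.getLast_mem _
    have hnd1 := List.nodup_cons.1 hnd
    have hnd2 := List.nodup_cons.1 hnd1.2
    intro _
    refine ⟨b, SimpleGraph.Walk.cons hadj (SimpleGraph.Walk.cons hxc q'), ?_⟩
    rw [SimpleGraph.Walk.isHamiltonianCycle_iff_isCycle_and_length_eq]
    constructor
    · rw [SimpleGraph.Walk.cons_isCycle_iff]
      constructor
      · rw [SimpleGraph.Walk.isPath_def, SimpleGraph.Walk.support_cons, hq']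
        exact hnd
      · rw [SimpleGraph.Walk.edges_cons, List.mem_cons]
        rintro (h | h)
        · rw [Sym2.eq_iff] at h
          rcases h with ⟨rfl, -⟩ | ⟨rfl, -⟩
          · exact hadj.ne rfl
          · exact hnd2.1 hbl
        · have := SimpleGraph.Walk.snd_mem_support_of_mem_edges _ h
          rw [hq'] at this
          exact hnd1.1 this
    · rw [SimpleGraph.Walk.length_cons, ← SimpleGraph.Walk.length_support,
        SimpleGraph.Walk.support_cons, hq', hlen]

lemma MaxPath.reverse {G F : SimpleGraph V} {l : List V} (h : MaxPath G F l) :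
    MaxPath G F l.reverse :=
  ⟨h.1.reverse, fun l' hl' => by rw [coreCount_perm (List.reverse_perm l)]; exact h.2 l' hl'⟩

/-- Closing up a maximal good path to a cycle yields a Hamiltonian cycle or a better path. -/
lemma MaxPath.closing [Fintype V] [DecidableEq V] {G G' F : SimpleGraph V} {S : Finset V}
    {m : ℕ} (hR : Ready G F S m) {l : List V} (hl : MaxPath G F l) (hcard : 3 ≤ Fintype.card V) {a b : V}
    (ha : l.head? = some a) (hb : l.getLast? = some b) (hG : G ≤ G') (hadj : G'.Adj b a) :
    G'.IsHamiltonian ∨ ∃ l', GoodPath G' F l' ∧ coreCount F l < coreCount F l' := by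
  by_cases hall : ∀ v, deg F v ≤ 1 → v ∈ l
  · left
    refine isHamiltonian_of_list hl.1.nodup ?_ (hl.1.chain.imp fun _ _ h => hG h) hcard ha hb hadj
    intro v
    by_cases hv : v ∈ S
    · apply hall; rw [deg_eq_zero_of_isolated (hR.iso v hv)]; omega
    · obtain ⟨w, -, hw, hr⟩ := hR.reach v hv
      exact hl.1.closed.mem_of_reachable (hall w hw) hr.symm
  right
  push Not at hall
  obtain ⟨k, hk, hkl⟩ := hall
  obtain ⟨P, hP, -⟩ := hR.private_nbrs
  have hS : ∃ z ∈ S, z ∈ l := by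
    by_cases hbS : b ∈ S
    · exact ⟨b, hbS, List.mem_of_getLast? hb⟩
    · obtain ⟨h1, h2, h3⟩ := hP b hbS (hl.1.deg_last_le hb)
      obtain ⟨z, hz⟩ : (P b).Nonempty := by rw [← Finset.card_pos]; omega
      exact ⟨z, h1 hz, hl.mem_of_adj_last hR.iso hb (h1 hz) (h3 z hz)⟩
  obtain ⟨z, hzS, hzl, y, hyl, hyd, hzy⟩ : ∃ z ∈ S, z ∈ l ∧ ∃ y, y ∉ l ∧ deg F y ≤ 1 ∧
      G.Adj z y := by
    by_cases hsub : ∀ z ∈ S, z ∈ l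
    · have hkS : k ∉ S := fun h => hkl (hsub k h)
      obtain ⟨h1, h2, h3⟩ := hP k hkS hk
      obtain ⟨z, hz⟩ : (P k).Nonempty := by rw [← Finset.card_pos]; omega
      exact ⟨z, h1 hz, hsub z (h1 hz), k, hkl, hk, (h3 z hz).symm⟩
    · obtain ⟨z₀, h1, h2⟩ := hS
      obtain ⟨x, hx, y, hy, hyx, hxy⟩ := hR.connected (S.filter (fun z => z ∈ l))
        (Finset.filter_subset _ _) ⟨z₀, Finset.mem_filter.2 ⟨h1, h2⟩⟩ (by
          intro h
          apply hsub
          intro z hz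
          rw [← h] at hz
          exact (Finset.mem_filter.1 hz).2)
      rw [Finset.mem_filter] at hx hyx
      refine ⟨x, hx.1, hx.2, y, fun h => hyx ⟨hy, h⟩, ?_, hxy⟩
      rw [deg_eq_zero_of_isolated (hR.iso y hy)]; omega
  obtain ⟨q, hq1, hq2, hq3⟩ := exists_closed_path hR.deg_le hyd
  obtain ⟨l₁, l₂, rfl⟩ := List.append_of_mem hzl
  have hperm : (z :: l₂ ++ l₁).Perm (l₁ ++ z :: l₂) := List.perm_append_comm
  have hch := List.isChain_append.1 hl.1.chain
  have hcyc : (z :: l₂ ++ l₁).IsChain G'.Adj := by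
    rw [List.isChain_append]
    refine ⟨hch.2.1.imp fun _ _ h => hG h, hch.1.imp fun _ _ h => hG h, ?_⟩
    intro u hu v hv
    rw [List.getLast?_append] at hb
    have e1 : u = b := by
      rw [Option.mem_def] at hu
      rw [hu] at hb
      simpa using hb
    have e2 : v = a := by
      rw [Option.mem_def] at hv
      rw [List.head?_append, hv] at ha
      simpa using ha
    rw [e1, e2]; exact hadj
  refine ⟨(y :: q).reverse ++ (z :: l₂ ++ l₁), ⟨?_, by simp, ?_, ?_⟩, ?_⟩
  · rw [List.nodup_append]
    refine ⟨List.nodup_reverse.2 hq1, hperm.nodup_iff.2 hl.1.nodup, ?_⟩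
    rintro u hu v hv rfl
    rw [List.mem_reverse] at hu
    have := reachable_of_isChain hq2 hu
    exact hyl (hl.1.closed.mem_of_reachable (hperm.subset hv) this.symm)
  · rw [List.isChain_append]
    refine ⟨?_, hcyc, ?_⟩
    · rw [List.isChain_reverse]
      exact hq2.imp fun _ _ h => (hG (hR.le h)).symm
    · intro u hu v hv
      simp at hu hv
      subst hu; subst hv
      exact (hG hzy).symm
  · have key : ∀ v w, F.Adj v w → Nxt (l₁ ++ z :: l₂) v w → Nxt (z :: l₂ ++ l₁) v w := by
      intro v w hvw hn
      rw [nxt_append_cons] at hn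
      rcases hn with hn | hn
      · rcases List.eq_nil_or_concat l₁ with rfl | ⟨l₀, p, rfl⟩
        · simp [nxt_cons, not_nxt_nil] at hn
        · rw [List.concat_eq_append, List.append_assoc] at hn
          rw [List.singleton_append, nxt_append_cons] at hn
          rw [List.concat_eq_append]
          rcases hn with hn | hn
          · exact nxt_append_right hn
          · rw [nxt_cons] at hn
            rcases hn with ⟨-, hn⟩ | hn
            · simp at hn; subst hn; exact absurd hvw.symm (hR.iso _ hzS _)
            · simp [nxt_cons, not_nxt_nil] at hn
      · exact nxt_append_left hn
    intro v hv w hw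
    rw [List.mem_append] at hv
    rcases hv with hv | hv
    · exact (consec_reverse.2 (hq3 v (List.mem_reverse.1 hv) w hw)).append_left
    · refine Consec.append_right ?_
      rcases hl.1.closed v (hperm.subset hv) w hw with h | h
      · exact Or.inl (key v w hw h)
      · exact Or.inr (key w v hw.symm h)
  · rw [coreCount_append F (y :: q).reverse, coreCount_perm hperm]
    have := coreCount_pos (F := F) (l := (y :: q).reverse) (v := y) (by simp) hyd
    omega

open Classical in
/-- The largest number of core vertices on a good path. -/
noncomputable def maxCore [Fintype V] (G F : SimpleGraph V) : ℕ :=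
  Nat.findGreatest (fun k => ∃ l, GoodPath G F l ∧ k ≤ coreCount F l) (Fintype.card V)

lemma coreCount_le [Fintype V] (F : SimpleGraph V) {l : List V} (hl : l.Nodup) :
    coreCount F l ≤ Fintype.card V := List.countP_le_length.trans hl.length_le_card

lemma coreCount_le_maxCore [Fintype V] {G F : SimpleGraph V} {l : List V}
    (hl : GoodPath G F l) : coreCount F l ≤ maxCore G F := by
  classical
  exact Nat.le_findGreatest (coreCount_le F hl.nodup) ⟨l, hl, le_rfl⟩

lemma exists_maxCore_le [Fintype V] {G F : SimpleGraph V} {l : List V} (hl : GoodPath G F l) :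
    ∃ l', GoodPath G F l' ∧ maxCore G F ≤ coreCount F l' := by
  classical
  exact Nat.findGreatest_spec
      (P := fun k => ∃ l, GoodPath G F l ∧ k ≤ coreCount F l) (Nat.zero_le (Fintype.card V))
      ⟨l, hl, Nat.zero_le _⟩

lemma maxCore_mono [Fintype V] {G G' F : SimpleGraph V} (h : G ≤ G') :
    maxCore G F ≤ maxCore G' F := by
  classical
  apply Nat.findGreatest_mono_left
  rintro k ⟨l, hl, hk⟩
  exact ⟨l, hl.mono h, hk⟩

open Classical in
lemma maxCore_le [Fintype V] {G F : SimpleGraph V} :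
    maxCore G F ≤ (Finset.univ.filter fun v => deg F v ≤ 1).card := by
  by_cases h0 : maxCore G F = 0
  · omega
  · obtain ⟨l, hl, hkl⟩ := Nat.findGreatest_of_ne_zero rfl h0
    change maxCore G F ≤ _ at hkl
    refine hkl.trans ?_
    rw [coreCount, List.countP_eq_length_filter,
      ← List.toFinset_card_of_nodup (hl.nodup.filter _)]
    apply Finset.card_le_card
    intro v hv
    simp at hv ⊢
    exact hv.2

variable [Fintype V] [DecidableEq V]

open Classical in
/-- The largest number of core vertices on a good path, plus one if the graph is Hamiltonian. -/
noncomputable def progress (G F : SimpleGraph V) : ℕ :=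
  maxCore G F + if G.IsHamiltonian then 1 else 0

lemma progress_mono {G G' F : SimpleGraph V} (h : G ≤ G') : progress G F ≤ progress G' F := by
  classical
  unfold progress
  apply Nat.add_le_add (maxCore_mono h)
  by_cases hG : G.IsHamiltonian
  · rw [if_pos hG, if_pos (hG.mono h)]
  · rw [if_neg hG]; exact Nat.zero_le _

open Classical in
/-- A bound for `progress` in terms of the number of vertices of degree at most one. -/
lemma progress_le_core {G F : SimpleGraph V} :
    progress G F ≤ (Finset.univ.filter fun v => deg F v ≤ 1).card + 1 := by
  unfold progress
  apply Nat.add_le_add maxCore_le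
  split_ifs <;> omega

lemma progress_le {G F : SimpleGraph V} : progress G F ≤ Fintype.card V + 1 := by
  classical
  exact progress_le_core.trans (Nat.add_le_add_right (Finset.card_le_univ _) 1)

/-- A graph that is ready but not Hamiltonian has many boosters. -/
lemma exists_boosters {G F : SimpleGraph V} {S : Finset V} {m : ℕ} (hR : Ready G F S m)
    (hcard : 3 ≤ Fintype.card V) (hH : ¬ G.IsHamiltonian) :
    ∃ B : Finset (Sym2 V), (m + 1) ^ 2 ≤ 2 * B.card ∧ ∀ e ∈ B, ¬ e.IsDiag ∧
      ∀ G', G ≤ G' → e ∈ G'.edgeSet → progress G F < progress G' F := by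
  classical
  obtain ⟨s, hs⟩ := hR.nonempty
  have hinit : GoodPath G F [s] := by
    refine ⟨by simp, by simp, by simp, ?_⟩
    intro v hv w hw
    simp at hv; subst hv
    exact absurd hw (hR.iso _ hs _)
  obtain ⟨l₀, hl₀⟩ : ∃ l₀, MaxPath G F l₀ := by
    obtain ⟨l, hl, hk⟩ := exists_maxCore_le hinit
    exact ⟨l, hl, fun l' hl' => (coreCount_le_maxCore hl').trans hk⟩
  have hmax : ∀ {l l'}, MaxPath G F l → Relation.ReflTransGen (Rot G S) l l' →
      MaxPath G F l' := by
    intro l l' hl h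
    refine ⟨reflTransGen_rot_goodPath hR.iso h hl.1, fun l'' h'' => ?_⟩
    rw [coreCount_perm (reflTransGen_rot_perm h)]
    exact hl.2 _ h''
  have hprog : ∀ {l}, MaxPath G F l → progress G F = coreCount F l := by
    intro l hl
    unfold progress
    rw [if_neg hH, add_zero]
    apply le_antisymm
    · obtain ⟨l', hl', hk⟩ := exists_maxCore_le hinit
      exact hk.trans (hl.2 l' hl')
    · exact coreCount_le_maxCore hl.1
  have hboost : ∀ {l}, MaxPath G F l → ∀ a b, l.head? = some a → l.getLast? = some b →
      ∀ G', G ≤ G' → G'.Adj b a → progress G F < progress G' F := by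
    intro l hl a b ha hb G' hG hadj
    rcases hl.closing hR hcard ha hb hG hadj with h | ⟨l', h1, h2⟩
    · have := maxCore_mono (F := F) hG
      unfold progress
      rw [if_neg hH, if_pos h]
      omega
    · rw [hprog hl]
      refine h2.trans_le ((coreCount_le_maxCore h1).trans ?_)
      exact Nat.le_add_right _ _
  have hpath : ∀ b, ∃ l', b ∈ rotEnds G S l₀ →
      Relation.ReflTransGen (Rot G S) l₀ l' ∧ l'.getLast? = some b := by
    intro b
    by_cases hb : b ∈ rotEnds G S l₀
    · obtain ⟨l', h⟩ := mem_rotEnds.1 hb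
      exact ⟨l', fun _ => h⟩
    · exact ⟨[], fun h => absurd h hb⟩
  choose L hL using hpath
  let X : Finset (V × V) := (rotEnds G S l₀).biUnion fun b =>
    (rotEnds G S (L b).reverse).image fun a => (b, a)
  have hXcard : (m + 1) ^ 2 ≤ X.card := by
    rw [Finset.card_biUnion]
    · calc (m + 1) ^ 2 ≤ (rotEnds G S l₀).card * (m + 1) := by
            rw [sq]; exact Nat.mul_le_mul_right _ (card_rotEnds hR hl₀)
        _ ≤ _ := by
            rw [← smul_eq_mul]
            apply Finset.card_nsmul_le_sum
            intro b hb
            rw [Finset.card_image_of_injective _ (Prod.mk_right_injective b)]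
            exact card_rotEnds hR (hmax hl₀ (hL b hb).1).reverse
    · intro b _ b' _ hne
      rw [Function.onFun, Finset.disjoint_left]
      intro x hx hx'
      obtain ⟨a, -, rfl⟩ := Finset.mem_image.1 hx
      obtain ⟨a', -, h⟩ := Finset.mem_image.1 hx'
      exact hne (Prod.ext_iff.1 h).1.symm
  have hX : ∀ x ∈ X, ∃ l, MaxPath G F l ∧ l.head? = some x.1 ∧ l.getLast? = some x.2 := by
    intro x hx
    obtain ⟨b, hb, hx⟩ := Finset.mem_biUnion.1 hx
    obtain ⟨a, ha, rfl⟩ := Finset.mem_image.1 hx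
    obtain ⟨l, h1, h2⟩ := mem_rotEnds.1 ha
    refine ⟨l, hmax (hmax hl₀ (hL b hb).1).reverse h1, ?_, h2⟩
    rw [reflTransGen_rot_head h1, List.head?_reverse]
    exact (hL b hb).2
  have hXne : ∀ x ∈ X, x.1 ≠ x.2 := by
    intro x hx heq
    obtain ⟨l, h1, h2, h3⟩ := hX x hx
    rw [← heq] at h3
    have h4 : l.length ≤ 1 := by
      match l, h1.1.nodup, h2, h3 with
      | [], _, _, _ => simp
      | [_], _, _, _ => simp
      | u :: v :: l, hnd, h2, h3 =>
        simp at h2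
        rw [List.getLast?_cons_cons, ← h2] at h3
        exact absurd (List.mem_of_getLast? h3) (List.nodup_cons.1 hnd).1
    have h5 := card_rotEnds hR h1
    have h6 : (rotEnds G S l).card ≤ l.length := by
      rw [← List.toFinset_card_of_nodup h1.1.nodup]
      apply Finset.card_le_card
      intro b hb
      obtain ⟨l', h7, h8⟩ := mem_rotEnds.1 hb
      rw [List.mem_toFinset]
      exact (reflTransGen_rot_perm h7).subset (List.mem_of_getLast? h8)
    have := hR.pos
    omega
  refine ⟨X.image fun x => s(x.1, x.2), ?_, ?_⟩
  · refine hXcard.trans ?_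
    have := Finset.card_le_mul_card_image (f := fun x : V × V => s(x.1, x.2)) X 2 (by
      intro e he
      induction e using Sym2.ind with
      | _ u v =>
        refine (Finset.card_le_card (t := {(u, v), (v, u)}) ?_).trans Finset.card_le_two
        rintro ⟨a, b⟩ hx
        simp at hx ⊢
        exact hx.2)
    exact this
  · intro e he
    obtain ⟨x, hx, rfl⟩ := Finset.mem_image.1 he
    refine ⟨by simpa using hXne x hx, ?_⟩
    intro G' hG hadj
    obtain ⟨l, h1, h2, h3⟩ := hX x hx
    exact hboost h1 _ _ h2 h3 G' hG (SimpleGraph.Adj.symm hadj)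

end Boosters
end KChoice

namespace KChoice
open Finset

section Expander
variable {V : Type*}

/-- Any two disjoint `m`-subsets of `S` are joined by an edge of `G`. -/
def Joined (G : SimpleGraph V) (S : Finset V) (m : ℕ) : Prop :=
  ∀ A ⊆ S, ∀ B ⊆ S, Disjoint A B → A.card = m → B.card = m → ∃ a ∈ A, ∃ b ∈ B, G.Adj a b

/-- `S` induces a connected graph in which sets of size at most `m` expand tenfold. -/
structure Expander (G : SimpleGraph V) (S : Finset V) (m : ℕ) : Prop where
  expand : ∀ R ⊆ S, R.Nonempty → R.card ≤ m → ∃ Y ⊆ S, Disjoint Y R ∧ 10 * R.card ≤ Y.card ∧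
      ∀ y ∈ Y, ∃ r ∈ R, G.Adj r y
  connected : ∀ A ⊆ S, A.Nonempty → A ≠ S → ∃ a ∈ A, ∃ b ∈ S, b ∉ A ∧ G.Adj a b

lemma Joined.exists_adj {G : SimpleGraph V} {S : Finset V} {m : ℕ} (h : Joined G S m)
    {A B : Finset V} (hA : A ⊆ S) (hB : B ⊆ S) (hAB : Disjoint A B) (hAm : m ≤ A.card)
    (hBm : m ≤ B.card) : ∃ a ∈ A, ∃ b ∈ B, G.Adj a b := by
  obtain ⟨A', hA', hA'm⟩ := exists_subset_card_eq hAm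
  obtain ⟨B', hB', hB'm⟩ := exists_subset_card_eq hBm
  obtain ⟨a, ha, b, hb, hab⟩ := h A' (hA'.trans hA) B' (hB'.trans hB)
    (disjoint_of_subset_left hA' (disjoint_of_subset_right hB' hAB)) hA'm hB'm
  exact ⟨a, hA' ha, b, hB' hb, hab⟩

/-- A joined set contains an expander missing at most `m` of its vertices. -/
lemma Joined.exists_expander [DecidableEq V] {G : SimpleGraph V} {S : Finset V} {m : ℕ}
    (h : Joined G S m) (hS : 23 * m ≤ S.card) :
    ∃ T ⊆ S, (S \ T).card ≤ m ∧ Expander G T m := by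
  classical
  let nb : Finset V → Finset V := fun B => (S \ B).filter fun y => ∃ r ∈ B, G.Adj r y
  let C := S.powerset.filter fun B => B.card ≤ m ∧ (nb B).card ≤ 10 * B.card
  have hne : C.Nonempty := ⟨∅, by simp [C, nb]⟩
  obtain ⟨B, hB, hmax⟩ := exists_max_image C card hne
  simp only [C, mem_filter, mem_powerset] at hB hmax
  obtain ⟨hBS, hBm, hBn⟩ := hB
  have hTm : (S \ (S \ B)).card ≤ m := by
    rw [Finset.sdiff_sdiff_eq_self hBS]; exact hBm
  have hexp : ∀ R ⊆ S \ B, R.Nonempty → R.card ≤ m → ∃ Y ⊆ S \ B, Disjoint Y R ∧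
      10 * R.card ≤ Y.card ∧ ∀ y ∈ Y, ∃ r ∈ R, G.Adj r y := by
    intro R hR hRne hRm
    by_contra hcon
    let Y := ((S \ B) \ R).filter fun y => ∃ r ∈ R, G.Adj r y
    have hY : Y.card < 10 * R.card := by
      by_contra hY
      exact hcon ⟨Y, (filter_subset _ _).trans sdiff_subset,
        disjoint_of_subset_left (filter_subset _ _) sdiff_disjoint, by omega,
        fun y hy => (mem_filter.1 hy).2⟩
    have hRS : R ⊆ S := hR.trans sdiff_subset
    have hdisj : Disjoint B R := (disjoint_of_subset_left hR sdiff_disjoint).symm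
    have hcard : (B ∪ R).card = B.card + R.card := card_union_of_disjoint hdisj
    have hnb : (nb (B ∪ R)).card ≤ 10 * B.card + 10 * R.card := by
      have : nb (B ∪ R) ⊆ nb B ∪ Y := by
        intro y hy
        simp only [nb, Y, mem_filter, mem_sdiff, mem_union] at hy ⊢
        obtain ⟨⟨hyS, hyn⟩, r, hr, hry⟩ := hy
        push Not at hyn
        rcases hr with hr | hr
        · exact Or.inl ⟨⟨hyS, hyn.1⟩, r, hr, hry⟩
        · exact Or.inr ⟨⟨⟨hyS, hyn.1⟩, hyn.2⟩, r, hr, hry⟩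
      have h1 := card_le_card this
      have h2 := card_union_le (nb B) Y
      omega
    have hRpos := hRne.card_pos
    rcases le_or_gt (B ∪ R).card m with hle | hgt
    · have := hmax (B ∪ R) ⟨union_subset hBS hRS, hle, by omega⟩
      omega
    · have hbig : m ≤ ((S \ (B ∪ R)) \ nb (B ∪ R)).card := by
        have h1 := le_card_sdiff (nb (B ∪ R)) (S \ (B ∪ R))
        have h2 := le_card_sdiff (B ∪ R) S
        omega
      obtain ⟨a, ha, b, hb, hab⟩ := h.exists_adj (union_subset hBS hRS)
        (sdiff_subset.trans sdiff_subset)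
        (disjoint_of_subset_right sdiff_subset disjoint_sdiff) hgt.le hbig
      rw [mem_sdiff] at hb
      exact hb.2 (mem_filter.2 ⟨hb.1, a, ha, hab⟩)
  refine ⟨S \ B, sdiff_subset, hTm, hexp, ?_⟩
  intro A hA hAne hAS
  rcases le_or_gt A.card m with hle | hgt
  · obtain ⟨Y, hY, hYA, hYc, hYadj⟩ := hexp A hA hAne hle
    have : Y.Nonempty := by
      rw [← card_pos]; have := hAne.card_pos; omega
    obtain ⟨y, hy⟩ := this
    obtain ⟨r, hr, hry⟩ := hYadj y hy
    exact ⟨r, hr, y, hY hy, fun hyA => disjoint_left.1 hYA hy hyA, hry⟩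
  · rcases le_or_gt ((S \ B) \ A).card m with hle' | hgt'
    · have hne' : ((S \ B) \ A).Nonempty := by
        rw [sdiff_nonempty]
        exact fun hsub => hAS (hA.antisymm hsub)
      obtain ⟨Y, hY, hYA, hYc, hYadj⟩ := hexp _ sdiff_subset hne' hle'
      have : Y.Nonempty := by
        rw [← card_pos]; have := hne'.card_pos; omega
      obtain ⟨y, hy⟩ := this
      obtain ⟨r, hr, hry⟩ := hYadj y hy
      rw [mem_sdiff] at hr
      refine ⟨y, ?_, r, hr.1, hr.2, hry.symm⟩
      by_contra hyA
      exact disjoint_left.1 hYA hy (mem_sdiff.2 ⟨hY hy, hyA⟩)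
    · obtain ⟨a, ha, b, hb, hab⟩ := h.exists_adj (hA.trans sdiff_subset)
        (sdiff_subset.trans sdiff_subset : (S \ B) \ A ⊆ S)
        disjoint_sdiff hgt.le hgt'.le
      rw [mem_sdiff] at hb
      exact ⟨a, ha, b, hb.1, hb.2, hab⟩

end Expander

section Forest
variable {V : Type*}

/-- In a finite acyclic graph every vertex is connected to a vertex of degree at most one. -/
lemma exists_leaf [Finite V] {F : SimpleGraph V} (hF : F.IsAcyclic) (v : V) :
    ∃ w, F.Reachable v w ∧ deg F w ≤ 1 := by
  classical
  have := Fintype.ofFinite V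
  let P : ℕ → Prop := fun k => ∃ w, ∃ p : F.Walk v w, p.IsPath ∧ p.length = k
  have h0 : P 0 := ⟨v, .nil, by simp, rfl⟩
  have hb : ∀ k, P k → k ≤ Fintype.card V := by
    rintro k ⟨w, p, hp, rfl⟩
    exact hp.length_lt.le
  obtain ⟨w, p, hp, hlen⟩ := Nat.findGreatest_spec (P := P) (Nat.zero_le (Fintype.card V)) h0
  refine ⟨w, ⟨p⟩, ?_⟩
  unfold deg
  rw [Set.ncard_le_one (Set.toFinite _)]
  have key : ∀ x, F.Adj w x → x = p.penultimate := by
    intro x hx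
    by_cases hxp : x ∈ p.support
    · exact hF.eq_penultimate_of_adj_end hp hx hxp
    · have hP : P (p.length + 1) := ⟨x, p.concat hx, hp.concat hxp hx, by simp⟩
      have := Nat.le_findGreatest (hb _ hP) hP
      omega
  intro a ha b hb
  rw [key a ha, key b hb]

/-- A graph of maximum degree two without cycles. -/
structure LinForest (F : SimpleGraph V) : Prop where
  deg_le : ∀ v, deg F v ≤ 2
  acyclic : F.IsAcyclic

lemma linForest_bot : LinForest (⊥ : SimpleGraph V) :=
  ⟨fun v => by simp [deg, SimpleGraph.neighborSet], SimpleGraph.isAcyclic_bot⟩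

lemma LinForest.anti [Finite V] {F G : SimpleGraph V} (h : F ≤ G) (hG : LinForest G) :
    LinForest F :=
  ⟨fun v => (deg_mono h v).trans (hG.deg_le v), hG.acyclic.anti h⟩

lemma deg_sup_edge_le [Finite V] [DecidableEq V] (F : SimpleGraph V) {a b v : V} (hb : v ≠ b) :
    deg (F ⊔ SimpleGraph.edge a b) v ≤ deg F v + (if v = a then 1 else 0) := by
  classical
  unfold deg
  split_ifs with h
  · subst h
    refine (Set.ncard_le_ncard (t := insert b (F.neighborSet v)) ?_ (Set.toFinite _)).trans
      (Set.ncard_insert_le _ _)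
    intro w hw
    simp only [SimpleGraph.mem_neighborSet, SimpleGraph.sup_adj, SimpleGraph.edge_adj] at hw
    simp only [Set.mem_insert_iff, SimpleGraph.mem_neighborSet]
    tauto
  · refine Set.ncard_le_ncard ?_ (Set.toFinite _)
    intro w hw
    simp only [SimpleGraph.mem_neighborSet, SimpleGraph.sup_adj, SimpleGraph.edge_adj] at hw ⊢
    tauto

/-- Joining two vertices of degree at most one in different components of a linear forest gives a
linear forest. -/
lemma LinForest.sup_edge [Finite V] {F : SimpleGraph V} (hF : LinForest F) {a b : V}
    (ha : deg F a ≤ 1) (hb : deg F b ≤ 1) (hab : ¬ F.Reachable a b) :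
    LinForest (F ⊔ SimpleGraph.edge a b) := by
  classical
  refine ⟨fun v => ?_, hF.acyclic.sup_edge_of_not_reachable hab⟩
  have hne : a ≠ b := fun h => hab (h ▸ SimpleGraph.Reachable.refl _)
  by_cases hvb : v = b
  · subst hvb
    rw [SimpleGraph.edge_comm]
    have := deg_sup_edge_le F (a := v) hne.symm
    simp at this
    omega
  · have := deg_sup_edge_le F (a := a) hvb
    split_ifs at this with h
    · subst h; omega
    · have := hF.deg_le v; omega

/-- In a graph of maximum degree at most two, a vertex of degree at most one is connected to at
most one other such vertex. -/
lemma eq_of_reachable_of_deg_le_one [Finite V] {F : SimpleGraph V} (hF : ∀ v, deg F v ≤ 2)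
    {a b c : V} (ha : deg F a ≤ 1) (hb : deg F b ≤ 1) (hc : deg F c ≤ 1) (hab : F.Reachable a b)
    (hac : F.Reachable a c) (hba : b ≠ a) (hca : c ≠ a) : b = c := by
  obtain ⟨q, hnd, hch, hcl⟩ := exists_closed_path hF ha
  have hlast : ∀ x, deg F x ≤ 1 → F.Reachable a x → x ≠ a → (a :: q).getLast? = some x := by
    intro x hx hax hxa
    have hmem := hcl.mem_of_reachable (List.mem_cons_self) hax
    obtain ⟨l₁, l₂, hl⟩ := List.append_of_mem hmem
    rcases l₂ with _ | ⟨z, l₂⟩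
    · rw [hl]; simp
    · exfalso
      rcases List.eq_nil_or_concat l₁ with rfl | ⟨l₁, y, rfl⟩
      · simp at hl; exact hxa hl.1.symm
      · rw [hl] at hch hnd
        simp only [List.concat_eq_append, List.append_assoc, List.singleton_append] at hch hnd
        rw [List.isChain_append] at hch
        have h1 := hch.2.1
        simp only [List.isChain_cons_cons] at h1
        have := eq_of_deg_le_one hx h1.1.symm h1.2.1
        subst this
        have h2 := hnd.of_append_right
        simp at h2
  have h1 := hlast b hb hab hba
  have h2 := hlast c hc hac hca
  rw [h1] at h2
  exact Option.some.inj h2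

end Forest

end KChoice

namespace KChoice
open Finset

section Stars
variable {V : Type*} [DecidableEq V]

/-- The number of edges of `s` at `v`. -/
def load (s : Finset (Sym2 V)) (v : V) : ℕ := (s.filter fun e => v ∈ e).card

lemma load_mono {s t : Finset (Sym2 V)} (h : s ⊆ t) (v : V) : load s v ≤ load t v :=
  card_le_card (filter_subset_filter _ h)

lemma load_insert {s : Finset (Sym2 V)} {e : Sym2 V} (he : e ∉ s) (v : V) :
    load (insert e s) v = load s v + if v ∈ e then 1 else 0 := by
  unfold load
  rw [filter_insert]
  split_ifs with h
  · rw [card_insert_of_notMem (fun h' => he (mem_filter.1 h').1)]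
  · rfl

lemma eq_of_load_le_one {s : Finset (Sym2 V)} {v : V} (h : load s v ≤ 1) {e f : Sym2 V}
    (he : e ∈ s) (hf : f ∈ s) (hve : v ∈ e) (hvf : v ∈ f) : e = f :=
  card_le_one.1 h e (mem_filter.2 ⟨he, hve⟩) f (mem_filter.2 ⟨hf, hvf⟩)

/-- The edges of `s` form vertex-disjoint stars with centres in `Q`, leaves in `Y` and at most `c`
edges each. -/
structure IsStars (Q Y : Finset V) (c : ℕ) (s : Finset (Sym2 V)) : Prop where
  edge : ∀ e ∈ s, ∃ q ∈ Q, ∃ y ∈ Y, e = s(q, y)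
  uniq : ∀ y ∈ Y, load s y ≤ 1
  load_le : ∀ q ∈ Q, load s q ≤ c

lemma isStars_empty (Q Y : Finset V) (c : ℕ) : IsStars Q Y c ∅ := by
  constructor <;> simp [load]

lemma IsStars.card_le {Q Y : Finset V} {c : ℕ} {s : Finset (Sym2 V)} (h : IsStars Q Y c s) :
    s.card ≤ c * Q.card := by
  have h1 : s ⊆ Q.biUnion fun q => s.filter fun e => q ∈ e := by
    intro e he
    obtain ⟨q, hq, y, -, rfl⟩ := h.edge e he
    exact mem_biUnion.2 ⟨q, hq, mem_filter.2 ⟨he, Sym2.mem_mk_left _ _⟩⟩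
  have h2 := card_biUnion_le_card_mul Q (fun q => s.filter fun e => q ∈ e) c
    (fun q hq => h.load_le q hq)
  have h3 := card_le_card h1
  rw [mul_comm c]
  exact h3.trans h2

lemma IsStars.card_used_le {Q Y : Finset V} {c : ℕ} {s : Finset (Sym2 V)} (h : IsStars Q Y c s)
    (hQY : Disjoint Q Y) : (Y.filter fun y => load s y ≠ 0).card ≤ s.card := by
  set U := Y.filter fun y => load s y ≠ 0 with hU
  have hch : ∀ x, ∃ e, x ∈ U → e ∈ s ∧ x ∈ e := by
    intro x
    by_cases hx : x ∈ U
    · obtain ⟨e, he⟩ := card_pos.1 (Nat.pos_of_ne_zero (mem_filter.1 hx).2)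
      exact ⟨e, fun _ => mem_filter.1 he⟩
    · exact ⟨s(x, x), fun h' => absurd h' hx⟩
  choose f hf using hch
  refine card_le_card_of_injOn f (fun x hx => (hf x hx).1) ?_
  intro x hx y hy hxy
  have hx1 := hf x hx
  have hy1 := hf y hy
  obtain ⟨q, hq, z, hz, hqz⟩ := h.edge _ hx1.1
  have key : ∀ w, w ∈ U → w ∈ f x → w = z := by
    intro w hw hwf
    rw [hqz] at hwf
    rcases Sym2.mem_iff.1 hwf with rfl | rfl
    · exact absurd (mem_filter.1 hw).1 (disjoint_left.1 hQY hq)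
    · rfl
  rw [key x hx hx1.2, key y hy (hxy ▸ hy1.2)]

/-- The leaves of the star centred at `q`. -/
def leaves (s : Finset (Sym2 V)) (Y : Finset V) (q : V) : Finset V :=
  Y.filter fun y => s(q, y) ∈ s

lemma IsStars.load_le_card_leaves {Q Y : Finset V} {c : ℕ} {s : Finset (Sym2 V)}
    (h : IsStars Q Y c s) {q : V} (hq : q ∉ Y) : load s q ≤ (leaves s Y q).card := by
  have h1 : s.filter (fun e => q ∈ e) ⊆ (leaves s Y q).image fun y => s(q, y) := by
    intro e he
    obtain ⟨hes, hqe⟩ := mem_filter.1 he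
    obtain ⟨q', -, y, hy, rfl⟩ := h.edge e hes
    rcases Sym2.mem_iff.1 hqe with rfl | rfl
    · exact mem_image.2 ⟨y, mem_filter.2 ⟨hy, hes⟩, rfl⟩
    · exact absurd hy hq
  exact (card_le_card h1).trans card_image_le

lemma IsStars.center_unique {Q Y : Finset V} {c : ℕ} {s : Finset (Sym2 V)}
    (h : IsStars Q Y c s) {a b y : V} (hy : y ∈ Y) (ha : s(a, y) ∈ s) (hb : s(b, y) ∈ s) :
    a = b := by
  have := eq_of_load_le_one (h.uniq y hy) ha hb (Sym2.mem_mk_right _ _) (Sym2.mem_mk_right _ _)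
  exact Sym2.congr_left.1 this

end Stars

section Reconnect
variable {V : Type*} [Fintype V] [DecidableEq V]

/-- Rerouting the ends of a linear forest through interior vertices which have private neighbours
in an expander. -/
lemma exists_ready {G F : SimpleGraph V} {S : Finset V} {m : ℕ} (hm : 1 ≤ m)
    (hSne : S.Nonempty) (hE : Expander G S m) (hFG : F ≤ G) (hF : LinForest F)
    (hiso : ∀ v ∈ S, ∀ w, ¬ F.Adj v w) {A B : Finset (Sym2 V)} {L X W : Finset V} {D : ℕ}
    (hL : ∀ v, v ∈ L ↔ v ∉ S ∧ deg F v ≤ 1) (hX : ∀ v, v ∈ X ↔ v ∉ S ∧ deg F v = 2)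
    (hA : IsStars L X D A) (hB : IsStars W S 10 B)
    (hAG : ∀ a b, s(a, b) ∈ A → G.Adj a b) (hBG : ∀ a b, s(a, b) ∈ B → G.Adj a b)
    (hgood : ∀ v ∈ L, ∃ T ⊆ leaves A X v, 2 ≤ T.card ∧
      ∀ x ∈ T, ∀ w, (w = x ∨ F.Adj x w) → 10 ≤ load B w) :
    ∃ F' : SimpleGraph V, Ready G F' S m := by
  classical
  choose! gd hgdl hgd2 hgdB using hgood
  have hch : ∀ v, ∃ T : Finset V, v ∈ L → T ⊆ gd v ∧ T.card = 2 - deg F v := by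
    intro v
    by_cases hv : v ∈ L
    · have h2 : 2 - deg F v ≤ (gd v).card := le_trans (Nat.sub_le _ _) (hgd2 v hv)
      obtain ⟨T, hT⟩ := exists_subset_card_eq h2
      exact ⟨T, fun _ => hT⟩
    · exact ⟨∅, fun h => absurd h hv⟩
  choose ch hch using hch
  let O : V → V → Prop := fun v x => v ∈ L ∧ x ∈ ch v
  have hOgd : ∀ v x, O v x → x ∈ gd v := fun v x h => (hch v h.1).1 h.2
  have hOA : ∀ v x, O v x → s(v, x) ∈ A := fun v x h =>
    (mem_filter.1 (hgdl v h.1 (hOgd v x h))).2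
  have hOX : ∀ v x, O v x → x ∈ X := fun v x h =>
    (mem_filter.1 (hgdl v h.1 (hOgd v x h))).1
  have hOW : ∀ v x, O v x → ∀ w, (w = x ∨ F.Adj x w) → 10 ≤ load B w := fun v x h =>
    hgdB v h.1 x (hOgd v x h)
  have hLX : ∀ v, v ∈ L → v ∉ X := fun v h h' => by
    have h1 := ((hL v).1 h).2
    have h2 := ((hX v).1 h').2
    omega
  have hOu : ∀ v v' x, O v x → O v' x → v = v' := fun v v' x h h' =>
    hA.center_unique (hOX v x h) (hOA v x h) (hOA v' x h')
  let R : V → Prop := fun x => ∃ v, O v x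
  let F' : SimpleGraph V :=
    { Adj := fun a b => (F.Adj a b ∧ ¬ R a ∧ ¬ R b) ∨ O a b ∨ O b a
      symm := ⟨fun a b h => by
        rcases h with ⟨h1, h2, h3⟩ | h | h
        · exact Or.inl ⟨h1.symm, h3, h2⟩
        · exact Or.inr (Or.inr h)
        · exact Or.inr (Or.inl h)⟩
      loopless := ⟨fun a h => by
        rcases h with ⟨h1, -⟩ | h | h
        · exact h1.ne rfl
        · exact hLX a h.1 (hOX a a h)
        · exact hLX a h.1 (hOX a a h)⟩ }
  have hadj : ∀ a b, F'.Adj a b ↔ (F.Adj a b ∧ ¬ R a ∧ ¬ R b) ∨ O a b ∨ O b a :=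
    fun a b => Iff.rfl
  have hRX : ∀ x, R x → x ∈ X := fun x ⟨v, h⟩ => hOX v x h
  have hRdeg : ∀ x, R x → deg F' x ≤ 1 := by
    rintro x ⟨u, hu⟩
    unfold deg
    rw [Set.ncard_le_one (Set.toFinite _)]
    have key : ∀ a, F'.Adj x a → a = u := by
      intro a ha
      rcases (hadj x a).1 ha with ⟨-, h, -⟩ | h | h
      · exact absurd ⟨u, hu⟩ h
      · exact absurd (hOX u x hu) (hLX x h.1)
      · exact hOu a u x h hu
    intro a ha b hb
    rw [key a ha, key b hb]
  have hisoL : ∀ v w, O v w → v ∉ S ∧ w ∉ S := fun v w h =>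
    ⟨((hL v).1 h.1).1, ((hX w).1 (hOX v w h)).1⟩
  have hF'S : ∀ a b, F'.Adj a b → b ∉ S := by
    intro a b h
    rcases (hadj a b).1 h with ⟨h, -⟩ | h | h
    · exact fun hb => hiso b hb a h.symm
    · exact (hisoL _ _ h).2
    · exact (hisoL _ _ h).1
  have hdegle : ∀ v, deg F' v ≤ 2 := by
    intro v
    by_cases hR : R v
    · exact (hRdeg v hR).trans (by norm_num)
    · by_cases hv : v ∈ L
      · have hsub : F'.neighborSet v ⊆ F.neighborSet v ∪ (ch v : Set V) := by
          intro w hw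
          rcases (hadj v w).1 hw with ⟨h, -⟩ | h | h
          · exact Or.inl h
          · exact Or.inr h.2
          · exact absurd ⟨w, h⟩ hR
        have h1 := (Set.ncard_le_ncard hsub (Set.toFinite _)).trans (Set.ncard_union_le _ _)
        rw [Set.ncard_coe_finset, (hch v hv).2] at h1
        have h2 := ((hL v).1 hv).2
        unfold deg at h2 ⊢
        unfold deg at h1
        omega
      · refine le_trans (Set.ncard_le_ncard ?_ (Set.toFinite _)) (hF.deg_le v)
        intro w hw
        rcases (hadj v w).1 hw with ⟨h, -⟩ | h | h
        · exact h
        · exact absurd h.1 hv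
        · exact absurd ⟨w, h⟩ hR
  have hlow : ∀ v, v ∉ S → deg F' v ≤ 1 → ∃ x, R x ∧ (v = x ∨ F.Adj x v) := by
    intro v hvS hd
    by_contra hcon
    push Not at hcon
    have hRv : ¬ R v := fun h => (hcon v h).1 rfl
    have hFR : ∀ w, F.Adj v w → ¬ R w := fun w hw h => (hcon w h).2 hw.symm
    have hsub : F.neighborSet v ⊆ F'.neighborSet v := fun w hw =>
      (hadj v w).2 (Or.inl ⟨hw, hRv, hFR w hw⟩)
    by_cases hv : v ∈ L
    · have hsub' : F.neighborSet v ∪ (ch v : Set V) ⊆ F'.neighborSet v := by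
        rintro w (hw | hw)
        · exact hsub hw
        · exact (hadj v w).2 (Or.inr (Or.inl ⟨hv, hw⟩))
      have hdisj : Disjoint (F.neighborSet v) (ch v : Set V) := by
        rw [Set.disjoint_left]
        intro w hw hw'
        exact hFR w hw ⟨v, hv, hw'⟩
      have h1 := Set.ncard_le_ncard hsub' (Set.toFinite _)
      rw [Set.ncard_union_eq hdisj (Set.toFinite _) (Set.toFinite _), Set.ncard_coe_finset,
        (hch v hv).2] at h1
      have h2 := ((hL v).1 hv).2
      unfold deg at h1 h2 hd
      omega
    · have h1 := Set.ncard_le_ncard hsub (Set.toFinite _)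
      have h2 : ¬ deg F v ≤ 1 := fun h => hv ((hL v).2 ⟨hvS, h⟩)
      unfold deg at h2 hd
      omega
  have hlowB : ∀ v, v ∉ S → deg F' v ≤ 1 → 10 ≤ load B v := by
    intro v hvS hd
    obtain ⟨x, ⟨u, hu⟩, hx⟩ := hlow v hvS hd
    exact hOW u x hu v hx
  refine ⟨F', ?_, ?_, hdegle, ⟨fun w => leaves B S w, ?_, ?_⟩, ?_, hm, hSne, hE.expand,
    hE.connected⟩
  · intro a b h
    rcases (hadj a b).1 h with ⟨h, -⟩ | h | h
    · exact hFG h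
    · exact hAG _ _ (hOA _ _ h)
    · exact (hAG _ _ (hOA _ _ h)).symm
  · intro v hv w h
    exact hF'S w v h.symm hv
  · intro v hv hd
    refine ⟨filter_subset _ _, (hlowB v hv hd).trans (hB.load_le_card_leaves hv), ?_⟩
    intro y hy
    exact hBG _ _ (mem_filter.1 hy).2
  · intro v w hv _ hw _ hvw
    rw [disjoint_left]
    intro y hy hy'
    obtain ⟨hyS, hy⟩ := mem_filter.1 hy
    exact hvw (hB.center_unique hyS hy (mem_filter.1 hy').2)
  · intro v hv
    by_contra hcon
    push Not at hcon
    have hreachS : ∀ w, F'.Reachable v w → w ∉ S := by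
      rintro w hw
      by_cases hvw : w = v
      · rw [hvw]; exact hv
      · obtain ⟨p⟩ := hw.symm
        cases p with
        | nil => exact absurd rfl hvw
        | cons h p => exact hF'S _ _ h.symm
    have hnR : ∀ w, F'.Reachable v w → ¬ R w := fun w hw hR =>
      hcon w (hreachS w hw) (hRdeg w hR) hw
    have hnL : ∀ w, F'.Reachable v w → w ∉ L := by
      intro w hw hwL
      have h1 : 0 < (ch w).card := by
        rw [(hch w hwL).2]
        have := ((hL w).1 hwL).2
        omega
      obtain ⟨x, hx⟩ := card_pos.1 h1
      exact hnR x (hw.trans ((hadj w x).2 (Or.inr (Or.inl ⟨hwL, hx⟩))).reachable) ⟨w, hwL, hx⟩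
    have hstep : ∀ w w', F'.Reachable v w → F.Adj w w' → F'.Reachable v w' := by
      intro w w' hw hww'
      have hsub : F'.neighborSet w ⊆ F.neighborSet w := by
        intro z hz
        rcases (hadj w z).1 hz with ⟨h, -⟩ | h | h
        · exact h
        · exact absurd h.1 (hnL w hw)
        · exact absurd ⟨z, h⟩ (hnR w hw)
      have hd : ¬ deg F' w ≤ 1 := fun h => hcon w (hreachS w hw) h hw
      have hd' := hF.deg_le w
      have heq := Set.eq_of_subset_of_ncard_le hsub
        (by unfold deg at hd hd'; omega) (Set.toFinite _)
      have : w' ∈ F'.neighborSet w := heq ▸ hww'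
      exact hw.trans (SimpleGraph.Adj.reachable this)
    obtain ⟨w, ⟨p⟩, hwd⟩ := exists_leaf hF.acyclic v
    have hall : ∀ a b (p : F.Walk a b), F'.Reachable v a → F'.Reachable v b := by
      intro a b p
      induction p with
      | nil => exact id
      | cons h p ih => exact fun ha => ih (hstep _ _ ha h)
    have hw := hall v w p (SimpleGraph.Reachable.refl _)
    exact hnL w hw ((hL w).2 ⟨hreachS w hw, hwd⟩)

end Reconnect

end KChoice

namespace KChoice
open Finset

section Greedy
variable {E : Type*}

/-- The entries of a list at the positions in `[a, b)`. -/
def window (a b : ℕ) (h : List E) : List E := (h.take b).drop a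

lemma window_append_singleton {a b : ℕ} (h : List E) (e : E) :
    window a b (h ++ [e]) =
      if a ≤ h.length ∧ h.length < b then window a b h ++ [e] else window a b h := by
  unfold window
  split_ifs with hc
  · rw [List.take_of_length_le (l := h ++ [e]) (by simp; omega),
      List.take_of_length_le (l := h) (by omega), List.drop_append_of_le_length hc.1]
  · by_cases hb : b ≤ h.length
    · rw [List.take_append_of_le_length hb]
    · rw [List.drop_eq_nil_of_le (by simp; omega), List.drop_eq_nil_of_le (by simp; omega)]

lemma window_take {a b c : ℕ} (hbc : b ≤ c) (h : List E) :
    window a b (h.take c) = window a b h := by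
  unfold window
  rw [List.take_take, min_eq_left hbc]

variable [DecidableEq E]

open Classical in
/-- The set built by going through a list and accepting elements according to a rule. -/
noncomputable def greedy (r : Finset E → E → Prop) (l : List E) : Finset E :=
  l.foldl (fun s e => if r s e then insert e s else s) ∅

open Classical in
lemma greedy_append_singleton (r : Finset E → E → Prop) (l : List E) (e : E) :
    greedy r (l ++ [e]) = if r (greedy r l) e then insert e (greedy r l) else greedy r l := by
  rw [greedy, List.foldl_append]
  rfl

lemma greedy_induction {r : Finset E → E → Prop} {P : Finset E → Prop} (h0 : P ∅)
    (h1 : ∀ s e, P s → r s e → P (insert e s)) (l : List E) : P (greedy r l) := by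
  classical
  induction l using List.reverseRecOn with
  | nil => exact h0
  | append_singleton l e ih =>
    rw [greedy_append_singleton]
    split_ifs with h
    · exact h1 _ _ ih h
    · exact ih

lemma mem_of_mem_greedy {r : Finset E → E → Prop} {l : List E} {e : E} (h : e ∈ greedy r l) :
    e ∈ l := by
  classical
  induction l using List.reverseRecOn with
  | nil => simp [greedy] at h
  | append_singleton l e' ih =>
    rw [greedy_append_singleton] at h
    rw [List.mem_append, List.mem_singleton]
    split_ifs at h
    · rcases mem_insert.1 h with h | h
      · exact Or.inr h
      · exact Or.inl (ih h)
    · exact Or.inl (ih h)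

lemma exists_subset_greedy {r : Finset E → E → Prop} {l : List E} {e : E} (h : e ∈ l) :
    ∃ s ⊆ greedy r l, r s e → e ∈ greedy r l := by
  classical
  induction l using List.reverseRecOn with
  | nil => simp at h
  | append_singleton l e' ih =>
    have hsub : greedy r l ⊆ greedy r (l ++ [e']) := by
      rw [greedy_append_singleton]
      split_ifs
      · exact subset_insert _ _
      · exact subset_rfl
    rw [List.mem_append, List.mem_singleton] at h
    rcases h with h | rfl
    · obtain ⟨s, hs, hr⟩ := ih h
      exact ⟨s, hs.trans hsub, fun h => hsub (hr h)⟩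
    · refine ⟨greedy r l, hsub, fun h => ?_⟩
      rw [greedy_append_singleton, if_pos h]
      exact mem_insert_self _ _

/-- A greedy process run on the entries at the positions in `[a, b)`, with a rule that depends on
the first `a` entries. -/
noncomputable def phase (a b : ℕ) (R : List E → Finset E → E → Prop) (h : List E) : Finset E :=
  greedy (R (h.take a)) (window a b h)

lemma phase_take {a b c : ℕ} (hab : a ≤ b) (hbc : b ≤ c) (R : List E → Finset E → E → Prop)
    (h : List E) : phase a b R (h.take c) = phase a b R h := by
  unfold phase
  rw [window_take hbc, List.take_take, min_eq_left (hab.trans hbc)]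

open Classical in
lemma phase_append_singleton {a b : ℕ} (R : List E → Finset E → E → Prop)
    (h : List E) (e : E) :
    phase a b R (h ++ [e]) =
      if (a ≤ h.length ∧ h.length < b) ∧ R (h.take a) (phase a b R h) e
        then insert e (phase a b R h) else phase a b R h := by
  unfold phase
  rw [window_append_singleton]
  by_cases hc : a ≤ h.length ∧ h.length < b
  · rw [if_pos hc, greedy_append_singleton, List.take_append_of_le_length hc.1]
    simp only [hc, true_and, and_self]
  · rw [if_neg hc, if_neg (fun h => hc h.1)]
    by_cases ha : a ≤ h.length
    · rw [List.take_append_of_le_length ha]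
    · have : window a b h = [] := by
        unfold window
        rw [List.drop_eq_nil_of_le (by simp; omega)]
      rw [this]
      rfl

lemma phase_subset_append {a b : ℕ} (R : List E → Finset E → E → Prop)
    (h : List E) (e : E) : phase a b R h ⊆ phase a b R (h ++ [e]) := by
  rw [phase_append_singleton]
  split_ifs
  · exact subset_insert _ _
  · exact subset_rfl

lemma phase_append_subset {a b : ℕ} (R : List E → Finset E → E → Prop)
    (h : List E) (e : E) : phase a b R (h ++ [e]) ⊆ insert e (phase a b R h) := by
  rw [phase_append_singleton]
  split_ifs
  · exact subset_rfl
  · exact subset_insert _ _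

lemma mem_of_mem_phase {a b : ℕ} {R : List E → Finset E → E → Prop}
    {h : List E} {e : E} (he : e ∈ phase a b R h) : e ∈ h :=
  List.mem_of_mem_take (List.mem_of_mem_drop (mem_of_mem_greedy he))

end Greedy

section FollowSel
variable {n : ℕ}

/-- The online algorithm that follows an increasing selection function. -/
def follow (Sel : List (Sym2 (Fin n)) → Finset (Sym2 (Fin n))) : Alg n :=
  fun h => h.getLast?.filter fun e => e ∈ Sel h

lemma selected_follow (Sel : List (Sym2 (Fin n)) → Finset (Sym2 (Fin n))) (h0 : Sel [] = ∅)
    (h1 : ∀ h e, Sel h ⊆ Sel (h ++ [e])) (h2 : ∀ h e, Sel (h ++ [e]) ⊆ insert e (Sel h))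
    (σ : Omega n) {t : ℕ} (ht : t ≤ numEdges n) :
    selected n 1 (follow Sel) σ t = Sel (hist σ t) := by
  induction t with
  | zero => simp [selected, hist, h0]
  | succ t ih =>
    have hp : presented n 1 σ (t + 1) = hist σ t ++ [(σ ⟨t, ht⟩).1] := by
      rw [← hist_succ σ ⟨t, ht⟩]
      simp [presented, hist]
    have hb : block n 1 σ (t + 1) = [(σ ⟨t, ht⟩).1] := by
      have : block n 1 σ (t + 1) = (presented n 1 σ (t + 1)).drop t := by
        simp [block, presented]
      rw [this, hp]
      rw [List.drop_append_of_le_length (by rw [length_hist σ (by omega)]),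
        List.drop_eq_nil_of_le (by rw [length_hist σ (by omega)])]
      rfl
    have hs := hist_succ σ ⟨t, ht⟩
    simp only at hs
    rw [selected, ih (by omega), hp, hb, hs]
    have hA : follow Sel (hist σ t ++ [(σ ⟨t, ht⟩).1]) =
        if (σ ⟨t, ht⟩).1 ∈ Sel (hist σ t ++ [(σ ⟨t, ht⟩).1]) then some (σ ⟨t, ht⟩).1 else none := by
      simp [follow, Option.filter]
    rw [hA]
    split_ifs with hin
    · simp only [List.mem_singleton, if_true]
      apply subset_antisymm
      · exact union_subset (h1 _ _) (by simpa using hin)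
      · intro x hx
        rcases mem_insert.1 (h2 _ _ hx) with rfl | hx
        · exact mem_union_right _ (by simp)
        · exact mem_union_left _ hx
    · simp only [union_empty]
      apply subset_antisymm (h1 _ _)
      intro x hx
      rcases mem_insert.1 (h2 _ _ hx) with rfl | hx'
      · exact absurd hx hin
      · exact hx'

end FollowSel

end KChoice

namespace KChoice
open Finset

section StarRule
variable {V : Type*} [DecidableEq V]

/-- Accept an edge that attaches an unused vertex of `Y` to a vertex of `Q` with fewer than `c`
accepted edges. -/
def starRule (Q Y : Finset V) (c : ℕ) (s : Finset (Sym2 V)) (e : Sym2 V) : Prop :=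
  ∃ q ∈ Q, ∃ y ∈ Y, e = s(q, y) ∧ load s y = 0 ∧ load s q < c

lemma isStars_greedy {Q Y : Finset V} (hQY : Disjoint Q Y) (c : ℕ) (l : List (Sym2 V)) :
    IsStars Q Y c (greedy (starRule Q Y c) l) := by
  refine greedy_induction (isStars_empty Q Y c) ?_ l
  rintro s e hs ⟨q, hq, y, hy, rfl, hy0, hqc⟩
  have hne : s(q, y) ∉ s := fun h => by
    have : s(q, y) ∈ s.filter fun e => y ∈ e := mem_filter.2 ⟨h, Sym2.mem_mk_right _ _⟩
    rw [load, card_eq_zero] at hy0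
    rw [hy0] at this
    simp at this
  refine ⟨?_, ?_, ?_⟩
  · intro e he
    rcases mem_insert.1 he with rfl | he
    · exact ⟨q, hq, y, hy, rfl⟩
    · exact hs.edge e he
  · intro z hz
    rw [load_insert hne]
    split_ifs with h
    · rcases Sym2.mem_iff.1 h with rfl | rfl
      · exact absurd hz (disjoint_left.1 hQY hq)
      · omega
    · exact hs.uniq z hz
  · intro z hz
    rw [load_insert hne]
    split_ifs with h
    · rcases Sym2.mem_iff.1 h with rfl | rfl
      · omega
      · exact absurd hy (disjoint_left.1 hQY hz)
    · exact hs.load_le z hz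

end StarRule

/-- The parameters of the algorithm: the size of the reserved set, the expansion scale, the ends of
the five windows, and the number of alternatives for each end of the forest. -/
structure Params where
  s : ℕ
  m : ℕ
  τ₁ : ℕ
  τ₂ : ℕ
  τ₃ : ℕ
  τ₄ : ℕ
  T : ℕ
  D : ℕ

namespace Params
variable (p : Params) {n : ℕ}

/-- The graph spanned by a set of edges. -/
abbrev gr (s : Finset (Sym2 (Fin n))) : SimpleGraph (Fin n) := SimpleGraph.fromEdgeSet s

/-- The reserved vertices. -/
def reserve (n : ℕ) : Finset (Fin n) := univ.filter fun v => v.val < p.s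

/-- The edges of the first window inside the reserved set. -/
noncomputable def E₁ (h : List (Sym2 (Fin n))) : Finset (Sym2 (Fin n)) :=
  phase 0 p.τ₁ (fun _ _ e => ∀ v ∈ e, v ∈ p.reserve n) h

open Classical in
/-- An expander inside the reserved set. -/
noncomputable def core (h : List (Sym2 (Fin n))) : Finset (Fin n) :=
  if hT : ∃ T ⊆ p.reserve n, (p.reserve n \ T).card ≤ p.m ∧ Expander (gr (p.E₁ h)) T p.m
    then hT.choose else ∅

/-- A greedy linear forest outside the expander. -/
noncomputable def E₂ (h : List (Sym2 (Fin n))) : Finset (Sym2 (Fin n)) :=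
  phase p.τ₁ p.τ₂ (fun g s e => (∀ v ∈ e, v ∉ p.core g) ∧ ¬ e.IsDiag ∧
    LinForest (gr (insert e s))) h

open Classical in
/-- The ends of the greedy forest. -/
noncomputable def ends (h : List (Sym2 (Fin n))) : Finset (Fin n) :=
  univ.filter fun v => v ∉ p.core h ∧ deg (gr (p.E₂ h)) v ≤ 1

open Classical in
/-- The interior vertices of the greedy forest. -/
noncomputable def inner (h : List (Sym2 (Fin n))) : Finset (Fin n) :=
  univ.filter fun v => v ∉ p.core h ∧ deg (gr (p.E₂ h)) v = 2

/-- Edges joining the ends of the forest to interior vertices. -/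
noncomputable def E₃ (h : List (Sym2 (Fin n))) : Finset (Sym2 (Fin n)) :=
  phase p.τ₂ p.τ₃ (fun g => starRule (p.ends g) (p.inner g) p.D) h

open Classical in
/-- The interior vertices reached from the ends, together with their neighbours. -/
noncomputable def cut (h : List (Sym2 (Fin n))) : Finset (Fin n) :=
  univ.filter fun w => ∃ x ∈ p.inner h, load (p.E₃ h) x ≠ 0 ∧ (w = x ∨ (gr (p.E₂ h)).Adj x w)

/-- Edges joining the cut vertices to the expander. -/
noncomputable def E₄ (h : List (Sym2 (Fin n))) : Finset (Sym2 (Fin n)) :=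
  phase p.τ₃ p.τ₄ (fun g => starRule (p.cut g) (p.core g) 10) h

/-- The graph built in the first four windows. -/
noncomputable def base (h : List (Sym2 (Fin n))) : SimpleGraph (Fin n) :=
  gr (p.E₁ h ∪ p.E₂ h ∪ p.E₃ h ∪ p.E₄ h)

open Classical in
/-- The rerouted forest. -/
noncomputable def frame (h : List (Sym2 (Fin n))) : SimpleGraph (Fin n) :=
  if hF : ∃ F, Ready (p.base h) F (p.core h) p.m then hF.choose else ⊥

/-- The edges of the last window that make progress towards a Hamiltonian cycle. -/
noncomputable def E₅ (h : List (Sym2 (Fin n))) : Finset (Sym2 (Fin n)) :=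
  phase p.τ₄ p.T (fun g s e =>
    progress (p.base g ⊔ gr s) (p.frame g) < progress (p.base g ⊔ gr (insert e s)) (p.frame g)) h

/-- All the edges selected by the algorithm. -/
noncomputable def sel (h : List (Sym2 (Fin n))) : Finset (Sym2 (Fin n)) :=
  p.E₁ h ∪ p.E₂ h ∪ p.E₃ h ∪ p.E₄ h ∪ p.E₅ h

lemma sel_nil : p.sel ([] : List (Sym2 (Fin n))) = ∅ := by
  simp only [sel, E₁, E₂, E₃, E₄, E₅, phase, window, List.take_nil, List.drop_nil, greedy,
    List.foldl_nil, union_empty]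

lemma sel_subset_append (h : List (Sym2 (Fin n))) (e : Sym2 (Fin n)) :
    p.sel h ⊆ p.sel (h ++ [e]) := by
  unfold sel
  exact union_subset_union (union_subset_union (union_subset_union (union_subset_union
    (phase_subset_append _ _ _) (phase_subset_append _ _ _)) (phase_subset_append _ _ _))
    (phase_subset_append _ _ _)) (phase_subset_append _ _ _)

lemma sel_append_subset (h : List (Sym2 (Fin n))) (e : Sym2 (Fin n)) :
    p.sel (h ++ [e]) ⊆ insert e (p.sel h) := by
  unfold sel
  have h1 : p.E₁ (h ++ [e]) ⊆ insert e (p.E₁ h) := phase_append_subset _ _ _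
  have h2 : p.E₂ (h ++ [e]) ⊆ insert e (p.E₂ h) := phase_append_subset _ _ _
  have h3 : p.E₃ (h ++ [e]) ⊆ insert e (p.E₃ h) := phase_append_subset _ _ _
  have h4 : p.E₄ (h ++ [e]) ⊆ insert e (p.E₄ h) := phase_append_subset _ _ _
  have h5 : p.E₅ (h ++ [e]) ⊆ insert e (p.E₅ h) := phase_append_subset _ _ _
  intro x hx
  simp only [mem_union] at hx
  simp only [mem_insert, mem_union]
  rcases hx with (((hx | hx) | hx) | hx) | hx
  · have := mem_insert.1 (h1 hx); tauto
  · have := mem_insert.1 (h2 hx); tauto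
  · have := mem_insert.1 (h3 hx); tauto
  · have := mem_insert.1 (h4 hx); tauto
  · have := mem_insert.1 (h5 hx); tauto

/-- The windows follow each other. -/
structure Ordered : Prop where
  h₁₂ : p.τ₁ ≤ p.τ₂
  h₂₃ : p.τ₂ ≤ p.τ₃
  h₃₄ : p.τ₃ ≤ p.τ₄
  h₄ : p.τ₄ ≤ p.T

variable {p} (hp : p.Ordered) {h : List (Sym2 (Fin n))} {c : ℕ}
include hp

omit hp in
lemma E₁_take (hc : p.τ₁ ≤ c) : p.E₁ (h.take c) = p.E₁ h := phase_take (Nat.zero_le _) hc _ _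

omit hp in
lemma core_take (hc : p.τ₁ ≤ c) : p.core (h.take c) = p.core h := by
  unfold core; rw [E₁_take hc]

lemma E₂_take (hc : p.τ₂ ≤ c) : p.E₂ (h.take c) = p.E₂ h := phase_take hp.h₁₂ hc _ _

lemma ends_take (hc : p.τ₂ ≤ c) : p.ends (h.take c) = p.ends h := by
  unfold ends; rw [E₂_take hp hc, core_take (hp.h₁₂.trans hc)]

lemma inner_take (hc : p.τ₂ ≤ c) : p.inner (h.take c) = p.inner h := by
  unfold inner; rw [E₂_take hp hc, core_take (hp.h₁₂.trans hc)]

lemma E₃_take (hc : p.τ₃ ≤ c) : p.E₃ (h.take c) = p.E₃ h := phase_take hp.h₂₃ hc _ _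

lemma cut_take (hc : p.τ₃ ≤ c) : p.cut (h.take c) = p.cut h := by
  unfold cut; rw [E₂_take hp (hp.h₂₃.trans hc), E₃_take hp hc, inner_take hp (hp.h₂₃.trans hc)]

lemma E₄_take (hc : p.τ₄ ≤ c) : p.E₄ (h.take c) = p.E₄ h := phase_take hp.h₃₄ hc _ _

lemma base_take (hc : p.τ₄ ≤ c) : p.base (h.take c) = p.base h := by
  unfold base
  rw [E₄_take hp hc, E₃_take hp (hp.h₃₄.trans hc), E₂_take hp (hp.h₂₃.trans (hp.h₃₄.trans hc)),
    E₁_take (hp.h₁₂.trans (hp.h₂₃.trans (hp.h₃₄.trans hc)))]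

lemma frame_take (hc : p.τ₄ ≤ c) : p.frame (h.take c) = p.frame h := by
  unfold frame
  rw [base_take hp hc, core_take (hp.h₁₂.trans (hp.h₂₃.trans (hp.h₃₄.trans hc)))]

omit hp in
lemma E₂_eq : p.E₂ h = greedy (fun s e => (∀ v ∈ e, v ∉ p.core h) ∧ ¬ e.IsDiag ∧
    LinForest (gr (insert e s))) (window p.τ₁ p.τ₂ h) := by
  unfold E₂ phase
  beta_reduce
  rw [core_take le_rfl]

lemma E₃_eq : p.E₃ h = greedy (starRule (p.ends h) (p.inner h) p.D) (window p.τ₂ p.τ₃ h) := by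
  unfold E₃ phase
  beta_reduce
  rw [ends_take hp le_rfl, inner_take hp le_rfl]

lemma E₄_eq : p.E₄ h = greedy (starRule (p.cut h) (p.core h) 10) (window p.τ₃ p.τ₄ h) := by
  unfold E₄ phase
  beta_reduce
  rw [cut_take hp le_rfl, core_take (hp.h₁₂.trans hp.h₂₃)]

end Params

end KChoice

namespace KChoice
open Finset

/-- A finite graph of maximum degree at most two has at most as many edges as vertices. -/
lemma card_le_of_deg_le_two {n : ℕ} {s : Finset (Sym2 (Fin n))} (hs : ∀ e ∈ s, ¬ e.IsDiag)
    (hd : ∀ v, deg (SimpleGraph.fromEdgeSet (s : Set (Sym2 (Fin n)))) v ≤ 2) : s.card ≤ n := by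
  classical
  set G := SimpleGraph.fromEdgeSet (s : Set (Sym2 (Fin n))) with hG
  have h1 : ∑ v, G.degree v = 2 * #G.edgeFinset := by
    convert G.sum_degrees_eq_twice_card_edges
  have h2 : s ⊆ G.edgeFinset := by
    intro e he
    rw [SimpleGraph.mem_edgeFinset, hG, SimpleGraph.edgeSet_fromEdgeSet]
    exact ⟨he, hs e he⟩
  have h3 : ∑ v, G.degree v ≤ ∑ _v : Fin n, 2 := by
    refine sum_le_sum fun v _ => ?_
    have := hd v
    unfold deg at this
    rwa [Set.ncard_eq_toFinset_card', ← SimpleGraph.neighborFinset_def,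
      SimpleGraph.card_neighborFinset_eq_degree] at this
  have h4 := card_le_card h2
  simp only [sum_const, card_univ, Fintype.card_fin, smul_eq_mul] at h3
  omega

namespace Params
variable {p : Params} {n : ℕ} {h : List (Sym2 (Fin n))}

lemma card_reserve (hs : p.s ≤ n) : (p.reserve n).card = p.s := by
  unfold reserve
  rw [Fin.card_filter_val_lt, min_eq_right hs]

lemma core_spec (hJ : Joined (gr (p.E₁ h)) (p.reserve n) p.m)
    (hs : 23 * p.m ≤ (p.reserve n).card) :
    p.core h ⊆ p.reserve n ∧ (p.reserve n \ p.core h).card ≤ p.m ∧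
      Expander (gr (p.E₁ h)) (p.core h) p.m := by
  have hT := hJ.exists_expander hs
  unfold core
  rw [dif_pos hT]
  exact hT.choose_spec

lemma core_subset : p.core h ⊆ p.reserve n := by
  unfold core
  split_ifs with hT
  · exact hT.choose_spec.1
  · exact empty_subset _

lemma linForest_E₂ : LinForest (gr (p.E₂ h)) := by
  unfold E₂ phase
  refine greedy_induction (P := fun s => LinForest (gr s)) ?_ ?_ _
  · have : gr (∅ : Finset (Sym2 (Fin n))) = ⊥ := by simp [gr]
    rw [this]
    exact linForest_bot
  · intro s e _ hr
    exact hr.2.2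

lemma E₂_spec {e : Sym2 (Fin n)} (he : e ∈ p.E₂ h) : (∀ v ∈ e, v ∉ p.core h) ∧ ¬ e.IsDiag := by
  rw [E₂_eq] at he
  have : ∀ e ∈ greedy (fun (s : Finset (Sym2 (Fin n))) (e : Sym2 (Fin n)) =>
      (∀ v ∈ e, v ∉ p.core h) ∧ ¬ e.IsDiag ∧
    LinForest (gr (insert e s))) (window p.τ₁ p.τ₂ h), (∀ v ∈ e, v ∉ p.core h) ∧ ¬ e.IsDiag := by
    refine greedy_induction (P := fun s : Finset (Sym2 (Fin n)) =>
      ∀ e ∈ s, (∀ v ∈ e, v ∉ p.core h) ∧ ¬ e.IsDiag) ?_ ?_ _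
    · simp
    · intro s e hs hr f hf
      rcases mem_insert.1 hf with rfl | hf
      · exact ⟨hr.1, hr.2.1⟩
      · exact hs f hf
  exact this e he

lemma card_E₂_le : (p.E₂ h).card ≤ n :=
  card_le_of_deg_le_two (fun _ he => (E₂_spec he).2) linForest_E₂.deg_le

lemma mem_ends {v : Fin n} :
    v ∈ p.ends h ↔ v ∉ p.core h ∧ deg (gr (p.E₂ h)) v ≤ 1 := by simp [ends]

lemma mem_inner {v : Fin n} :
    v ∈ p.inner h ↔ v ∉ p.core h ∧ deg (gr (p.E₂ h)) v = 2 := by simp [inner]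

lemma disjoint_ends_inner : Disjoint (p.ends h) (p.inner h) := by
  rw [disjoint_left]
  intro v hv hv'
  have h1 := (mem_ends.1 hv).2
  have h2 := (mem_inner.1 hv').2
  omega

/-- Between two large sets of ends lying in different components there is no edge in the second
window, so there are few ends. -/
lemma card_ends_lt {k : ℕ}
    (hJ : ∀ A B : Finset (Fin n), Disjoint A B → A.card = k → B.card = k →
      ∃ a ∈ A, ∃ b ∈ B, s(a, b) ∈ window p.τ₁ p.τ₂ h) : (p.ends h).card ≤ 3 * k := by
  classical
  by_contra hcon
  push Not at hcon
  set F := gr (p.E₂ h) with hF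
  have hdeg : ∀ v, deg F v ≤ 2 := linForest_E₂.deg_le
  obtain ⟨A, hA, hAk⟩ := exists_subset_card_eq (show k ≤ (p.ends h).card by omega)
  let Pt := A.biUnion fun a => (p.ends h).filter fun b => b ≠ a ∧ F.Reachable a b
  have hPt : Pt.card ≤ k := by
    have := card_biUnion_le_card_mul A
      (fun a => (p.ends h).filter fun b => b ≠ a ∧ F.Reachable a b) 1 ?_
    · rw [hAk, mul_one] at this; exact this
    · intro a ha
      rw [card_le_one]
      intro b hb c hc
      rw [mem_filter] at hb hc
      exact eq_of_reachable_of_deg_le_one hdeg (mem_ends.1 (hA ha)).2 (mem_ends.1 hb.1).2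
        (mem_ends.1 hc.1).2 hb.2.2 hc.2.2 hb.2.1 hc.2.1
  have hrest : k ≤ (p.ends h \ (A ∪ Pt)).card := by
    have h1 := le_card_sdiff (A ∪ Pt) (p.ends h)
    have h2 := card_union_le A Pt
    omega
  obtain ⟨B, hB, hBk⟩ := exists_subset_card_eq hrest
  have hAB : Disjoint A B := by
    rw [disjoint_left]
    intro a ha hb
    exact (mem_sdiff.1 (hB hb)).2 (mem_union_left _ ha)
  obtain ⟨a, ha, b, hb, hab⟩ := hJ A B hAB hAk hBk
  have hane : a ≠ b := fun h' => disjoint_left.1 hAB ha (h' ▸ hb)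
  have hbs := mem_sdiff.1 (hB hb)
  have hnr : ¬ F.Reachable a b := fun hr => hbs.2 (mem_union_right _
    (mem_biUnion.2 ⟨a, ha, mem_filter.2 ⟨hbs.1, hane.symm, hr⟩⟩))
  have haE := mem_ends.1 (hA ha)
  have hbE := mem_ends.1 hbs.1
  obtain ⟨s, hs, hr⟩ := exists_subset_greedy (r := fun s e => (∀ v ∈ e, v ∉ p.core h) ∧
    ¬ e.IsDiag ∧ LinForest (gr (insert e s))) hab
  rw [← E₂_eq] at hs hr
  have hsF : gr s ≤ F := SimpleGraph.fromEdgeSet_mono (by exact_mod_cast hs)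
  have hmem : s(a, b) ∈ p.E₂ h := by
    refine hr ⟨?_, by simpa using hane, ?_⟩
    · intro v hv
      rcases Sym2.mem_iff.1 hv with rfl | rfl
      · exact haE.1
      · exact hbE.1
    · have : gr (insert s(a, b) s) = gr s ⊔ SimpleGraph.edge a b := by
        simp only [gr, SimpleGraph.edge, coe_insert]
        rw [Set.insert_eq, Set.union_comm, SimpleGraph.fromEdgeSet_union]
      rw [this]
      exact (linForest_E₂.anti hsF).sup_edge ((deg_mono hsF a).trans haE.2)
        ((deg_mono hsF b).trans hbE.2) (fun h' => hnr (h'.mono hsF))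
  apply hnr
  apply SimpleGraph.Adj.reachable
  rw [hF, SimpleGraph.fromEdgeSet_adj]
  exact ⟨by exact_mod_cast hmem, hane⟩

variable (hp : p.Ordered)
include hp

lemma isStars_E₃ : IsStars (p.ends h) (p.inner h) p.D (p.E₃ h) := by
  rw [E₃_eq hp]
  exact isStars_greedy disjoint_ends_inner _ _

omit hp in
lemma not_adj_core {v : Fin n} (hv : v ∈ p.core h) (w : Fin n) : ¬ (gr (p.E₂ h)).Adj v w := by
  rw [SimpleGraph.fromEdgeSet_adj]
  rintro ⟨h1, -⟩
  exact (E₂_spec (by exact_mod_cast h1)).1 v (Sym2.mem_mk_left _ _) hv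

omit hp in
lemma disjoint_cut_core : Disjoint (p.cut h) (p.core h) := by
  rw [disjoint_left]
  intro w hw hc
  simp only [cut, mem_filter, mem_univ, true_and] at hw
  obtain ⟨x, hx, -, rfl | hadj⟩ := hw
  · exact (mem_inner.1 hx).1 hc
  · exact not_adj_core hc x hadj.symm

lemma isStars_E₄ : IsStars (p.cut h) (p.core h) 10 (p.E₄ h) := by
  rw [E₄_eq hp]
  exact isStars_greedy disjoint_cut_core _ _

lemma card_cut_le : (p.cut h).card ≤ 3 * (p.D * (p.ends h).card) := by
  classical
  have hst := isStars_E₃ (h := h) hp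
  let U := (p.inner h).filter fun x => load (p.E₃ h) x ≠ 0
  have hU : U.card ≤ (p.E₃ h).card := hst.card_used_le disjoint_ends_inner
  have hsub : p.cut h ⊆ U.biUnion fun x => insert x ((gr (p.E₂ h)).neighborFinset x) := by
    intro w hw
    simp only [cut, mem_filter, mem_univ, true_and] at hw
    obtain ⟨x, hx, hl, hw⟩ := hw
    refine mem_biUnion.2 ⟨x, mem_filter.2 ⟨hx, hl⟩, ?_⟩
    simp only [mem_insert, SimpleGraph.mem_neighborFinset]
    exact hw
  have h1 := card_le_card hsub
  have h2 := card_biUnion_le_card_mul U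
    (fun x => insert x ((gr (p.E₂ h)).neighborFinset x)) 3 (fun x _ => by
      refine (card_insert_le _ _).trans ?_
      have := (linForest_E₂ (p := p) (h := h)).deg_le x
      unfold deg at this
      rw [Set.ncard_eq_toFinset_card', ← SimpleGraph.neighborFinset_def] at this
      omega)
  have h3 := hst.card_le
  have h4 := h1.trans h2
  have h5 : U.card * 3 ≤ p.D * (p.ends h).card * 3 := Nat.mul_le_mul_right 3 (hU.trans h3)
  linarith

lemma card_E₅_le_progress :
    (p.E₅ h).card ≤ progress (p.base h ⊔ gr (p.E₅ h)) (p.frame h) := by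
  have : p.E₅ h = greedy (fun s e => progress (p.base h ⊔ gr s) (p.frame h) <
      progress (p.base h ⊔ gr (insert e s)) (p.frame h)) (window p.τ₄ p.T h) := by
    unfold E₅ phase
    beta_reduce
    rw [base_take hp le_rfl, frame_take hp le_rfl]
  rw [this]
  refine greedy_induction (P := fun s => s.card ≤ progress (p.base h ⊔ gr s) (p.frame h))
    (by simp) ?_ _
  intro s e hs hr
  have := card_insert_le e s
  omega

omit hp in
lemma gr_sel : gr (p.sel h) = p.base h ⊔ gr (p.E₅ h) := by
  unfold sel base gr
  rw [coe_union, SimpleGraph.fromEdgeSet_union]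

/-- The structural requirements on the first four phases. -/
lemma ready_frame (hm : 1 ≤ p.m) (hJ : Joined (gr (p.E₁ h)) (p.reserve n) p.m)
    (hs : 23 * p.m ≤ (p.reserve n).card)
    (hgood : ∀ v ∈ p.ends h, ∃ T ⊆ leaves (p.E₃ h) (p.inner h) v, 2 ≤ T.card ∧
      ∀ x ∈ T, ∀ w, (w = x ∨ (gr (p.E₂ h)).Adj x w) → 10 ≤ load (p.E₄ h) w) :
    Ready (p.base h) (p.frame h) (p.core h) p.m := by
  obtain ⟨h1, h2, h3⟩ := core_spec hJ hs
  have hne : (p.core h).Nonempty := by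
    rw [← card_pos]
    have := le_card_sdiff (p.core h) (p.reserve n)
    omega
  have hle : ∀ {s : Finset (Sym2 (Fin n))}, s ⊆ p.E₁ h ∪ p.E₂ h ∪ p.E₃ h ∪ p.E₄ h →
      gr s ≤ p.base h := fun hs => SimpleGraph.fromEdgeSet_mono (by exact_mod_cast hs)
  have hE : Expander (p.base h) (p.core h) p.m := by
    have hle1 : gr (p.E₁ h) ≤ p.base h := hle fun x hx => by simp [hx]
    refine ⟨fun R hR hRne hRm => ?_, fun A hA hAne hAS => ?_⟩
    · obtain ⟨Y, hY, hd, hc, hadj⟩ := h3.expand R hR hRne hRm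
      exact ⟨Y, hY, hd, hc, fun y hy => by
        obtain ⟨r, hr, hry⟩ := hadj y hy
        exact ⟨r, hr, hle1 hry⟩⟩
    · obtain ⟨a, ha, b, hb, hbA, hab⟩ := h3.connected A hA hAne hAS
      exact ⟨a, ha, b, hb, hbA, hle1 hab⟩
  have hex : ∃ F, Ready (p.base h) F (p.core h) p.m := by
    have hst3 := isStars_E₃ (h := h) hp
    have hst4 := isStars_E₄ (h := h) hp
    refine exists_ready hm hne hE (hle fun x hx => by simp [hx]) linForest_E₂
      (fun v hv w => not_adj_core hv w) (fun v => mem_ends) (fun v => mem_inner)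
      hst3 hst4 ?_ ?_ hgood
    · intro a b hab
      refine hle (s := p.E₃ h) (fun x hx => by simp [hx]) ?_
      rw [SimpleGraph.fromEdgeSet_adj]
      refine ⟨by exact_mod_cast hab, ?_⟩
      rintro rfl
      obtain ⟨q, hq, y, hy, hqy⟩ := hst3.edge _ hab
      rcases Sym2.eq_iff.1 hqy with ⟨rfl, rfl⟩ | ⟨rfl, rfl⟩ <;>
      exact disjoint_left.1 disjoint_ends_inner hq hy
    · intro a b hab
      refine hle (s := p.E₄ h) (fun x hx => by simp [hx]) ?_
      rw [SimpleGraph.fromEdgeSet_adj]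
      refine ⟨by exact_mod_cast hab, ?_⟩
      rintro rfl
      obtain ⟨q, hq, y, hy, hqy⟩ := hst4.edge _ hab
      rcases Sym2.eq_iff.1 hqy with ⟨rfl, rfl⟩ | ⟨rfl, rfl⟩ <;>
      exact disjoint_left.1 disjoint_cut_core hq hy
  unfold frame
  rw [dif_pos hex]
  exact hex.choose_spec

omit hp in
/-- A ready pair has few vertices of small degree. -/
lemma progress_le_of_ready {G G' F : SimpleGraph (Fin n)} {S : Finset (Fin n)} {m : ℕ}
    (hR : Ready G F S m) : 10 * progress G' F ≤ 11 * S.card + 10 := by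
  classical
  obtain ⟨P, hP1, hP2⟩ := hR.private_nbrs
  let U := univ.filter fun v => deg F v ≤ 1
  let Q := U.filter fun v => v ∉ S
  have h1 : progress G' F ≤ U.card + 1 := by
    have := progress_le_core (G := G') (F := F)
    convert this
  have h2 : U.card ≤ S.card + Q.card := by
    have : U ⊆ S ∪ Q := by
      intro v hv
      by_cases hvS : v ∈ S
      · exact mem_union_left _ hvS
      · exact mem_union_right _ (mem_filter.2 ⟨hv, hvS⟩)
    exact (card_le_card this).trans (card_union_le _ _)
  have hQ : ∀ v ∈ Q, v ∉ S ∧ deg F v ≤ 1 := fun v hv =>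
    ⟨(mem_filter.1 hv).2, (mem_filter.1 (mem_filter.1 hv).1).2⟩
  have h3 : Q.card * 10 ≤ S.card := by
    have hb : (Q.biUnion P).card = ∑ v ∈ Q, (P v).card := card_biUnion fun v hv w hw hvw =>
      hP2 v w (hQ v hv).1 (hQ v hv).2 (hQ w hw).1 (hQ w hw).2 hvw
    have hsub : Q.biUnion P ⊆ S := biUnion_subset.2 fun v hv => (hP1 v (hQ v hv).1 (hQ v hv).2).1
    have hs : Q.card * 10 ≤ ∑ v ∈ Q, (P v).card := by
      rw [← smul_eq_mul]
      exact card_nsmul_le_sum _ _ _ fun v hv => (hP1 v (hQ v hv).1 (hQ v hv).2).2.1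
    have := card_le_card hsub
    omega
  omega

lemma card_sel_le (hsn : p.s ≤ n) (hR : Ready (p.base h) (p.frame h) (p.core h) p.m) :
    (p.sel h).card ≤ (p.E₁ h).card + n + 31 * (p.D * (p.ends h).card) + 2 * p.s + 1 := by
  have h1 := card_E₂_le (p := p) (h := h)
  have h2 := (isStars_E₃ (h := h) hp).card_le
  have h3 := (isStars_E₄ (h := h) hp).card_le
  have h4 := card_cut_le (h := h) hp
  have h5 := card_E₅_le_progress (h := h) hp
  have h6 := progress_le_of_ready (G' := p.base h ⊔ gr (p.E₅ h)) hR
  have h7 := card_le_card (core_subset (p := p) (h := h))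
  rw [card_reserve hsn] at h7
  have h8 : (p.sel h).card ≤ (p.E₁ h).card + (p.E₂ h).card + (p.E₃ h).card + (p.E₄ h).card +
      (p.E₅ h).card := by
    unfold sel
    have a1 := card_union_le (p.E₁ h ∪ p.E₂ h ∪ p.E₃ h ∪ p.E₄ h) (p.E₅ h)
    have a2 := card_union_le (p.E₁ h ∪ p.E₂ h ∪ p.E₃ h) (p.E₄ h)
    have a3 := card_union_le (p.E₁ h ∪ p.E₂ h) (p.E₃ h)
    have a4 := card_union_le (p.E₁ h) (p.E₂ h)
    omega
  omega

end Params

end KChoice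

namespace KChoice
open Finset

lemma one_sub_exp_neg_one : (1 : ℝ) / 2 ≤ 1 - Real.exp (-1) := by
  have h1 := Real.exp_one_gt_d9
  have h2 : Real.exp (-1) * Real.exp 1 = 1 := by rw [← Real.exp_add]; simp
  have h3 := Real.exp_pos (-1)
  nlinarith

section Windows
variable {n : ℕ}

/-- Within a window some edge of a large set is revealed. -/
lemma pr_window_miss (F : Finset (Sym2 (Fin n))) (hF : ∀ e ∈ F, ¬ e.IsDiag) {a b q : ℕ}
    (hab : a ≤ b) (hb : b ≤ numEdges n) (hq : q + b ≤ F.card) :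
    pr n (fun σ => ∀ e ∈ F, e ∉ window a b (hist σ b)) ≤
      Real.exp (-(1 / 2 * ((q : ℝ) / numEdges n) * ((b : ℝ) - a))) := by
  classical
  have key := pr_lower_tail (n := n) 1 ((q : ℝ) / numEdges n) zero_le_one 0
    (fun h => ((window a b h).filter (· ∈ F)).length) (fun _ => True) (fun _ e => e ∈ F)
    (by positivity) hab hb
    (by
      intro σ t i _ _ _ _
      rw [window_append_singleton]
      split_ifs <;> simp)
    (by
      intro σ t i h1 h2 _ _ h4
      rw [window_append_singleton, length_hist σ t.2.le, if_pos ⟨h1, h2⟩]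
      simp [h4])
    (by
      intro σ t h1 h2 _
      have hN : (0 : ℝ) < numEdges n := by exact_mod_cast (Nat.zero_le _).trans_lt t.2
      rw [div_mul_cancel₀ _ hN.ne']
      have := card_sub_le_avail (fun e => e ∈ F) F σ t (fun e he => ⟨hF e he, fun _ => he⟩) b (by
        calc (F.filter (fun e => e ∈ hist σ t)).card ≤ (hist σ t).toFinset.card :=
              card_le_card fun e he => List.mem_toFinset.2 (mem_filter.1 he).2
          _ ≤ (hist σ t).length := List.toFinset_card_le _
          _ ≤ b := by rw [length_hist σ t.2.le]; exact h2.le)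
      have h3 : q ≤ avail (fun e => e ∈ F) σ t := by omega
      exact_mod_cast h3)
  refine (pr_mono ?_).trans (key.trans ?_)
  · intro σ hσ
    refine ⟨fun _ _ _ => trivial, ?_⟩
    have : (window a b (hist σ b)).filter (· ∈ F) = [] := by
      rw [List.filter_eq_nil_iff]
      intro e he hF
      exact hσ e (by simpa using hF) he
    simp [this]
  · apply Real.exp_le_exp.2
    have h1 := one_sub_exp_neg_one
    have h2 : (0 : ℝ) ≤ (q : ℝ) / numEdges n * ((b : ℝ) - a) := by
      have : (a : ℝ) ≤ b := by exact_mod_cast hab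
      have : (0 : ℝ) ≤ (b : ℝ) - a := by linarith
      positivity
    nlinarith

/-- Within a window any two large disjoint sets get joined by an edge. -/
lemma pr_not_joined (U : Finset (Fin n)) {a b q k : ℕ} (hab : a ≤ b) (hb : b ≤ numEdges n)
    (hq : q + b ≤ k ^ 2) :
    pr n (fun σ => ¬ ∀ A ⊆ U, ∀ B ⊆ U, Disjoint A B → A.card = k → B.card = k →
        ∃ x ∈ A, ∃ y ∈ B, s(x, y) ∈ window a b (hist σ b)) ≤
      4 ^ U.card * Real.exp (-(1 / 2 * ((q : ℝ) / numEdges n) * ((b : ℝ) - a))) := by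
  classical
  let I := (U.powerset ×ˢ U.powerset).filter fun P => Disjoint P.1 P.2 ∧ P.1.card = k ∧ P.2.card = k
  have hbound : ∀ P ∈ I, pr n (fun σ => ∀ x ∈ P.1, ∀ y ∈ P.2, s(x, y) ∉ window a b (hist σ b)) ≤
      Real.exp (-(1 / 2 * ((q : ℝ) / numEdges n) * ((b : ℝ) - a))) := by
    rintro ⟨A, B⟩ hP
    obtain ⟨-, hd, hA, hB⟩ := mem_filter.1 hP
    simp only at hd hA hB ⊢
    have hcard : ((A ×ˢ B).image fun z => s(z.1, z.2)).card = k ^ 2 := by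
      rw [card_image_of_injOn, card_product, hA, hB, sq]
      rintro ⟨x, y⟩ hxy ⟨x', y'⟩ hxy' heq
      simp only [coe_product, Set.mem_prod, mem_coe] at hxy hxy'
      rcases Sym2.eq_iff.1 heq with ⟨rfl, rfl⟩ | ⟨rfl, rfl⟩
      · rfl
      · exact absurd hxy'.2 (disjoint_left.1 hd hxy.1)
    refine (pr_mono ?_).trans (pr_window_miss ((A ×ˢ B).image fun z => s(z.1, z.2)) ?_ hab hb
      (hcard ▸ hq))
    · intro σ hσ e he
      obtain ⟨⟨x, y⟩, hxy, rfl⟩ := mem_image.1 he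
      exact hσ x (mem_product.1 hxy).1 y (mem_product.1 hxy).2
    · intro e he
      obtain ⟨⟨x, y⟩, hxy, rfl⟩ := mem_image.1 he
      simp only [Sym2.mk_isDiag_iff]
      rintro rfl
      exact disjoint_left.1 hd (mem_product.1 hxy).1 (mem_product.1 hxy).2
  calc _ ≤ pr n (fun σ => ∃ P ∈ I, ∀ x ∈ P.1, ∀ y ∈ P.2, s(x, y) ∉ window a b (hist σ b)) := by
        apply pr_mono
        intro σ hσ
        push Not at hσ
        obtain ⟨A, hA, B, hB, h1, h2, h3, h4⟩ := hσ
        exact ⟨(A, B), mem_filter.2 ⟨mem_product.2 ⟨mem_powerset.2 hA, mem_powerset.2 hB⟩,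
          h1, h2, h3⟩, h4⟩
    _ ≤ _ := pr_exists_le I _
    _ ≤ I.card • Real.exp (-(1 / 2 * ((q : ℝ) / numEdges n) * ((b : ℝ) - a))) :=
        sum_le_card_nsmul _ _ _ hbound
    _ ≤ _ := by
        rw [nsmul_eq_mul]
        gcongr
        have : I.card ≤ 4 ^ U.card := by
          refine (card_filter_le _ _).trans ?_
          rw [card_product, card_powerset, ← mul_pow]
          norm_num
        exact_mod_cast this

/-- The initial segment of the process does not contain too many edges of a given set. -/
lemma pr_many (F : Finset (Sym2 (Fin n))) {T : ℕ} (hT : 2 * T ≤ numEdges n) (M : ℝ) :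
    pr n (fun σ => M ≤ (((hist σ T).filter (· ∈ F)).length : ℝ)) ≤
      Real.exp (-M + 4 * ((F.card : ℝ) / numEdges n) * T) := by
  classical
  have key := pr_upper_tail (n := n) 1 (2 * ((F.card : ℝ) / numEdges n)) zero_le_one M
    (fun h => (h.filter (· ∈ F)).length) (fun e => e ∈ F) (t₁ := T) (by omega) (by simp)
    (by
      intro h e
      by_cases he : e ∈ F <;> simp [List.filter_append, he])
    (by
      intro h e he
      simp [List.filter_append, he])
    (by
      intro σ t ht
      have hN : (0 : ℝ) < numEdges n := by exact_mod_cast (Nat.zero_le _).trans_lt t.2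
      have h1 : (avail (fun e => e ∈ F) σ t : ℝ) ≤ F.card := by
        exact_mod_cast avail_le_card _ F (fun e he => he) σ t
      have h2 : ((t : ℕ) : ℝ) ≤ T := by exact_mod_cast ht.le
      have h3 : (2 : ℝ) * T ≤ numEdges n := by exact_mod_cast hT
      refine h1.trans ?_
      rw [mul_div_assoc', div_mul_eq_mul_div, le_div_iff₀ hN]
      have h4 : (0 : ℝ) ≤ F.card := by positivity
      nlinarith)
  refine key.trans (Real.exp_le_exp.2 ?_)
  have h1 : Real.exp 1 - 1 ≤ 2 := by have := Real.exp_one_lt_d9; linarith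
  have h2 : (0 : ℝ) ≤ 2 * ((F.card : ℝ) / numEdges n) * T := by positivity
  nlinarith

lemma load_toFinset_le (h : List (Sym2 (Fin n))) (v : Fin n) :
    load h.toFinset v ≤
      (h.filter (· ∈ univ.image fun w => s(v, w))).length := by
  classical
  refine le_trans (card_le_card ?_) (List.toFinset_card_le _)
  intro e he
  obtain ⟨h1, h2⟩ := mem_filter.1 he
  rw [List.mem_toFinset, List.mem_filter]
  refine ⟨List.mem_toFinset.1 h1, ?_⟩
  obtain ⟨w, rfl⟩ := h2
  simp

/-- No vertex has large degree in an initial segment of the process. -/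
lemma pr_large_load {T : ℕ} (hT : 2 * T ≤ numEdges n) (Δ : ℕ) :
    pr n (fun σ => ¬ ∀ v, load (hist σ T).toFinset v ≤ Δ) ≤
      n * Real.exp (-(Δ : ℝ) + 4 * ((n : ℝ) / numEdges n) * T) := by
  classical
  calc _ ≤ pr n (fun σ => ∃ v ∈ (univ : Finset (Fin n)), (Δ : ℝ) ≤
          (((hist σ T).filter (· ∈ univ.image fun w => s(v, w))).length : ℝ)) := by
        apply pr_mono
        intro σ hσ
        push Not at hσ
        obtain ⟨v, hv⟩ := hσ
        exact ⟨v, mem_univ _, by exact_mod_cast hv.le.trans (load_toFinset_le _ v)⟩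
    _ ≤ _ := pr_exists_le _ _
    _ ≤ (univ : Finset (Fin n)).card • Real.exp (-(Δ : ℝ) + 4 * ((n : ℝ) / numEdges n) * T) := by
        apply sum_le_card_nsmul
        intro v _
        refine (pr_many _ hT _).trans (Real.exp_le_exp.2 ?_)
        have : ((univ.image fun w => s(v, w)).card : ℝ) ≤ n := by
          have := card_image_le (s := (univ : Finset (Fin n))) (f := fun w => s(v, w))
          rw [card_univ, Fintype.card_fin] at this
          exact_mod_cast this
        gcongr
    _ = _ := by simp

lemma phase_hist_subset (a b : ℕ) (R : List (Sym2 (Fin n)) → Finset (Sym2 (Fin n)) →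
    Sym2 (Fin n) → Prop) (σ : Omega n) {s t : ℕ} (hst : s ≤ t) (ht : t ≤ numEdges n) :
    phase a b R (hist σ s) ⊆ phase a b R (hist σ t) := by
  induction t, hst using Nat.le_induction with
  | base => exact subset_rfl
  | succ t hst ih =>
    refine (ih (by omega)).trans ?_
    rw [hist_succ σ ⟨t, ht⟩]
    exact phase_subset_append _ _ _

lemma hist_subset (σ : Omega n) {s t : ℕ} (hst : s ≤ t) :
    (hist σ s).toFinset ⊆ (hist σ t).toFinset := by
  intro e he
  rw [List.mem_toFinset, mem_hist] at he ⊢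
  obtain ⟨i, hi, rfl⟩ := he
  exact ⟨i, by omega, rfl⟩

end Windows

section StarTail
variable {n : ℕ}

/-- A greedy family of stars in which many centres of `K` are still unsaturated although the
remaining degrees leave enough room. -/
structure StarBad (Q Y K : Finset (Fin n)) (c k k' a Δ : ℕ) (s : Finset (Sym2 (Fin n)))
    (h : List (Sym2 (Fin n))) : Prop where
  subset : K ⊆ Q
  disj : Disjoint Q Y
  card_le : K.card ≤ k'
  many : k ≤ (K.filter fun q => load s q < c).card
  room : c * Q.card + Δ + a ≤ Y.card
  deg_le : ∀ v, load h.toFinset v ≤ Δ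

lemma StarBad.mul_le_avail {Q Y K : Finset (Fin n)} {c k k' a Δ t : ℕ} {s : Finset (Sym2 (Fin n))}
    {σ : Omega n} (hB : StarBad Q Y K c k k' a Δ s (hist σ t)) (hs : IsStars Q Y c s) :
    k * a ≤ avail (fun e => starRule Q Y c s e ∧ ∃ q ∈ K, q ∈ e) σ t := by
  obtain ⟨K', hK', hK'c⟩ := exists_subset_card_eq hB.many
  set Y' := Y.filter fun y => load s y = 0 with hY'
  have hYc : Δ + a ≤ Y'.card := by
    have h1 : Y'.card + (Y.filter fun y => load s y ≠ 0).card = Y.card :=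
      card_filter_add_card_filter_not (s := Y) (fun y => load s y = 0)
    have h2 := hs.card_used_le hB.disj
    have h3 := hs.card_le
    have h4 := hB.room
    omega
  have hK'Q : ∀ q ∈ K', q ∈ K ∧ load s q < c := fun q hq => mem_filter.1 (hK' hq)
  set F := (K' ×ˢ Y').image fun z => s(z.1, z.2) with hF
  have hFc : F.card = k * Y'.card := by
    rw [hF, card_image_of_injOn, card_product, hK'c]
    rintro ⟨x, y⟩ hxy ⟨x', y'⟩ hxy' heq
    simp only [coe_product, Set.mem_prod, mem_coe] at hxy hxy'
    rcases Sym2.eq_iff.1 heq with ⟨rfl, rfl⟩ | ⟨rfl, rfl⟩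
    · rfl
    · exact absurd (mem_filter.1 hxy'.2).1
        (disjoint_left.1 hB.disj (hB.subset (hK'Q _ hxy.1).1))
  have hmain := card_sub_le_avail (fun e => starRule Q Y c s e ∧ ∃ q ∈ K, q ∈ e) F σ t
    (by
      intro e he
      obtain ⟨⟨q, y⟩, hqy, rfl⟩ := mem_image.1 he
      obtain ⟨hq, hy⟩ := mem_product.1 hqy
      obtain ⟨hqK, hqc⟩ := hK'Q q hq
      obtain ⟨hyY, hy0⟩ := mem_filter.1 hy
      refine ⟨?_, fun _ => ⟨⟨q, hB.subset hqK, y, hyY, rfl, hy0, hqc⟩, q, hqK,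
        Sym2.mem_mk_left _ _⟩⟩
      simp only [Sym2.mk_isDiag_iff]
      rintro rfl
      exact disjoint_left.1 hB.disj (hB.subset hqK) hyY)
    (k * Δ) (by
      have hsub : F.filter (fun e => e ∈ hist σ t) ⊆
          K'.biUnion fun q => (hist σ t).toFinset.filter fun e => q ∈ e := by
        intro e he
        obtain ⟨h1, h2⟩ := mem_filter.1 he
        obtain ⟨⟨q, y⟩, hqy, rfl⟩ := mem_image.1 h1
        exact mem_biUnion.2 ⟨q, (mem_product.1 hqy).1,
          mem_filter.2 ⟨List.mem_toFinset.2 h2, Sym2.mem_mk_left _ _⟩⟩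
      refine (card_le_card hsub).trans ((card_biUnion_le_card_mul _ _ Δ ?_).trans ?_)
      · intro q _
        exact hB.deg_le q
      · rw [hK'c])
  rw [hFc] at hmain
  have := Nat.mul_le_mul_left k hYc
  rw [mul_add] at this
  omega

/-- A window of the process saturates most of the centres of a greedy family of stars. -/
lemma pr_starBad (Q Y K : List (Sym2 (Fin n)) → Finset (Fin n)) {c k k' a Δ t₀ t₁ : ℕ} {b : ℝ}
    (hb : 0 ≤ b) (h01 : t₀ ≤ t₁) (h1 : t₁ ≤ numEdges n) :
    pr n (fun σ => StarBad (Q (hist σ t₀)) (Y (hist σ t₀)) (K (hist σ t₀)) c k k' a Δ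
        (phase t₀ t₁ (fun g => starRule (Q g) (Y g) c) (hist σ t₁)) (hist σ t₁)) ≤
      Real.exp (b * (c * k') - (1 - Real.exp (-b)) * ((k * a : ℕ) / numEdges n) *
        ((t₁ : ℝ) - t₀)) := by
  classical
  set P := fun h : List (Sym2 (Fin n)) => phase t₀ t₁ (fun g => starRule (Q g) (Y g) c) h with hP
  have hstar : ∀ h, Disjoint (Q (h.take t₀)) (Y (h.take t₀)) →
      IsStars (Q (h.take t₀)) (Y (h.take t₀)) c (P h) := fun h hd => isStars_greedy hd _ _
  have key := pr_lower_tail (n := n) b (((k * a : ℕ) : ℝ) / numEdges n) hb ((c * k' : ℕ) : ℝ)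
    (fun h => ∑ q ∈ K (h.take t₀), load (P h) q)
    (fun h => StarBad (Q (h.take t₀)) (Y (h.take t₀)) (K (h.take t₀)) c k k' a Δ (P h) h)
    (fun h e => starRule (Q (h.take t₀)) (Y (h.take t₀)) c (P h) e ∧
      ∃ q ∈ K (h.take t₀), q ∈ e) (by positivity) h01 h1
    (by
      intro σ t i a1 a2 _ _
      rw [List.take_append_of_le_length (by rw [length_hist σ t.2.le]; exact a1)]
      exact sum_le_sum fun q _ => load_mono (phase_subset_append _ _ _) q)
    (by
      rintro σ t i a1 a2 _ hB ⟨hr, q, hq, hqe⟩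
      rw [List.take_append_of_le_length (by rw [length_hist σ t.2.le]; exact a1)]
      have hPe : P (hist σ t ++ [(σ i).1]) = insert (σ i).1 (P (hist σ t)) := by
        simp only [hP]
        rw [phase_append_singleton, length_hist σ t.2.le, if_pos ⟨⟨a1, a2⟩, hr⟩]
      have hne : (σ i).1 ∉ P (hist σ t) := by
        obtain ⟨q', hq', y, hy, he, hy0, -⟩ := hr
        intro hmem
        rw [load, card_eq_zero] at hy0
        have : (σ i).1 ∈ (P (hist σ t)).filter fun e => y ∈ e :=
          mem_filter.2 ⟨hmem, he ▸ Sym2.mem_mk_right _ _⟩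
        rw [hy0] at this
        simp at this
      rw [hPe, ← Nat.lt_iff_add_one_le]
      refine sum_lt_sum (fun q _ => ?_) ⟨q, hq, ?_⟩
      · exact load_mono (subset_insert _ _) q
      · rw [load_insert hne, if_pos hqe]; omega)
    (by
      intro σ t a1 a2 hB
      have hN : (0 : ℝ) < numEdges n := by exact_mod_cast (Nat.zero_le _).trans_lt t.2
      rw [div_mul_cancel₀ _ hN.ne']
      exact_mod_cast hB.mul_le_avail (hstar _ hB.disj))
  refine (pr_mono ?_).trans (key.trans (le_of_eq ?_))
  · intro σ hB
    have hg : ∀ t, t₀ ≤ t → (hist σ t).take t₀ = hist σ t₀ := fun t ht => take_hist σ ht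
    refine ⟨fun t a1 a2 => ?_, ?_⟩
    · rw [hg t a1]
      have hsub : P (hist σ t) ⊆ P (hist σ t₁) := phase_hist_subset _ _ _ σ a2.le h1
      refine ⟨hB.subset, hB.disj, hB.card_le, hB.many.trans (card_le_card ?_), hB.room,
        fun v => (load_mono (hist_subset σ a2.le) v).trans (hB.deg_le v)⟩
      intro q hq
      rw [mem_filter] at hq ⊢
      exact ⟨hq.1, (load_mono hsub q).trans_lt hq.2⟩
    · rw [hg t₁ h01]
      have hS := hstar (hist σ t₁) (by rw [hg t₁ h01]; exact hB.disj)
      rw [hg t₁ h01] at hS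
      have : ∑ q ∈ K (hist σ t₀), load (P (hist σ t₁)) q ≤ c * k' := by
        refine (sum_le_card_nsmul _ _ c fun q hq => hS.load_le q (hB.subset hq)).trans ?_
        rw [smul_eq_mul, mul_comm]
        exact Nat.mul_le_mul_left c hB.card_le
      exact_mod_cast this
  · push_cast
    ring_nf

end StarTail

namespace Params
variable {p : Params} {n : ℕ}

open Classical in
/-- The last window produces a Hamiltonian cycle. -/
lemma pr_ready_not_isHamiltonian (hp : p.Ordered) (hn : 3 ≤ n) {q : ℕ} (hT : p.T ≤ numEdges n)
    (hq : 2 * (q + p.T) ≤ (p.m + 1) ^ 2) :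
    pr n (fun σ => Ready (p.base (hist σ p.T)) (p.frame (hist σ p.T)) (p.core (hist σ p.T)) p.m ∧
        ¬ (p.base (hist σ p.T) ⊔ gr (p.E₅ (hist σ p.T))).IsHamiltonian) ≤
      Real.exp (n + 1 - 1 / 2 * ((q : ℝ) / numEdges n) * ((p.T : ℝ) - p.τ₄)) := by
  set G := fun h : List (Sym2 (Fin n)) => p.base h ⊔ gr (p.E₅ h) with hG
  have hcore : ∀ h : List (Sym2 (Fin n)), p.core (h.take p.τ₄) = p.core h := fun h =>
    core_take (hp.h₁₂.trans (hp.h₂₃.trans hp.h₃₄))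
  have happ : ∀ (σ : Omega n) (t : Fin (numEdges n)) e, p.τ₄ ≤ t →
      p.base (hist σ t ++ [e]) = p.base (hist σ t) ∧
      p.frame (hist σ t ++ [e]) = p.frame (hist σ t) := by
    intro σ t e ht
    have hlen : p.τ₄ ≤ (hist σ t).length := by rw [length_hist σ t.2.le]; exact ht
    constructor
    · rw [← base_take hp le_rfl, List.take_append_of_le_length hlen, base_take hp le_rfl]
    · rw [← frame_take hp le_rfl, List.take_append_of_le_length hlen, frame_take hp le_rfl]
  have key := pr_lower_tail (n := n) 1 ((q : ℝ) / numEdges n) zero_le_one ((n + 1 : ℕ) : ℝ)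
    (fun h => progress (G h) (p.frame h))
    (fun h => Ready (p.base h) (p.frame h) (p.core h) p.m ∧ ¬ (G h).IsHamiltonian)
    (fun h e => progress (G h) (p.frame h) <
      progress (p.base h ⊔ gr (insert e (p.E₅ h))) (p.frame h)) (by positivity) hp.h₄ hT
    (by
      intro σ t i a1 a2 _ _
      obtain ⟨hb, hf⟩ := happ σ t (σ i).1 a1
      simp only [hG]
      rw [hb, hf]
      exact progress_mono (sup_le_sup_left
        (SimpleGraph.fromEdgeSet_mono (by exact_mod_cast phase_subset_append _ _ _)) _))
    (by
      intro σ t i a1 a2 _ _ hr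
      obtain ⟨hb, hf⟩ := happ σ t (σ i).1 a1
      have h5 : p.E₅ (hist σ t ++ [(σ i).1]) = insert (σ i).1 (p.E₅ (hist σ t)) := by
        unfold E₅
        rw [phase_append_singleton, length_hist σ t.2.le, if_pos]
        refine ⟨⟨a1, a2⟩, ?_⟩
        rw [base_take hp le_rfl, frame_take hp le_rfl]
        exact hr
      simp only [hG]
      rw [hb, hf, h5]
      exact hr)
    (by
      rintro σ t a1 a2 ⟨hR, hH⟩
      have hN : (0 : ℝ) < numEdges n := by exact_mod_cast (Nat.zero_le _).trans_lt t.2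
      rw [div_mul_cancel₀ _ hN.ne']
      obtain ⟨B, hB, hB'⟩ := exists_boosters (hR.mono (le_sup_left (b := gr (p.E₅ (hist σ t)))))
        (by simpa using hn) hH
      have := card_sub_le_avail (fun e => progress (G (hist σ t)) (p.frame (hist σ t)) <
        progress (p.base (hist σ t) ⊔ gr (insert e (p.E₅ (hist σ t)))) (p.frame (hist σ t))) B σ t
        (fun e he => ⟨(hB' e he).1, fun _ => (hB' e he).2 _ ?_ ?_⟩) p.T (by
          calc (B.filter (fun e => e ∈ hist σ t)).card ≤ (hist σ t).toFinset.card :=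
                card_le_card fun e he => List.mem_toFinset.2 (mem_filter.1 he).2
            _ ≤ (hist σ t).length := List.toFinset_card_le _
            _ ≤ p.T := by rw [length_hist σ t.2.le]; exact a2.le)
      · have h3 : q ≤ avail (fun e => progress (G (hist σ t)) (p.frame (hist σ t)) <
          progress (p.base (hist σ t) ⊔ gr (insert e (p.E₅ (hist σ t)))) (p.frame (hist σ t)))
            σ t := by omega
        exact_mod_cast h3
      · exact sup_le_sup_left (SimpleGraph.fromEdgeSet_mono (by
          exact_mod_cast subset_insert _ _)) _
      · rw [SimpleGraph.edgeSet_sup, SimpleGraph.edgeSet_fromEdgeSet]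
        exact Or.inr ⟨by simp, (hB' e he).1⟩)
  refine (pr_mono ?_).trans (key.trans (Real.exp_le_exp.2 ?_))
  · rintro σ ⟨hR, hH⟩
    refine ⟨fun t a1 a2 => ?_, ?_⟩
    · have ht : (hist σ p.T).take t = hist σ t := take_hist σ a2.le
      have hb : p.base (hist σ t) = p.base (hist σ p.T) := by rw [← ht, base_take hp a1]
      have hf : p.frame (hist σ t) = p.frame (hist σ p.T) := by rw [← ht, frame_take hp a1]
      have hc : p.core (hist σ t) = p.core (hist σ p.T) := by
        rw [← ht, core_take (hp.h₁₂.trans (hp.h₂₃.trans (hp.h₃₄.trans a1)))]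
      refine ⟨by rw [hb, hf, hc]; exact hR, fun hham => hH (hham.mono ?_)⟩
      simp only [hG]
      rw [hb]
      exact sup_le_sup_left (SimpleGraph.fromEdgeSet_mono (by
        exact_mod_cast phase_hist_subset _ _ _ σ a2.le hT)) _
    · have : progress (G (hist σ p.T)) (p.frame (hist σ p.T)) ≤ n + 1 := by
        simpa using progress_le (G := G (hist σ p.T)) (F := p.frame (hist σ p.T))
      exact_mod_cast this
  · have h1 := one_sub_exp_neg_one
    have h2 : (0 : ℝ) ≤ (q : ℝ) / numEdges n * ((p.T : ℝ) - p.τ₄) := by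
      have : (p.τ₄ : ℝ) ≤ p.T := by exact_mod_cast hp.h₄
      have : (0 : ℝ) ≤ (p.T : ℝ) - p.τ₄ := by linarith
      positivity
    push_cast
    nlinarith

end Params

end KChoice

namespace KChoice
open Finset
namespace Params
variable {p : Params} {n : ℕ} {h : List (Sym2 (Fin n))}

open Classical in
/-- The vertices at distance at most one in the forest from the leaves attached to an end `v`. -/
noncomputable def alt (p : Params) (v : Fin n) (h : List (Sym2 (Fin n))) : Finset (Fin n) :=
  univ.filter fun w => v ∈ p.ends h ∧ ∃ x ∈ leaves (p.E₃ h) (p.inner h) v,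
    w = x ∨ (gr (p.E₂ h)).Adj x w

lemma alt_subset_cut (v : Fin n) : p.alt v h ⊆ p.cut h := by
  intro w hw
  simp only [alt, mem_filter, mem_univ, true_and] at hw
  obtain ⟨-, x, hx, hxw⟩ := hw
  obtain ⟨hxi, hxE⟩ := mem_filter.1 hx
  simp only [cut, mem_filter, mem_univ, true_and]
  refine ⟨x, hxi, ?_, hxw⟩
  rw [load, ← Nat.pos_iff_ne_zero, card_pos]
  exact ⟨_, mem_filter.2 ⟨hxE, Sym2.mem_mk_right _ _⟩⟩

lemma card_closedNbhd_le (v : Fin n) :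
    letI := Classical.decRel (gr (p.E₂ h)).Adj
    (insert v ((gr (p.E₂ h)).neighborFinset v)).card ≤ 3 := by
  classical
  refine (card_insert_le _ _).trans ?_
  have := (linForest_E₂ (p := p) (h := h)).deg_le v
  unfold deg at this
  rw [Set.ncard_eq_toFinset_card', ← SimpleGraph.neighborFinset_def] at this
  exact Nat.add_le_add_right (by convert this) 1

lemma card_alt_le (hp : p.Ordered) (v : Fin n) : (p.alt v h).card ≤ 3 * p.D := by
  classical
  by_cases hv : v ∈ p.ends h
  · have h1 : (leaves (p.E₃ h) (p.inner h) v).card ≤ p.D := by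
      refine le_trans ?_ ((isStars_E₃ (h := h) hp).load_le v hv)
      unfold load
      rw [← card_image_of_injective (leaves (p.E₃ h) (p.inner h) v)
        (f := fun y => s(v, y)) (fun y z hyz => Sym2.congr_right.1 hyz)]
      refine card_le_card fun e he => ?_
      obtain ⟨y, hy, rfl⟩ := mem_image.1 he
      exact mem_filter.2 ⟨(mem_filter.1 hy).2, Sym2.mem_mk_left _ _⟩
    have hsub : p.alt v h ⊆ (leaves (p.E₃ h) (p.inner h) v).biUnion
        fun x => insert x ((gr (p.E₂ h)).neighborFinset x) := by
      intro w hw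
      simp only [alt, mem_filter, mem_univ, true_and] at hw
      obtain ⟨-, x, hx, hxw⟩ := hw
      refine mem_biUnion.2 ⟨x, hx, ?_⟩
      simpa using hxw
    have h2 := card_biUnion_le_card_mul (leaves (p.E₃ h) (p.inner h) v)
      (fun x => insert x ((gr (p.E₂ h)).neighborFinset x)) 3
      (fun x _ => by convert card_closedNbhd_le (p := p) (h := h) x)
    have := card_le_card hsub
    nlinarith
  · have : p.alt v h = ∅ := by
      simp [alt, hv]
    simp [this]

/-- Either an end has two good leaves or many vertices near its leaves lack neighbours in the
expander. -/
lemma exists_good_leaves (hp : p.Ordered) {k : ℕ} (hD : p.D = 3 * k + 1) {v : Fin n}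
    (hv : v ∈ p.ends h) (hl : p.D ≤ load (p.E₃ h) v)
    (hk : ((p.alt v h).filter fun w => load (p.E₄ h) w < 10).card < k) :
    ∃ T ⊆ leaves (p.E₃ h) (p.inner h) v, 2 ≤ T.card ∧
      ∀ x ∈ T, ∀ w, (w = x ∨ (gr (p.E₂ h)).Adj x w) → 10 ≤ load (p.E₄ h) w := by
  classical
  set L := leaves (p.E₃ h) (p.inner h) v with hL
  have hLc : 3 * k + 1 ≤ L.card := by
    rw [← hD]
    exact hl.trans ((isStars_E₃ hp).load_le_card_leaves
      (disjoint_left.1 disjoint_ends_inner hv))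
  let good : Fin n → Prop := fun x =>
    ∀ w, (w = x ∨ (gr (p.E₂ h)).Adj x w) → 10 ≤ load (p.E₄ h) w
  refine ⟨L.filter good, filter_subset _ _, ?_, fun x hx => (mem_filter.1 hx).2⟩
  have hsplit := card_filter_add_card_filter_not (s := L) good
  have hbad : (L.filter fun x => ¬ good x).card ≤
      3 * ((p.alt v h).filter fun w => load (p.E₄ h) w < 10).card := by
    have hch : ∀ x, ∃ w, ¬ good x → (w = x ∨ (gr (p.E₂ h)).Adj x w) ∧ load (p.E₄ h) w < 10 := by
      intro x
      by_cases hx : good x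
      · exact ⟨x, fun h' => absurd hx h'⟩
      · simp only [good] at hx
        push Not at hx
        obtain ⟨w, hw1, hw2⟩ := hx
        exact ⟨w, fun _ => ⟨hw1, hw2⟩⟩
    choose f hf using hch
    refine card_le_mul_card_image_of_maps_to (f := f) ?_ 3 ?_
    · intro x hx
      obtain ⟨hxL, hxb⟩ := mem_filter.1 hx
      refine mem_filter.2 ⟨?_, (hf x hxb).2⟩
      simp only [alt, mem_filter, mem_univ, true_and]
      exact ⟨hv, x, hxL, (hf x hxb).1⟩
    · intro w _
      refine le_trans (card_le_card ?_) (card_closedNbhd_le (p := p) (h := h) w)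
      intro x hx
      obtain ⟨hx1, rfl⟩ := mem_filter.1 hx
      have := (hf x (mem_filter.1 hx1).2).1
      simp only [mem_insert, SimpleGraph.mem_neighborFinset]
      rcases this with h' | h'
      · exact Or.inl h'.symm
      · exact Or.inr h'.symm
  omega

lemma card_inner_add : (p.inner h).card + (p.ends h).card + (p.core h).card = n := by
  classical
  have h1 : p.inner h ∪ p.ends h ∪ p.core h = univ := by
    ext v
    simp only [mem_union, mem_inner, mem_ends, mem_univ, iff_true]
    have := (linForest_E₂ (p := p) (h := h)).deg_le v
    by_cases hv : v ∈ p.core h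
    · exact Or.inr hv
    · rcases Nat.lt_or_ge (deg (gr (p.E₂ h)) v) 2 with h' | h'
      · exact Or.inl (Or.inr ⟨hv, by omega⟩)
      · exact Or.inl (Or.inl ⟨hv, by omega⟩)
  have h2 : Disjoint (p.inner h ∪ p.ends h) (p.core h) := by
    rw [disjoint_left]
    intro v hv
    rcases mem_union.1 hv with hv | hv
    · exact (mem_inner.1 hv).1
    · exact (mem_ends.1 hv).1
  have h3 := card_union_of_disjoint h2
  rw [card_union_of_disjoint disjoint_ends_inner.symm, h1, card_univ, Fintype.card_fin] at h3
  omega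

/-- Numerical requirements on the parameters of the algorithm on `n` vertices. -/
structure Admissible (p : Params) (n μ k Δ a₃ a₄ q₁ q₂ q₅ : ℕ) : Prop where
  ordered : p.Ordered
  three_le : 3 ≤ n
  time : 2 * p.T ≤ numEdges n
  m_pos : 1 ≤ p.m
  m_le : 23 * p.m ≤ p.s
  s_le : p.s ≤ n
  D_eq : p.D = 3 * k + 1
  expand : q₁ + p.τ₁ ≤ p.m ^ 2
  forest : q₂ + p.τ₂ ≤ μ ^ 2
  boost : 2 * (q₅ + p.T) ≤ (p.m + 1) ^ 2
  room₃ : p.D * (3 * μ) + Δ + a₃ + p.s + 3 * μ ≤ n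
  room₄ : 90 * (p.D * μ) + Δ + a₄ + p.m ≤ p.s

/-- The algorithm succeeds. -/
def Success (p : Params) (M : ℕ) (h : List (Sym2 (Fin n))) : Prop :=
  (p.sel h).card ≤ M ∧ (gr (p.sel h)).IsHamiltonian

/-- If none of the bad events occurs then the algorithm succeeds. -/
lemma success_of_good {μ k Δ a₃ a₄ q₁ q₂ q₅ M : ℕ} (hA : p.Admissible n μ k Δ a₃ a₄ q₁ q₂ q₅)
    (hJ₁ : ∀ A ⊆ p.reserve n, ∀ B ⊆ p.reserve n, Disjoint A B → A.card = p.m → B.card = p.m →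
      ∃ x ∈ A, ∃ y ∈ B, s(x, y) ∈ window 0 p.τ₁ h)
    (hE₁ : (p.E₁ h).card ≤ M)
    (hdeg : ∀ v, load h.toFinset v ≤ Δ)
    (hJ₂ : ∀ A ⊆ univ, ∀ B ⊆ univ, Disjoint A B → A.card = μ → B.card = μ →
      ∃ x ∈ A, ∃ y ∈ B, s(x, y) ∈ window p.τ₁ p.τ₂ h)
    (h₃ : ∀ v, ¬ StarBad (p.ends h) (p.inner h) (p.ends h ∩ {v}) p.D 1 1 a₃ Δ (p.E₃ h) h)
    (h₄ : ∀ v, ¬ StarBad (p.cut h) (p.core h) (p.alt v h) 10 k (3 * p.D) a₄ Δ (p.E₄ h) h)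
    (h₅ : Ready (p.base h) (p.frame h) (p.core h) p.m →
      (p.base h ⊔ gr (p.E₅ h)).IsHamiltonian) :
    p.Success (M + n + 93 * (p.D * μ) + 2 * p.s + 1) h := by
  classical
  have hp := hA.ordered
  have hres := card_reserve hA.s_le
  have hs : 23 * p.m ≤ (p.reserve n).card := by rw [hres]; exact hA.m_le
  have hJ : Joined (gr (p.E₁ h)) (p.reserve n) p.m := by
    intro A hAr B hBr hd hAc hBc
    obtain ⟨x, hx, y, hy, hxy⟩ := hJ₁ A hAr B hBr hd hAc hBc
    refine ⟨x, hx, y, hy, ?_⟩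
    obtain ⟨s, -, hr⟩ := exists_subset_greedy
      (r := fun _ e => ∀ v ∈ e, v ∈ p.reserve n) hxy
    rw [SimpleGraph.fromEdgeSet_adj]
    refine ⟨?_, fun h' => disjoint_left.1 hd hx (h' ▸ hy)⟩
    have : s(x, y) ∈ p.E₁ h := hr (by
      intro v hv
      rcases Sym2.mem_iff.1 hv with rfl | rfl
      · exact hAr hx
      · exact hBr hy)
    exact_mod_cast this
  obtain ⟨hcore, hcore', -⟩ := core_spec hJ hs
  have hends : (p.ends h).card ≤ 3 * μ := card_ends_lt fun A B => hJ₂ A (subset_univ _) B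
    (subset_univ _)
  have hcorele : (p.core h).card ≤ p.s := hres ▸ card_le_card hcore
  have hcorege : p.s ≤ (p.core h).card + p.m := by
    have := le_card_sdiff (p.core h) (p.reserve n)
    omega
  have hDends : p.D * (p.ends h).card ≤ p.D * (3 * μ) := Nat.mul_le_mul_left _ hends
  have hDends' : p.D * (3 * μ) = 3 * (p.D * μ) := by ring
  have hload : ∀ v ∈ p.ends h, p.D ≤ load (p.E₃ h) v := by
    intro v hv
    by_contra hlt
    refine h₃ v ⟨inter_subset_left, disjoint_ends_inner, ?_, ?_, ?_, hdeg⟩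
    · exact (card_le_card inter_subset_right).trans (by simp)
    · rw [Nat.one_le_iff_ne_zero, ← Nat.pos_iff_ne_zero, card_pos]
      exact ⟨v, by simp [hv, not_le.1 hlt]⟩
    · have h1 := card_inner_add (p := p) (h := h)
      have h2 := hA.room₃
      omega
  have hR : Ready (p.base h) (p.frame h) (p.core h) p.m := by
    refine ready_frame hp hA.m_pos hJ hs fun v hv => ?_
    refine exists_good_leaves hp hA.D_eq hv (hload v hv) ?_
    by_contra hge
    refine h₄ v ⟨alt_subset_cut v, disjoint_cut_core, card_alt_le hp v, not_lt.1 hge, ?_, hdeg⟩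
    have h1 := card_cut_le (h := h) hp
    have h2 := hA.room₄
    omega
  refine ⟨?_, by rw [gr_sel]; exact h₅ hR⟩
  have := card_sel_le hp hA.s_le hR
  omega

/-- The probability that the algorithm fails. -/
theorem pr_not_success_le {μ k Δ a₃ a₄ q₁ q₂ q₅ M : ℕ} {b : ℝ}
    (hA : p.Admissible n μ k Δ a₃ a₄ q₁ q₂ q₅) (hb : 0 ≤ b) :
    pr n (fun σ => ¬ p.Success (M + n + 93 * (p.D * μ) + 2 * p.s + 1) (hist σ p.T)) ≤
      4 ^ p.s * Real.exp (-(1 / 2 * ((q₁ : ℝ) / numEdges n) * p.τ₁)) +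
      Real.exp (-M + 4 * ((p.s ^ 2 : ℕ) / numEdges n) * p.τ₁) +
      n * Real.exp (-(Δ : ℝ) + 4 * ((n : ℝ) / numEdges n) * p.T) +
      4 ^ n * Real.exp (-(1 / 2 * ((q₂ : ℝ) / numEdges n) * ((p.τ₂ : ℝ) - p.τ₁))) +
      n * Real.exp (b * p.D - (1 - Real.exp (-b)) * ((a₃ : ℝ) / numEdges n) *
        ((p.τ₃ : ℝ) - p.τ₂)) +
      n * Real.exp (30 * p.D - 1 / 2 * ((k * a₄ : ℕ) / numEdges n) * ((p.τ₄ : ℝ) - p.τ₃)) +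
      Real.exp (n + 1 - 1 / 2 * ((q₅ : ℝ) / numEdges n) * ((p.T : ℝ) - p.τ₄)) := by
  classical
  have hp := hA.ordered
  have ht := hA.time
  have c4 := hp.h₄
  have c3 := hp.h₃₄
  have c2 := hp.h₂₃
  have c1 := hp.h₁₂
  have hw : ∀ (σ : Omega n) {a b : ℕ}, b ≤ p.T →
      window a b (hist σ p.T) = window a b (hist σ b) := by
    intro σ a b hb
    rw [← take_hist σ hb, window_take le_rfl]
  have hres := card_reserve hA.s_le
  have b1 := pr_not_joined (p.reserve n) (a := 0) (b := p.τ₁) (q := q₁) (k := p.m)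
    (Nat.zero_le _) (by omega) hA.expand
  have b2 : pr n (fun σ => ¬ (p.E₁ (hist σ p.T)).card ≤ M) ≤
      Real.exp (-M + 4 * ((p.s ^ 2 : ℕ) / numEdges n) * p.τ₁) := by
    set F := (p.reserve n ×ˢ p.reserve n).image fun z => s(z.1, z.2) with hF
    have hFc : F.card ≤ p.s ^ 2 := by
      refine card_image_le.trans ?_
      rw [card_product, hres, sq]
    refine (pr_mono ?_).trans ((pr_many F (T := p.τ₁) (by omega) M).trans
      (Real.exp_le_exp.2 ?_))
    · intro σ hσ
      push Not at hσ
      have : (p.E₁ (hist σ p.T)).card ≤ ((hist σ p.τ₁).filter (· ∈ F)).length := by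
        refine le_trans (card_le_card ?_) (List.toFinset_card_le _)
        intro e he
        rw [List.mem_toFinset, List.mem_filter]
        rw [← E₁_take le_rfl, take_hist σ (by omega)] at he
        refine ⟨mem_of_mem_phase he, ?_⟩
        have hmem : ∀ e ∈ p.E₁ (hist σ p.τ₁), ∀ v ∈ e, v ∈ p.reserve n := by
          unfold E₁ phase
          refine greedy_induction (P := fun s : Finset (Sym2 (Fin n)) =>
            ∀ e ∈ s, ∀ v ∈ e, v ∈ p.reserve n) (by simp) ?_ _
          intro s e hs hr f hf
          rcases mem_insert.1 hf with rfl | hf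
          · exact hr
          · exact hs f hf
        have h1 := hmem e he
        induction e with
        | _ x y =>
          simp only [hF, decide_eq_true_eq]
          exact mem_image.2 ⟨(x, y), mem_product.2 ⟨h1 x (Sym2.mem_mk_left _ _),
            h1 y (Sym2.mem_mk_right _ _)⟩, rfl⟩
      exact_mod_cast hσ.le.trans this
    · have : (F.card : ℝ) ≤ (p.s ^ 2 : ℕ) := by exact_mod_cast hFc
      gcongr
  have b3 := pr_large_load (n := n) ht Δ
  have b4 := pr_not_joined (univ : Finset (Fin n)) (a := p.τ₁) (b := p.τ₂) (q := q₂) (k := μ)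
    c1 (by omega) hA.forest
  rw [card_univ, Fintype.card_fin] at b4
  rw [hres] at b1
  have hdeg : ∀ (σ : Omega n) {t : ℕ}, t ≤ p.T → ∀ {Δ v}, load (hist σ p.T).toFinset v ≤ Δ →
      load (hist σ t).toFinset v ≤ Δ := fun σ t ht Δ v hv =>
    (load_mono (hist_subset σ ht) v).trans hv
  have b5 : pr n (fun σ => ∃ v ∈ (univ : Finset (Fin n)),
      StarBad (p.ends (hist σ p.T)) (p.inner (hist σ p.T)) (p.ends (hist σ p.T) ∩ {v})
        p.D 1 1 a₃ Δ (p.E₃ (hist σ p.T)) (hist σ p.T)) ≤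
      n * Real.exp (b * p.D - (1 - Real.exp (-b)) * ((a₃ : ℝ) / numEdges n) *
        ((p.τ₃ : ℝ) - p.τ₂)) := by
    refine (pr_exists_le _ _).trans ?_
    have : (n : ℝ) = ((univ : Finset (Fin n)).card : ℝ) := by simp
    rw [this, ← nsmul_eq_mul]
    refine sum_le_card_nsmul _ _ _ fun v _ => ?_
    refine (pr_mono ?_).trans ((pr_starBad p.ends p.inner (fun g => p.ends g ∩ {v}) (c := p.D)
      (k := 1) (k' := 1) (a := a₃) (Δ := Δ) (b := b) hb c2 (by omega)).trans_eq ?_)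
    · intro σ hB
      have e1 := take_hist σ (show p.τ₂ ≤ p.T by omega)
      have e2 := take_hist σ (show p.τ₃ ≤ p.T by omega)
      have e3 : phase p.τ₂ p.τ₃ (fun g => starRule (p.ends g) (p.inner g) p.D) (hist σ p.τ₃) =
          p.E₃ (hist σ p.T) := by rw [← e2, ← E₃_take (h := hist σ p.T) hp le_rfl]; rfl
      rw [e3, ← e1, ends_take hp le_rfl, inner_take hp le_rfl]
      exact ⟨hB.subset, hB.disj, hB.card_le, hB.many, hB.room,
        fun v => hdeg σ (by omega) (hB.deg_le v)⟩
    · push_cast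
      ring_nf
  have b6 : pr n (fun σ => ∃ v ∈ (univ : Finset (Fin n)),
      StarBad (p.cut (hist σ p.T)) (p.core (hist σ p.T)) (p.alt v (hist σ p.T))
        10 k (3 * p.D) a₄ Δ (p.E₄ (hist σ p.T)) (hist σ p.T)) ≤
      n * Real.exp (30 * p.D - 1 / 2 * ((k * a₄ : ℕ) / numEdges n) * ((p.τ₄ : ℝ) - p.τ₃)) := by
    refine (pr_exists_le _ _).trans ?_
    have : (n : ℝ) = ((univ : Finset (Fin n)).card : ℝ) := by simp
    rw [this, ← nsmul_eq_mul]
    refine sum_le_card_nsmul _ _ _ fun v _ => ?_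
    refine (pr_mono ?_).trans ((pr_starBad p.cut p.core (p.alt v) (c := 10)
      (k := k) (k' := 3 * p.D) (a := a₄) (Δ := Δ) (b := 1) zero_le_one c3 (by omega)).trans
      (Real.exp_le_exp.2 ?_))
    · intro σ hB
      have e1 := take_hist σ (show p.τ₃ ≤ p.T by omega)
      have e2 := take_hist σ (show p.τ₄ ≤ p.T by omega)
      have e3 : phase p.τ₃ p.τ₄ (fun g => starRule (p.cut g) (p.core g) 10) (hist σ p.τ₄) =
          p.E₄ (hist σ p.T) := by rw [← e2, ← E₄_take (h := hist σ p.T) hp le_rfl]; rfl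
      have e4 : p.alt v ((hist σ p.T).take p.τ₃) = p.alt v (hist σ p.T) := by
        unfold alt
        rw [ends_take hp c2, E₃_take hp le_rfl, inner_take hp c2, E₂_take hp c2]
      rw [e3, ← e1, e4, cut_take hp le_rfl, core_take (by omega)]
      exact ⟨hB.subset, hB.disj, hB.card_le, hB.many, hB.room,
        fun v => hdeg σ (by omega) (hB.deg_le v)⟩
    · have h1 := one_sub_exp_neg_one
      have h2 : (0 : ℝ) ≤ ((k * a₄ : ℕ) : ℝ) / numEdges n * ((p.τ₄ : ℝ) - p.τ₃) := by
        have : (p.τ₃ : ℝ) ≤ p.τ₄ := by exact_mod_cast c3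
        have : (0 : ℝ) ≤ (p.τ₄ : ℝ) - p.τ₃ := by linarith
        positivity
      push_cast at h2 ⊢
      nlinarith
  have b7 := pr_ready_not_isHamiltonian (n := n) (q := q₅) hp hA.three_le (by omega) hA.boost
  rw [Nat.cast_zero, sub_zero] at b1
  refine le_trans (pr_mono (Q := fun σ => ((((((
    (¬ ∀ A ⊆ p.reserve n, ∀ B ⊆ p.reserve n, Disjoint A B → A.card = p.m → B.card = p.m →
      ∃ x ∈ A, ∃ y ∈ B, s(x, y) ∈ window 0 p.τ₁ (hist σ p.τ₁)) ∨
    ¬ (p.E₁ (hist σ p.T)).card ≤ M) ∨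
    ¬ ∀ v, load (hist σ p.T).toFinset v ≤ Δ) ∨
    ¬ ∀ A ⊆ univ, ∀ B ⊆ univ, Disjoint A B → A.card = μ → B.card = μ →
      ∃ x ∈ A, ∃ y ∈ B, s(x, y) ∈ window p.τ₁ p.τ₂ (hist σ p.τ₂)) ∨
    ∃ v ∈ (univ : Finset (Fin n)),
      StarBad (p.ends (hist σ p.T)) (p.inner (hist σ p.T)) (p.ends (hist σ p.T) ∩ {v})
        p.D 1 1 a₃ Δ (p.E₃ (hist σ p.T)) (hist σ p.T)) ∨
    ∃ v ∈ (univ : Finset (Fin n)),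
      StarBad (p.cut (hist σ p.T)) (p.core (hist σ p.T)) (p.alt v (hist σ p.T))
        10 k (3 * p.D) a₄ Δ (p.E₄ (hist σ p.T)) (hist σ p.T)) ∨
    (Ready (p.base (hist σ p.T)) (p.frame (hist σ p.T)) (p.core (hist σ p.T)) p.m ∧
        ¬ (p.base (hist σ p.T) ⊔ gr (p.E₅ (hist σ p.T))).IsHamiltonian))) ?_) ?_
  · intro σ hσ
    by_contra hcon
    rw [not_or, not_or, not_or, not_or, not_or, not_or] at hcon
    obtain ⟨⟨⟨⟨⟨⟨g1, g2⟩, g3⟩, g4⟩, g5⟩, g6⟩, g7⟩ := hcon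
    rw [not_not] at g1 g2 g3 g4
    rw [← hw σ (by omega)] at g1 g4
    refine hσ (success_of_good hA g1 g2 g3 g4 (fun v hv => g5 ⟨v, mem_univ _, hv⟩)
      (fun v hv => g6 ⟨v, mem_univ _, hv⟩) (fun hR => ?_))
    by_contra hH
    exact g7 ⟨hR, by convert hH⟩
  · refine (pr_or_le _ _).trans (add_le_add ?_ (by convert b7))
    refine (pr_or_le _ _).trans (add_le_add ?_ b6)
    refine (pr_or_le _ _).trans (add_le_add ?_ b5)
    refine (pr_or_le _ _).trans (add_le_add ?_ b4)
    refine (pr_or_le _ _).trans (add_le_add ?_ b3)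
    exact (pr_or_le _ _).trans (add_le_add b1 b2)

end Params
end KChoice

namespace KChoice
open Finset Filter

lemma two_mul_numEdges (n : ℕ) : 2 * (numEdges n : ℝ) = n * ((n : ℝ) - 1) := by
  have h : numEdges n = n.choose 2 := by
    have := Sym2.card_subtype_not_diag (α := Fin n)
    rw [Fintype.card_fin] at this
    rw [← this]
  rw [h, Nat.cast_choose_two]
  ring

lemma four_pow_le (s : ℕ) : (4 : ℝ) ^ s ≤ Real.exp (1.4 * s) := by
  have h : (4 : ℝ) ≤ Real.exp 1.4 := by
    rw [← Real.log_le_iff_le_exp (by norm_num)]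
    have : (4 : ℝ) = 2 ^ 2 := by norm_num
    rw [this, Real.log_pow]
    have := Real.log_two_lt_d9
    push_cast
    linarith
  calc (4 : ℝ) ^ s ≤ Real.exp 1.4 ^ s := by gcongr
    _ = Real.exp (1.4 * s) := by rw [← Real.exp_nat_mul, mul_comm]

/-- The constants of the algorithm. -/
structure Constants (ε e δ κ C : ℝ) (k D : ℕ) : Prop where
  e_pos : 0 < e
  e_le : e ≤ 1
  e_le_eps : e ≤ ε
  δ_eq : 1000000 * δ = e
  C_eq : δ * C = 1800
  D_eq : D = 3 * k + 1
  k_ge : 40 ≤ k * (δ * e)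
  κ_eq : 900 * (D * κ) = δ

lemma exists_constants {ε : ℝ} (hε : 0 < ε) :
    ∃ e δ κ C : ℝ, ∃ k D : ℕ, Constants ε e δ κ C k D := by
  have he : 0 < min ε 1 := lt_min hε one_pos
  set e := min ε 1
  have hδ : 0 < e / 1000000 := by positivity
  set δ := e / 1000000 with hδe
  refine ⟨e, δ, δ / (900 * ((3 * ⌈40 / (δ * e)⌉₊ + 1 : ℕ) : ℝ)), 1800 / δ, ⌈40 / (δ * e)⌉₊,
    3 * ⌈40 / (δ * e)⌉₊ + 1, he, min_le_right _ _, min_le_left _ _, by rw [hδe]; ring,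
    by field_simp, rfl, ?_, ?_⟩
  · rw [← div_le_iff₀ (by positivity)]
    exact Nat.le_ceil _
  · have : (0 : ℝ) < ((3 * ⌈40 / (δ * e)⌉₊ + 1 : ℕ) : ℝ) := by positivity
    field_simp

namespace Constants
variable {ε e δ κ C : ℝ} {k D : ℕ}

/-- The number of vertices is large in terms of the constants. -/
structure Large (ε e δ κ C x L : ℝ) (D : ℕ) : Prop where
  L_ge : 1 ≤ L
  L_lower : 60000 ≤ δ ^ 2 * e * L
  L_lower' : 100 ≤ κ ^ 2 * e * L
  L_lower'' : 8 * (C + 4) ≤ e * L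
  x_C : 10000 * (C + 1) ≤ δ ^ 2 * x
  x_D : 100000 * (D : ℝ) ≤ δ * x
  x_κ : 2 * ((1 + ε) * (L + 1)) ≤ κ ^ 2 * x
  x_δ : 20000 * ((1 + ε) * (L + 1)) ≤ δ ^ 2 * x
  x_κ' : 100 ≤ κ ^ 2 * x

lemma eventually_large (h : Constants ε e δ κ C k D) :
    ∀ᶠ n : ℕ in atTop, Large ε e δ κ C n (Real.log n) D := by
  have he := h.e_pos
  have hδ : 0 < δ := by linarith [h.δ_eq]
  have hκ : 0 < κ := by
    have h1 := h.κ_eq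
    have h2 : (0 : ℝ) < D := by rw [h.D_eq]; positivity
    by_contra hcon
    push Not at hcon
    nlinarith
  have hε : 0 < 1 + ε := by linarith [h.e_le_eps]
  have hn : Tendsto (fun n : ℕ => (n : ℝ)) atTop atTop := tendsto_natCast_atTop_atTop
  have hL : Tendsto (fun n : ℕ => Real.log n) atTop atTop := Real.tendsto_log_atTop.comp hn
  have hLc : ∀ c a : ℝ, 0 < a → ∀ᶠ n : ℕ in atTop, c ≤ a * Real.log n := fun c a ha =>
    (hL.const_mul_atTop ha).eventually_ge_atTop c
  have hnc : ∀ c a : ℝ, 0 < a → ∀ᶠ n : ℕ in atTop, c ≤ a * (n : ℝ) := fun c a ha =>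
    (hn.const_mul_atTop ha).eventually_ge_atTop c
  have hLn : ∀ c a : ℝ, 0 < c → 0 < a → ∀ᶠ n : ℕ in atTop,
      c * ((1 + ε) * (Real.log n + 1)) ≤ a * n := by
    intro c a hc ha
    have h1 := (Real.isLittleO_log_id_atTop.comp_tendsto hn).bound
      (show 0 < a / (2 * (c * (1 + ε))) by positivity)
    filter_upwards [h1, hLc 1 1 one_pos, hnc (c * (1 + ε)) (a / 2) (by positivity)]
      with n hn1 hn2 hn3
    simp only [Function.comp, id, Real.norm_eq_abs, Nat.abs_cast] at hn1
    rw [abs_of_nonneg (by linarith), div_mul_eq_mul_div, le_div_iff₀ (by positivity)] at hn1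
    nlinarith
  filter_upwards [hLc 1 1 one_pos, hLc 60000 (δ ^ 2 * e) (by positivity),
    hLc 100 (κ ^ 2 * e) (by positivity), hLc (8 * (C + 4)) e he,
    hnc (10000 * (C + 1)) (δ ^ 2) (by positivity), hnc (100000 * D) δ hδ,
    hLn 2 (κ ^ 2) (by norm_num) (by positivity), hLn 20000 (δ ^ 2) (by norm_num) (by positivity),
    hnc 100 (κ ^ 2) (by positivity)] with n h1 h2 h3 h4 h5 h6 h7 h8 h9
  exact ⟨by linarith, h2, h3, h4, h5, h6, h7, h8, h9⟩

end Constants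

namespace Params

/-- The parameters of the algorithm on `n` vertices. -/
noncomputable def tuned (ε e δ C : ℝ) (D n : ℕ) : Params where
  s := ⌊δ * n⌋₊
  m := ⌊δ * n / 26⌋₊
  τ₁ := ⌈C * n⌉₊
  τ₂ := ⌈C * n⌉₊ + ⌈e / 8 * (n * Real.log n)⌉₊
  τ₃ := ⌈C * n⌉₊ + ⌈e / 8 * (n * Real.log n)⌉₊ + ⌈(0.5 + e / 2) * (n * Real.log n)⌉₊
  τ₄ := ⌈C * n⌉₊ + ⌈e / 8 * (n * Real.log n)⌉₊ + ⌈(0.5 + e / 2) * (n * Real.log n)⌉₊ +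
    ⌈e / 8 * (n * Real.log n)⌉₊
  T := ⌈(0.5 + ε) * n * Real.log n⌉₊
  D := D

variable {ε e δ κ C : ℝ} {k D n : ℕ}

/-- Elementary consequences of the choice of constants. -/
structure Basic (ε e δ κ C x L N : ℝ) (D : ℕ) : Prop where
  δ_pos : 0 < δ
  δ_le : 1000000 * δ ≤ 1
  κ_pos : 0 < κ
  C_pos : 0 < C
  ε_pos : 0 < ε
  D_ge : (1 : ℝ) ≤ D
  x_ge : 100000 ≤ x
  L_le : L ≤ x
  xL_ge : x ≤ x * L
  N_le : 2 * N ≤ x ^ 2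
  N_ge : 2 * x ^ 2 ≤ 5 * N

lemma basic (h : Constants ε e δ κ C k D)
    (hl : Constants.Large ε e δ κ C n (Real.log n) D) :
    Basic ε e δ κ C n (Real.log n) (numEdges n) D := by
  have he := h.e_pos
  have hδ : 0 < δ := by linarith [h.δ_eq]
  have hδ1 : 1000000 * δ ≤ 1 := by linarith [h.δ_eq, h.e_le]
  have hD : (1 : ℝ) ≤ D := by
    have : 1 ≤ D := by rw [h.D_eq]; omega
    exact_mod_cast this
  have hκ : 0 < κ := by
    have h1 := h.κ_eq
    by_contra hcon
    push Not at hcon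
    nlinarith
  have hC : 0 < C := by
    have h1 := h.C_eq
    by_contra hcon
    push Not at hcon
    nlinarith
  have hx : (100000 : ℝ) ≤ n := by
    have h1 := hl.x_D
    have h2 : (0 : ℝ) ≤ n := by positivity
    nlinarith
  have hN := two_mul_numEdges n
  have hL := hl.L_ge
  refine ⟨hδ, hδ1, hκ, hC, he.trans_le h.e_le_eps, hD, hx, ?_, by nlinarith, by nlinarith,
    by nlinarith⟩
  exact (Real.log_le_sub_one_of_pos (by linarith)).trans (by linarith)

lemma div_ge {q N x c : ℝ} (hN : 0 < N) (hN2 : 2 * N ≤ x ^ 2) (hc : 0 ≤ c)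
    (hq : c * x ^ 2 ≤ q) : 2 * c ≤ q / N := by
  rw [le_div_iff₀ hN]
  nlinarith

lemma div_ge' {q N x c : ℝ} (hN : 0 < N) (hN2 : 2 * N ≤ x ^ 2) (hc : 0 ≤ c) (hx : 0 < x)
    (hq : c * x ≤ q) : 2 * c / x ≤ q / N := by
  rw [div_le_div_iff₀ hx hN]
  nlinarith

lemma div_le {q N x c : ℝ} (hN : 0 < N) (hN2 : 2 * x ^ 2 ≤ 5 * N) (hc : 0 ≤ c)
    (hq : q ≤ c * x ^ 2) : q / N ≤ 5 / 2 * c := by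
  rw [div_le_iff₀ hN]
  nlinarith

end Params
end KChoice

namespace KChoice
open Finset Filter
namespace Params
variable {ε e δ κ C : ℝ} {k D n : ℕ}

/-- The parameters up to rounding. -/
structure Rounded (p : Params) (ε e δ C x L : ℝ) : Prop where
  s_ge : δ * x - 1 ≤ p.s
  s_le : (p.s : ℝ) ≤ δ * x
  m_ge : δ * x / 26 - 1 ≤ p.m
  m_le : (p.m : ℝ) ≤ δ * x / 26
  τ₁_ge : C * x ≤ p.τ₁
  τ₁_le : (p.τ₁ : ℝ) ≤ C * x + 1
  τ₂_ge : e / 8 * (x * L) ≤ p.τ₂ - p.τ₁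
  τ₃_ge : (0.5 + e / 2) * (x * L) ≤ p.τ₃ - p.τ₂
  τ₄_ge : e / 8 * (x * L) ≤ p.τ₄ - p.τ₃
  T_ge : e / 8 * (x * L) ≤ p.T - p.τ₄
  T_le : (p.T : ℝ) ≤ (1 + ε) * (L + 1) * x

lemma rounded (h : Constants ε e δ κ C k D)
    (hl : Constants.Large ε e δ κ C n (Real.log n) D) :
    Rounded (tuned ε e δ C D n) ε e δ C n (Real.log n) := by
  have hb := basic h hl
  have hδ := hb.δ_pos
  have hC := hb.C_pos
  have he := h.e_pos
  have hε := hb.ε_pos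
  have hL := hl.L_ge
  have hx := hb.x_ge
  have hxL := hb.xL_ge
  have hee := h.e_le_eps
  have he1 := h.e_le
  have hTlow := hl.L_lower''
  have hx0 : (0 : ℝ) < n := by linarith
  set x : ℝ := (n : ℝ)
  set L := Real.log x
  have a0 : 0 ≤ e / 8 * (x * L) := by positivity
  have a1 : 0 ≤ (0.5 + e / 2) * (x * L) := by positivity
  have a2 : 0 ≤ (0.5 + ε) * x * L := by positivity
  have b0 := Nat.le_ceil (e / 8 * (x * L))
  have b0' := (Nat.ceil_lt_add_one a0).le
  have b1 := Nat.le_ceil ((0.5 + e / 2) * (x * L))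
  have b1' := (Nat.ceil_lt_add_one a1).le
  have b2 := Nat.le_ceil ((0.5 + ε) * x * L)
  have b2' := (Nat.ceil_lt_add_one a2).le
  have b3 := Nat.le_ceil (C * x)
  have b3' := (Nat.ceil_lt_add_one (show 0 ≤ C * x by positivity)).le
  refine ⟨(Nat.sub_one_lt_floor _).le, Nat.floor_le (by positivity), (Nat.sub_one_lt_floor _).le,
    Nat.floor_le (by positivity), b3, b3', ?_, ?_, ?_, ?_, ?_⟩
  · simp only [tuned]; push_cast; linarith
  · simp only [tuned]; push_cast; linarith
  · simp only [tuned]; push_cast; linarith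
  · simp only [tuned]
    push_cast
    have h1 : 8 * (C + 4) * x ≤ e * L * x := by gcongr
    have h2 : e * (x * L) ≤ ε * (x * L) := by gcongr
    nlinarith
  · simp only [tuned]
    nlinarith

lemma ordered_tuned (h : Constants ε e δ κ C k D)
    (hl : Constants.Large ε e δ κ C n (Real.log n) D) : (tuned ε e δ C D n).Ordered := by
  have hr := rounded h hl
  have hb := basic h hl
  have h0 : 0 ≤ e / 8 * (n * Real.log n) := by
    have := h.e_pos
    have := hl.L_ge
    positivity
  have h1 : ((tuned ε e δ C D n).τ₄ : ℝ) ≤ (tuned ε e δ C D n).T := by linarith [hr.T_ge]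
  refine ⟨?_, ?_, ?_, by exact_mod_cast h1⟩ <;> simp only [tuned] <;> omega

lemma admissible_tuned (h : Constants ε e δ κ C k D)
    (hl : Constants.Large ε e δ κ C n (Real.log n) D) :
    (tuned ε e δ C D n).Admissible n ⌈κ * n⌉₊ k ⌈δ / 10 * n⌉₊ ⌊(1 - 3 * δ) * n⌋₊ ⌊δ / 2 * n⌋₊
      ⌊δ ^ 2 / 800 * n ^ 2⌋₊ ⌊κ ^ 2 / 2 * n ^ 2⌋₊ ⌊δ ^ 2 / 2000 * n ^ 2⌋₊ := by
  have hb := basic h hl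
  have hr := rounded h hl
  have hp := ordered_tuned h hl
  have hδ := hb.δ_pos
  have hδ1 := hb.δ_le
  have hκ := hb.κ_pos
  have hD := hb.D_ge
  have hx := hb.x_ge
  have hx0 : (0 : ℝ) < n := by linarith
  have hxD := hl.x_D
  have hDκ := h.κ_eq
  set p := tuned ε e δ C D n with hpd
  set x : ℝ := (n : ℝ) with hxe
  set L := Real.log x
  have hT := hr.T_le
  have hδx : 100000 ≤ δ * x := by linarith
  have hT1 : (p.T : ℝ) ≤ δ ^ 2 / 20000 * x ^ 2 := by
    have := mul_le_mul_of_nonneg_right hl.x_δ hx0.le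
    nlinarith
  have hδ2 : δ ^ 2 ≤ 1 := by nlinarith
  have hm : δ * x / 27 ≤ p.m := by linarith [hr.m_ge]
  have hm2 : δ ^ 2 / 729 * x ^ 2 ≤ (p.m : ℝ) ^ 2 := by
    have h1 : 0 ≤ δ * x / 27 := by positivity
    calc _ = (δ * x / 27) ^ 2 := by ring
      _ ≤ _ := by gcongr
  have hμ := Nat.le_ceil (κ * x)
  have hμ' := (Nat.ceil_lt_add_one (show 0 ≤ κ * x by positivity)).le
  have hΔ := (Nat.ceil_lt_add_one (show 0 ≤ δ / 10 * x by positivity)).le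
  have f1 := Nat.floor_le (show 0 ≤ δ ^ 2 / 800 * x ^ 2 by positivity)
  have f2 := Nat.floor_le (show 0 ≤ κ ^ 2 / 2 * x ^ 2 by positivity)
  have f3 := Nat.floor_le (show 0 ≤ δ ^ 2 / 2000 * x ^ 2 by positivity)
  have f4 := Nat.floor_le (show 0 ≤ (1 - 3 * δ) * x from mul_nonneg (by linarith) hx0.le)
  have f5 := Nat.floor_le (show 0 ≤ δ / 2 * x by positivity)
  have hDμ : (D : ℝ) * (⌈κ * x⌉₊ : ℕ) ≤ δ * x / 900 + D := by
    calc (D : ℝ) * (⌈κ * x⌉₊ : ℕ) ≤ D * (κ * x + 1) := by gcongr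
      _ = D * κ * x + D := by ring
      _ = δ * x / 900 + D := by rw [show (D : ℝ) * κ = δ / 900 by linarith]; ring
  have hμD : ((⌈κ * x⌉₊ : ℕ) : ℝ) ≤ D * (⌈κ * x⌉₊ : ℕ) := le_mul_of_one_le_left (by positivity) hD
  have hs := hr.s_le
  have hs' := hr.s_ge
  have hpD : (p.D : ℝ) = D := rfl
  refine ⟨hp, ?_, ?_, ?_, ?_, ?_, h.D_eq, ?_, ?_, ?_, ?_, ?_⟩
  · have : (3 : ℝ) ≤ n := by linarith
    exact_mod_cast this
  · have h1 := hb.N_ge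
    have : 2 * (p.T : ℝ) ≤ numEdges n := by nlinarith only [h1, hT1, hδ2, sq_nonneg x]
    exact_mod_cast this
  · have : (1 : ℝ) ≤ p.m := by linarith
    exact_mod_cast this
  · have : 23 * (p.m : ℝ) ≤ p.s := by linarith [hr.m_le]
    exact_mod_cast this
  · have : (p.s : ℝ) ≤ n := by nlinarith only [hs, hδ1, hx0]
    exact_mod_cast this
  · have h1 : (p.τ₁ : ℝ) ≤ (C + 1) * x := by linarith [hr.τ₁_le]
    have h2 := mul_le_mul_of_nonneg_right hl.x_C hx0.le
    have : ((⌊δ ^ 2 / 800 * x ^ 2⌋₊ : ℕ) : ℝ) + p.τ₁ ≤ (p.m : ℝ) ^ 2 := by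
      have h3 : 0 ≤ δ ^ 2 * x ^ 2 := by positivity
      nlinarith only [f1, h1, h2, hm2, h3]
    exact_mod_cast this
  · have h1 : (p.τ₂ : ℝ) ≤ p.T := by exact_mod_cast hp.h₂₃.trans (hp.h₃₄.trans hp.h₄)
    have h2 := mul_le_mul_of_nonneg_right hl.x_κ hx0.le
    have h3 : κ ^ 2 * x ^ 2 ≤ ((⌈κ * x⌉₊ : ℕ) : ℝ) ^ 2 := by
      calc _ = (κ * x) ^ 2 := by ring
        _ ≤ _ := by gcongr
    have : ((⌊κ ^ 2 / 2 * x ^ 2⌋₊ : ℕ) : ℝ) + p.τ₂ ≤ ((⌈κ * x⌉₊ : ℕ) : ℝ) ^ 2 := by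
      nlinarith only [f2, h1, h2, h3, hT]
    exact_mod_cast this
  · have : 2 * (((⌊δ ^ 2 / 2000 * x ^ 2⌋₊ : ℕ) : ℝ) + p.T) ≤ ((p.m : ℝ) + 1) ^ 2 := by
      have h3 : 0 ≤ δ ^ 2 * x ^ 2 := by positivity
      have h4 : (0 : ℝ) ≤ p.m := by positivity
      nlinarith only [f3, hT1, hm2, h3, h4]
    exact_mod_cast this
  · have : (p.D : ℝ) * (3 * (⌈κ * x⌉₊ : ℕ)) + (⌈δ / 10 * x⌉₊ : ℕ) +
        (⌊(1 - 3 * δ) * x⌋₊ : ℕ) + p.s + 3 * (⌈κ * x⌉₊ : ℕ) ≤ n := by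
      rw [hpD]
      linarith only [hDμ, hμD, hΔ, f4, hs, hxD, hD]
    exact_mod_cast this
  · have : 90 * ((p.D : ℝ) * (⌈κ * x⌉₊ : ℕ)) + (⌈δ / 10 * x⌉₊ : ℕ) +
        (⌊δ / 2 * x⌋₊ : ℕ) + p.m ≤ p.s := by
      rw [hpD]
      linarith only [hDμ, hΔ, f5, hs', hr.m_le, hxD, hD]
    exact_mod_cast this

/-- The number of selected edges. -/
lemma budget_tuned (h : Constants ε e δ κ C k D)
    (hl : Constants.Large ε e δ κ C n (Real.log n) D) :
    ((⌈20000 * δ * n⌉₊ + n + 93 * ((tuned ε e δ C D n).D * ⌈κ * n⌉₊) +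
      2 * (tuned ε e δ C D n).s + 1 : ℕ) : ℝ) ≤ (1 + ε) * n := by
  have hb := basic h hl
  have hr := rounded h hl
  have hδ := hb.δ_pos
  have hκ := hb.κ_pos
  have hx0 : (0 : ℝ) < n := by linarith [hb.x_ge]
  have hxD := hl.x_D
  have hD := hb.D_ge
  have hμ' := (Nat.ceil_lt_add_one (show 0 ≤ κ * (n : ℝ) by positivity)).le
  have hM := (Nat.ceil_lt_add_one (show 0 ≤ 20000 * δ * (n : ℝ) by positivity)).le
  have hDμ : (D : ℝ) * (⌈κ * (n : ℝ)⌉₊ : ℕ) ≤ δ * n / 900 + D := by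
    calc (D : ℝ) * (⌈κ * (n : ℝ)⌉₊ : ℕ) ≤ D * (κ * n + 1) := by gcongr
      _ = D * κ * n + D := by ring
      _ = δ * n / 900 + D := by rw [show (D : ℝ) * κ = δ / 900 by linarith [h.κ_eq]]; ring
  have hpD : ((tuned ε e δ C D n).D : ℝ) = D := rfl
  have he : 1000000 * (δ * n) ≤ ε * n := by
    rw [← mul_assoc, h.δ_eq]
    exact mul_le_mul_of_nonneg_right h.e_le_eps hx0.le
  push_cast
  rw [hpD]
  linarith [hr.s_le]

end Params
end KChoice

namespace KChoice
open Finset Filter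
namespace Params
variable {ε e δ κ C : ℝ} {k D n : ℕ}

lemma log_le (h : Constants ε e δ κ C k D)
    (hl : Constants.Large ε e δ κ C n (Real.log n) D) : 20000 * Real.log n ≤ δ * n := by
  have hb := basic h hl
  have hδ := hb.δ_pos
  have hε := hb.ε_pos
  have hL := hl.L_ge
  have h1 : 20000 * Real.log n ≤ 20000 * ((1 + ε) * (Real.log n + 1)) := by nlinarith
  have h2 : δ ^ 2 * (n : ℝ) ≤ δ * n := by
    gcongr
    nlinarith [hb.δ_le]
  linarith [hl.x_δ]

/-- Bounds for the densities of the edges that make progress in each phase. -/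
structure Densities (δ κ C x N : ℝ) (n s k M Δ a₃ a₄ q₁ q₂ q₅ : ℕ) : Prop where
  q₁_ge : δ ^ 2 / 450 ≤ q₁ / N
  s_le : ((s ^ 2 : ℕ) : ℝ) / N ≤ 5 / 2 * δ ^ 2
  M_ge : 20000 * δ * x ≤ M
  n_le : (n : ℝ) / N ≤ 5 / (2 * x)
  Δ_ge : δ / 10 * x ≤ Δ
  q₂_ge : κ ^ 2 / 2 ≤ q₂ / N
  a₃_ge : 2 * (1 - 4 * δ) / x ≤ a₃ / N
  a₄_ge : 4 / 5 * (k * δ) / x ≤ ((k * a₄ : ℕ) : ℝ) / N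
  q₅_ge : δ ^ 2 / 1050 ≤ q₅ / N

lemma densities (h : Constants ε e δ κ C k D)
    (hl : Constants.Large ε e δ κ C n (Real.log n) D) :
    Densities δ κ C n (numEdges n) n (tuned ε e δ C D n).s k ⌈20000 * δ * n⌉₊ ⌈δ / 10 * n⌉₊
      ⌊(1 - 3 * δ) * n⌋₊ ⌊δ / 2 * n⌋₊ ⌊δ ^ 2 / 800 * n ^ 2⌋₊ ⌊κ ^ 2 / 2 * n ^ 2⌋₊
      ⌊δ ^ 2 / 2000 * n ^ 2⌋₊ := by
  have hb := basic h hl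
  have hr := rounded h hl
  have hδ := hb.δ_pos
  have hδ1 := hb.δ_le
  have hκ := hb.κ_pos
  have hx := hb.x_ge
  have hx0 : (0 : ℝ) < n := by linarith
  have hN2 := hb.N_le
  have hN3 := hb.N_ge
  have hN : (0 : ℝ) < numEdges n := by
    have : (0 : ℝ) < n ^ 2 := by positivity
    linarith
  have hxδ : 40000 ≤ δ ^ 2 * (n : ℝ) := by
    have := hl.x_δ
    have := hl.L_ge
    nlinarith [hb.ε_pos]
  have hxδ2 : 1000000 ≤ δ ^ 2 * (n : ℝ) ^ 2 := by nlinarith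
  have hxκ2 : 100 ≤ κ ^ 2 * (n : ℝ) ^ 2 := by nlinarith [hl.x_κ']
  have hδx : 100000 ≤ δ * (n : ℝ) := by
    have := hl.x_D
    linarith [hb.D_ge]
  have f1 := (Nat.sub_one_lt_floor (δ ^ 2 / 800 * (n : ℝ) ^ 2)).le
  have f2 := (Nat.sub_one_lt_floor (κ ^ 2 / 2 * (n : ℝ) ^ 2)).le
  have f3 := (Nat.sub_one_lt_floor (δ ^ 2 / 2000 * (n : ℝ) ^ 2)).le
  have f4 := (Nat.sub_one_lt_floor ((1 - 3 * δ) * (n : ℝ))).le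
  have f5 := (Nat.sub_one_lt_floor (δ / 2 * (n : ℝ))).le
  refine ⟨?_, div_le hN hN3 (by positivity) ?_, Nat.le_ceil _, ?_, Nat.le_ceil _, ?_,
    div_ge' hN hN2 (by linarith) hx0 (by linarith), ?_, ?_⟩
  · have := div_ge hN hN2 (c := δ ^ 2 / 900) (by positivity)
      (q := (⌊δ ^ 2 / 800 * (n : ℝ) ^ 2⌋₊ : ℕ)) (by linarith)
    linarith
  · push_cast
    calc _ ≤ (δ * (n : ℝ)) ^ 2 := by gcongr; exact hr.s_le
      _ = _ := by ring
  · rw [div_le_div_iff₀ hN (by positivity)]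
    linarith
  · have := div_ge hN hN2 (c := κ ^ 2 / 4) (by positivity)
      (q := (⌊κ ^ 2 / 2 * (n : ℝ) ^ 2⌋₊ : ℕ)) (by linarith)
    linarith
  · have := div_ge' hN hN2 (c := 2 / 5 * (k * δ)) (by positivity) hx0
      (q := ((k * ⌊δ / 2 * (n : ℝ)⌋₊ : ℕ) : ℝ)) (by
        push_cast
        calc 2 / 5 * (k * δ) * (n : ℝ) = k * (2 / 5 * δ * n) := by ring
          _ ≤ _ := by gcongr; linarith)
    convert this using 2
    ring
  · have := div_ge hN hN2 (c := δ ^ 2 / 2100) (by positivity)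
      (q := (⌊δ ^ 2 / 2000 * (n : ℝ) ^ 2⌋₊ : ℕ)) (by linarith)
    linarith

lemma exponent_reserve_join (h : Constants ε e δ κ C k D)
    (hl : Constants.Large ε e δ κ C n (Real.log n) D) {q : ℝ} (hq : δ ^ 2 / 450 ≤ q) :
    1.4 * ((tuned ε e δ C D n).s : ℝ) - 1 / 2 * q * (tuned ε e δ C D n).τ₁ ≤ -Real.log n := by
  have hb := basic h hl
  have hr := rounded h hl
  have hC := hb.C_pos
  have hδ := hb.δ_pos
  have h1 : 1 / 2 * (δ ^ 2 / 450) * (C * n) ≤ 1 / 2 * q * (tuned ε e δ C D n).τ₁ := by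
    have h0 : 0 ≤ q := le_trans (by positivity) hq
    gcongr
    exact hr.τ₁_ge
  have h2 : 1 / 2 * (δ ^ 2 / 450) * (C * n) = 2 * (δ * n) := by
    calc _ = (δ * C) * δ * n / 900 := by ring
      _ = _ := by rw [h.C_eq]; ring
  have h3 := log_le h hl
  linarith [hr.s_le]

lemma exponent_reserve_edges (h : Constants ε e δ κ C k D)
    (hl : Constants.Large ε e δ κ C n (Real.log n) D) {q M : ℝ} (hq : q ≤ 5 / 2 * δ ^ 2)
    (hM : 20000 * δ * n ≤ M) :
    -M + 4 * q * (tuned ε e δ C D n).τ₁ ≤ -Real.log n := by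
  have hb := basic h hl
  have hr := rounded h hl
  have hδ := hb.δ_pos
  have h1 : 4 * q * (tuned ε e δ C D n).τ₁ ≤ 4 * (5 / 2 * δ ^ 2) * (C * n + 1) := by
    gcongr
    exact hr.τ₁_le
  have h2 : 4 * (5 / 2 * δ ^ 2) * (C * n + 1) = 18000 * (δ * n) + 10 * δ ^ 2 := by
    calc _ = 10 * (δ * C) * δ * n + 10 * δ ^ 2 := by ring
      _ = _ := by rw [h.C_eq]; ring
  have h3 := log_le h hl
  have h4 : δ ^ 2 ≤ 1 := by nlinarith [hb.δ_le]
  have h5 := hl.L_ge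
  linarith

lemma exponent_degree (h : Constants ε e δ κ C k D)
    (hl : Constants.Large ε e δ κ C n (Real.log n) D) {q Δ : ℝ} (hq : q ≤ 5 / (2 * n))
    (hΔ : δ / 10 * n ≤ Δ) :
    Real.log n + (-Δ + 4 * q * (tuned ε e δ C D n).T) ≤ -Real.log n := by
  have hb := basic h hl
  have hr := rounded h hl
  have hδ := hb.δ_pos
  have hε := hb.ε_pos
  have hL := hl.L_ge
  have hx0 : (0 : ℝ) < n := by linarith [hb.x_ge]
  have h1 : 4 * q * (tuned ε e δ C D n).T ≤
      4 * (5 / (2 * n)) * ((1 + ε) * (Real.log n + 1) * n) := by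
    gcongr
    exact hr.T_le
  have h2 : 4 * (5 / (2 * n)) * ((1 + ε) * (Real.log n + 1) * n) =
      10 * ((1 + ε) * (Real.log n + 1)) := by
    field_simp
    ring
  have h3 : 20000 * ((1 + ε) * (Real.log n + 1)) ≤ δ * n := by
    refine hl.x_δ.trans ?_
    gcongr
    nlinarith [hb.δ_le]
  have h4 := log_le h hl
  have h5 : Real.log n ≤ (1 + ε) * (Real.log n + 1) := by nlinarith
  linarith

lemma exponent_outside_join (h : Constants ε e δ κ C k D)
    (hl : Constants.Large ε e δ κ C n (Real.log n) D) {q : ℝ} (hq : κ ^ 2 / 2 ≤ q) :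
    1.4 * (n : ℝ) - 1 / 2 * q * ((tuned ε e δ C D n).τ₂ - (tuned ε e δ C D n).τ₁) ≤
      -Real.log n := by
  have hb := basic h hl
  have hr := rounded h hl
  have hL := hl.L_ge
  have he := h.e_pos
  have h1 : 1 / 2 * (κ ^ 2 / 2) * (e / 8 * (n * Real.log n)) ≤
      1 / 2 * q * ((tuned ε e δ C D n).τ₂ - (tuned ε e δ C D n).τ₁) := by
    have h0 : 0 ≤ q := le_trans (by positivity) hq
    gcongr
    exact hr.τ₂_ge
  have h2 : 100 * (n : ℝ) ≤ κ ^ 2 * e * Real.log n * n := by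
    gcongr
    exact hl.L_lower'
  linarith [hb.L_le]

lemma exponent_cover (h : Constants ε e δ κ C k D)
    (hl : Constants.Large ε e δ κ C n (Real.log n) D) {q : ℝ} (hq : 2 * (1 - 4 * δ) / n ≤ q) :
    Real.log n - (1 - e / 10) * q * ((tuned ε e δ C D n).τ₃ - (tuned ε e δ C D n).τ₂) ≤
      -(e / 2 * Real.log n) := by
  have hb := basic h hl
  have hr := rounded h hl
  have hL := hl.L_ge
  have he := h.e_pos
  have he1 := h.e_le
  have hδ := h.δ_eq
  have hx0 : (0 : ℝ) < n := by linarith [hb.x_ge]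
  have h1 : (1 - e / 10) * (2 * (1 - 4 * δ) / n) * ((0.5 + e / 2) * (n * Real.log n)) ≤
      (1 - e / 10) * q * ((tuned ε e δ C D n).τ₃ - (tuned ε e δ C D n).τ₂) := by
    have h0 : 0 ≤ 1 - e / 10 := by linarith
    have h0' : 0 ≤ q := le_trans (div_nonneg (by linarith) hx0.le) hq
    gcongr
    exact hr.τ₃_ge
  have h2 : (1 - e / 10) * (2 * (1 - 4 * δ) / n) * ((0.5 + e / 2) * (n * Real.log n)) =
      (1 - e / 10) * (1 - 4 * δ) * (1 + e) * Real.log n := by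
    field_simp
    ring
  have h3 : 1 + e / 2 ≤ (1 - e / 10) * (1 - 4 * δ) * (1 + e) := by
    have h4 : δ = e / 1000000 := by linarith
    subst h4
    nlinarith [mul_pos he he, mul_pos (mul_pos he he) he]
  have h4 := mul_le_mul_of_nonneg_right h3 (zero_le_one.trans hL)
  linarith

lemma exponent_attach (h : Constants ε e δ κ C k D)
    (hl : Constants.Large ε e δ κ C n (Real.log n) D) {q : ℝ} (hq : 4 / 5 * (k * δ) / n ≤ q) :
    Real.log n - 1 / 2 * q * ((tuned ε e δ C D n).τ₄ - (tuned ε e δ C D n).τ₃) ≤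
      -Real.log n := by
  have hb := basic h hl
  have hr := rounded h hl
  have hL := hl.L_ge
  have he := h.e_pos
  have hδ := hb.δ_pos
  have hx0 : (0 : ℝ) < n := by linarith [hb.x_ge]
  have h1 : 1 / 2 * (4 / 5 * (k * δ) / n) * (e / 8 * (n * Real.log n)) ≤
      1 / 2 * q * ((tuned ε e δ C D n).τ₄ - (tuned ε e δ C D n).τ₃) := by
    have h0' : 0 ≤ q := le_trans (by positivity) hq
    gcongr
    exact hr.τ₄_ge
  have h2 : 1 / 2 * (4 / 5 * (k * δ) / n) * (e / 8 * (n * Real.log n)) =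
      (k * (δ * e)) * Real.log n / 20 := by
    field_simp
    ring
  have h3 := mul_le_mul_of_nonneg_right h.k_ge (zero_le_one.trans hL)
  linarith

lemma exponent_boosters (h : Constants ε e δ κ C k D)
    (hl : Constants.Large ε e δ κ C n (Real.log n) D) {q : ℝ} (hq : δ ^ 2 / 1050 ≤ q) :
    (n : ℝ) + 1 - 1 / 2 * q * ((tuned ε e δ C D n).T - (tuned ε e δ C D n).τ₄) ≤
      -Real.log n := by
  have hb := basic h hl
  have hr := rounded h hl
  have hL := hl.L_ge
  have he := h.e_pos
  have h1 : 1 / 2 * (δ ^ 2 / 1050) * (e / 8 * (n * Real.log n)) ≤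
      1 / 2 * q * ((tuned ε e δ C D n).T - (tuned ε e δ C D n).τ₄) := by
    have h0 : 0 ≤ q := le_trans (by positivity) hq
    gcongr
    exact hr.T_ge
  have h2 : 60000 * (n : ℝ) ≤ δ ^ 2 * e * Real.log n * n := by
    gcongr
    exact hl.L_lower
  linarith [hb.L_le, hb.x_ge]

/-- The failure probability of the tuned algorithm is a negative power of `n`. -/
theorem pr_tuned_not_success_le (h : Constants ε e δ κ C k D)
    (hl : Constants.Large ε e δ κ C n (Real.log n) D) :
    pr n (fun σ => ¬ (tuned ε e δ C D n).Success (⌈20000 * δ * n⌉₊ + n +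
        93 * ((tuned ε e δ C D n).D * ⌈κ * n⌉₊) + 2 * (tuned ε e δ C D n).s + 1)
        (hist σ (tuned ε e δ C D n).T)) ≤
      7 * Real.exp ((Real.log (10 / e) + 30) * D - e / 2 * Real.log n) := by
  have hb := basic h hl
  have hd := densities h hl
  have he := h.e_pos
  have he1 := h.e_le
  have hL := hl.L_ge
  have hx0 : (0 : ℝ) < n := by linarith [hb.x_ge]
  have hpD : ((tuned ε e δ C D n).D : ℝ) = D := rfl
  have hlog : 0 ≤ Real.log (10 / e) :=
    Real.log_nonneg (by rw [le_div_iff₀ he]; linarith)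
  have hexp : Real.exp (-Real.log (10 / e)) = e / 10 := by
    rw [Real.exp_neg, Real.exp_log (by positivity), inv_div]
  have hn : ∀ y, (n : ℝ) * Real.exp y = Real.exp (Real.log n + y) := fun y => by
    rw [Real.exp_add, Real.exp_log hx0]
  have h4 : ∀ (s : ℕ) y, (4 : ℝ) ^ s * Real.exp y ≤ Real.exp (1.4 * s + y) := fun s y => by
    rw [Real.exp_add]
    gcongr
    exact four_pow_le s
  have hD : 0 ≤ Real.log (10 / e) * D := by positivity
  have hD' : (0 : ℝ) ≤ D := by positivity
  have heL : e / 2 * Real.log n ≤ Real.log n := by nlinarith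
  refine (pr_not_success_le (admissible_tuned h hl) hlog).trans ?_
  rw [hexp, hpD]
  set y := (Real.log (10 / e) + 30) * D - e / 2 * Real.log n with hy
  have hLy : -Real.log n ≤ y := by linarith
  have hsum : 7 * Real.exp y = Real.exp y + Real.exp y + Real.exp y + Real.exp y + Real.exp y +
      Real.exp y + Real.exp y := by ring
  rw [hsum]
  refine add_le_add (add_le_add (add_le_add (add_le_add (add_le_add (add_le_add
    ((h4 _ _).trans ?_) ?_) ((hn _).le.trans ?_)) ((h4 _ _).trans ?_)) ((hn _).le.trans ?_))
    ((hn _).le.trans ?_)) ?_ <;> refine Real.exp_le_exp.2 ?_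
  · linarith [exponent_reserve_join h hl hd.q₁_ge]
  · exact (exponent_reserve_edges h hl hd.s_le hd.M_ge).trans hLy
  · exact (exponent_degree h hl hd.n_le hd.Δ_ge).trans hLy
  · linarith [exponent_outside_join h hl hd.q₂_ge]
  · linarith [exponent_cover h hl hd.a₃_ge]
  · linarith [exponent_attach h hl hd.a₄_ge]
  · exact (exponent_boosters h hl hd.q₅_ge).trans hLy

lemma tendsto_failure_bound (he : 0 < e) (K : ℝ) :
    Tendsto (fun n : ℕ => 7 * Real.exp (K - e / 2 * Real.log n)) atTop (nhds 0) := by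
  have h1 : Tendsto (fun n : ℕ => Real.log n) atTop atTop :=
    Real.tendsto_log_atTop.comp tendsto_natCast_atTop_atTop
  have h2 : Tendsto (fun n : ℕ => K - e / 2 * Real.log n) atTop atBot :=
    tendsto_atBot_add_const_left _ K (tendsto_neg_atTop_atBot.comp
      (h1.const_mul_atTop (half_pos he)))
  simpa using (Real.tendsto_exp_atBot.comp h2).const_mul 7

end Params
end KChoice

open KChoice Filter

/-- the case `K = 1`: the random graph process.  For every `ε > 0`
there is an online algorithm which w.h.p., within the first `⌈(0.5 + ε)·n·log n⌉` steps
of the random graph process, has selected at most `(1 + ε)·n` edges, and the graph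
spanned by the selected edges is Hamiltonian.  (This refutes the conjecture of
Frieze, Krivelevich and Michaeli.) -/
theorem hamiltonian_in_random_graph_process (ε : ℝ) (hε : 0 < ε) :
    ∃ A : (n : ℕ) → Alg n,
      Tendsto
        (fun n : ℕ =>
          pr n (fun σ =>
            ((selected n 1 (A n) σ ⌈(0.5 + ε) * n * Real.log n⌉₊).card : ℝ) ≤
                (1 + ε) * n ∧
              (Bgraph n 1 (A n) σ ⌈(0.5 + ε) * n * Real.log n⌉₊).IsHamiltonian))
        atTop (nhds 1) := by
  obtain ⟨e, δ, κ, C, k, D, h⟩ := exists_constants hε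
  refine ⟨fun n => follow (Params.tuned ε e δ C D n).sel, ?_⟩
  have hlim := (Params.tendsto_failure_bound h.e_pos ((Real.log (10 / e) + 30) * D)).const_sub 1
  rw [sub_zero] at hlim
  refine tendsto_of_tendsto_of_tendsto_of_le_of_le' hlim tendsto_const_nhds ?_
    (Eventually.of_forall fun n => pr_le_one n _)
  filter_upwards [h.eventually_large] with n hl
  have hfail := Params.pr_tuned_not_success_le h hl
  rw [pr_not] at hfail
  refine (sub_le_comm.1 hfail).trans (pr_mono fun σ hσ => ?_)
  have hA := Params.admissible_tuned h hl
  have hsel := selected_follow (Params.tuned ε e δ C D n).sel (Params.sel_nil _)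
    (Params.sel_subset_append _) (Params.sel_append_subset _) σ
    (t := (Params.tuned ε e δ C D n).T) (by have := hA.time; omega)
  change ((selected n 1 _ σ (Params.tuned ε e δ C D n).T).card : ℝ) ≤ _ ∧
    (Bgraph n 1 _ σ (Params.tuned ε e δ C D n).T).IsHamiltonian
  rw [Bgraph, hsel]
  exact ⟨(Nat.cast_le.2 hσ.1).trans (Params.budget_tuned h hl), hσ.2⟩
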